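/- arXiv:0907.1958 — 3 statements merged into one kernel-verified Lean document; each statement's English description precedes it below -/
import Mathlib

section
/- Let G be a finite simple graph with |V(G)| ≥ 3 and let γ be an automorphism of G with γ³ = id. If there exists a (C₃,Φ) construction sequence for (G,γ), then G has a proper (C₃,γ) 3Tree2 partition. -/
open Matrix

noncomputable section

namespace C3Laman

variable {V : Type*} [Fintype V] [DecidableEq V]

/-- A 3Tree2 partition of `G`: three subtrees of `G` such that every edge of `G` lies in
exactly one of them, and every vertex of `G` lies in exactly two of them. -/
def Is3Tree2Partition (G : SimpleGraph V) (T : Fin 3 → G.Subgraph) : Prop :=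
  (∀ i, (T i).coe.IsTree) ∧
  (∀ e ∈ G.edgeSet, ∃! i : Fin 3, e ∈ (T i).edgeSet) ∧
  ∀ v : V, ({i : Fin 3 | v ∈ (T i).verts}).ncard = 2

/-- A proper 3Tree2 partition: no non-trivial subtrees of distinct trees have the same
vertex set. -/
def IsProper3Tree2Partition (G : SimpleGraph V) (T : Fin 3 → G.Subgraph) : Prop :=
  Is3Tree2Partition G T ∧
  ∀ i j : Fin 3, i ≠ j → ∀ Si Sj : G.Subgraph, Si ≤ T i → Sj ≤ T j →
    Si.coe.IsTree → Sj.coe.IsTree →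
    2 ≤ Si.verts.ncard → 2 ≤ Sj.verts.ncard → Si.verts ≠ Sj.verts

/-- A `(C₃, γ)` 3Tree2 partition: a 3Tree2 partition with `γ(Tᵢ) = T_{i+1}` (mod 3). -/
def IsC3_3Tree2Partition (G : SimpleGraph V) (γ : G ≃g G) (T : Fin 3 → G.Subgraph) : Prop :=
  Is3Tree2Partition G T ∧ ∀ i : Fin 3, (T i).map γ.toHom = T (i + 1)

/-- `H'` is a `(C₃, γ)` vertex addition of `H` (with vertex set `S`) by the new
vertices `v, w, z`. -/
def VertexAdditionStep (γ : V → V) (S : Finset V) (H H' : SimpleGraph V)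
    (v w z : V) : Prop :=
  ∃ v₁ ∈ S, ∃ v₂ ∈ S, v₁ ≠ v₂ ∧
    H'.edgeSet = H.edgeSet ∪
      {s(v, v₁), s(v, v₂), s(w, γ v₁), s(w, γ v₂), s(z, γ (γ v₁)), s(z, γ (γ v₂))}

/-- `H'` is a `(C₃, γ)` edge split of `H` (with vertex set `S`) by the new
vertices `v, w, z`. -/
def EdgeSplitStep (γ : V → V) (S : Finset V) (H H' : SimpleGraph V)
    (v w z : V) : Prop :=
  ∃ v₁ ∈ S, ∃ v₂ ∈ S, ∃ v₃ ∈ S, v₁ ≠ v₂ ∧ v₂ ≠ v₃ ∧ v₁ ≠ v₃ ∧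
    H.Adj v₁ v₂ ∧ ¬(γ v₁ = v₁ ∧ γ v₂ = v₂) ∧
    H'.edgeSet = (H.edgeSet \ {s(v₁, v₂), s(γ v₁, γ v₂), s(γ (γ v₁), γ (γ v₂))}) ∪
      {s(v, v₁), s(v, v₂), s(v, v₃),
       s(w, γ v₁), s(w, γ v₂), s(w, γ v₃),
       s(z, γ (γ v₁)), s(z, γ (γ v₂)), s(z, γ (γ v₃))}

/-- `H'` is a `(C₃, γ)` Δ extension of `H` (with vertex set `S`) by the new
vertices `v, w, z`. -/
def DeltaExtensionStep (γ : V → V) (S : Finset V) (H H' : SimpleGraph V)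
    (v w z : V) : Prop :=
  ∃ v₀ ∈ S, γ v₀ ≠ v₀ ∧
    H'.edgeSet = H.edgeSet ∪
      {s(v, w), s(w, z), s(z, v), s(v, v₀), s(w, γ v₀), s(z, γ (γ v₀))}

/-- A `(C₃, Φ)` construction sequence for `(G, γ)`:  a sequence of graphs `H i` on the
vertex sets `S i ⊆ V(G)`, starting with a triangle `K₃` on which `γ` acts as a 3-cycle,
each graph obtained from its predecessor by a `(C₃, γᵢ)` vertex addition, edge split, or
Δ extension by three new vertices permuted cyclically by `γ` (here `γᵢ` is the
restriction of `γ` to `S i`, which is required to be an automorphism of `H i`),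
and ending with `G` itself. -/
def C3ConstructionSeq (G : SimpleGraph V) (γ : V → V) : Prop :=
  ∃ (k : ℕ) (S : ℕ → Finset V) (H : ℕ → SimpleGraph V),
    (S 0).card = 3 ∧
    (∀ a b, (H 0).Adj a b ↔ a ∈ S 0 ∧ b ∈ S 0 ∧ a ≠ b) ∧
    (∀ u ∈ S 0, γ u ∈ S 0 ∧ γ u ≠ u) ∧
    (∀ i ≤ k,
      (∀ u ∈ S i, γ u ∈ S i) ∧
      (∀ a b, (H i).Adj a b → a ∈ S i ∧ b ∈ S i) ∧
      (∀ a b, (H i).Adj a b → (H i).Adj (γ a) (γ b))) ∧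
    (∀ i < k, ∃ v w z : V,
      v ∉ S i ∧ w ∉ S i ∧ z ∉ S i ∧ v ≠ w ∧ w ≠ z ∧ v ≠ z ∧
      γ v = w ∧ γ w = z ∧ γ z = v ∧
      S (i + 1) = S i ∪ {v, w, z} ∧
      (VertexAdditionStep γ (S i) (H i) (H (i + 1)) v w z ∨
       EdgeSplitStep γ (S i) (H i) (H (i + 1)) v w z ∨
       DeltaExtensionStep γ (S i) (H i) (H (i + 1)) v w z)) ∧
    S k = Finset.univ ∧ H k = G

/-- Edges of `E` spanned by `U`. -/
def Ins {V : Type*} (E : Set (Sym2 V)) (U : Finset V) : Set (Sym2 V) :=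
  {e | e ∈ E ∧ ∀ x ∈ e, x ∈ U}

/-- (2,3)-sparsity (with truncated subtraction). -/
def Sparse {V : Type*} (E : Set (Sym2 V)) : Prop :=
  ∀ U : Finset V, (Ins E U).ncard ≤ 2 * U.card - 3

section sparse

variable {V : Type*} [Fintype V] [DecidableEq V]

theorem Sparse.mono {E E' : Set (Sym2 V)} (h : Sparse E) (hs : E' ⊆ E) : Sparse E' := fun U =>
  le_trans (Set.ncard_le_ncard (t := Ins E U) (fun _ he => ⟨hs he.1, he.2⟩) (Set.toFinite _)) (h U)

theorem sparse_core {E E' : Set (Sym2 V)} (h : Sparse E) (v : V)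
    (h1 : ∀ e ∈ E', v ∉ e → e ∈ E)
    (h2 : ∀ U : Finset V, v ∈ U → (Ins E' U).ncard ≤ (Ins E (U.erase v)).ncard + 2)
    (h3 : ∀ e ∈ E', v ∈ e → ∃ x, x ≠ v ∧ e = s(v, x)) : Sparse E' := by
  intro U
  by_cases hv : v ∈ U
  · have hc : (U.erase v).card + 1 = U.card := Finset.card_erase_add_one hv
    rcases Nat.lt_or_ge (U.erase v).card 2 with hlt | hge
    · interval_cases hn : (U.erase v).card
      · rw [Finset.card_eq_zero] at hn
        have : Ins E' U = ∅ := by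
          rw [Set.eq_empty_iff_forall_notMem]
          rintro e ⟨he, heU⟩
          by_cases hve : v ∈ e
          · obtain ⟨x, hx, rfl⟩ := h3 e he hve
            have : x ∈ U.erase v := Finset.mem_erase.2 ⟨hx, heU x (by simp)⟩
            rw [hn] at this; simp at this
          · induction e using Sym2.ind with | h a b =>
            have : a ∈ U.erase v := Finset.mem_erase.2
              ⟨by rintro rfl; simp at hve, heU a (by simp)⟩
            rw [hn] at this; simp at this
        rw [this]; simp
      · obtain ⟨u, hu⟩ := Finset.card_eq_one.1 hn
        have hE := h {u}
        have hE0 : Ins E {u} = ∅ := by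
          rw [← Set.ncard_eq_zero (Set.toFinite _)]; simpa using hE
        have : Ins E' U ⊆ {s(v, u)} := by
          rintro e ⟨he, heU⟩
          by_cases hve : v ∈ e
          · obtain ⟨x, hx, rfl⟩ := h3 e he hve
            have : x ∈ U.erase v := Finset.mem_erase.2 ⟨hx, heU x (by simp)⟩
            rw [hu, Finset.mem_singleton] at this
            simp [this]
          · exfalso
            have : e ∈ Ins E {u} := ⟨h1 e he hve, fun x hx => by
              rw [← hu]
              exact Finset.mem_erase.2 ⟨by rintro rfl; exact hve hx, heU x hx⟩⟩
            rw [hE0] at this; exact this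
        have h4 := Set.ncard_le_ncard this (Set.toFinite _)
        rw [Set.ncard_singleton] at h4
        omega
    · have := h2 U hv
      have := h (U.erase v)
      omega
  · refine le_trans (Set.ncard_le_ncard ?_ (Set.toFinite _)) (h U)
    rintro e ⟨he, heU⟩
    exact ⟨h1 e he (fun hve => hv (heU v hve)), heU⟩

theorem ncard_insert2 {α : Type*} [Finite α] (a b : α) (X : Set α) :
    (insert a (insert b X)).ncard ≤ X.ncard + 2 :=
  (Set.ncard_insert_le _ _).trans (by have := Set.ncard_insert_le b X; omega)

theorem Sparse.ext0 {E : Set (Sym2 V)} (h : Sparse E) {v a b : V}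
    (hv : ∀ e ∈ E, v ∉ e) (ha : a ≠ v) (hb : b ≠ v) :
    Sparse (E ∪ {s(v, a), s(v, b)}) := by
  refine sparse_core h v ?_ ?_ ?_
  · rintro e (he | rfl | rfl) hve
    · exact he
    · simp at hve
    · simp at hve
  · intro U hU
    refine (Set.ncard_le_ncard ?_ (Set.toFinite _)).trans (ncard_insert2 s(v, a) s(v, b) _)
    rintro e ⟨he | rfl | rfl, heU⟩
    · exact Or.inr (Or.inr ⟨he, fun x hx => Finset.mem_erase.2
        ⟨by rintro rfl; exact hv e he hx, heU x hx⟩⟩)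
    · exact Or.inl rfl
    · exact Or.inr (Or.inl rfl)
  · rintro e (he | rfl | rfl) hve
    · exact absurd hve (hv e he)
    · exact ⟨a, ha, rfl⟩
    · exact ⟨b, hb, rfl⟩

theorem Sparse.ext1 {E : Set (Sym2 V)} (h : Sparse E) {v a b c : V}
    (hv : ∀ e ∈ E, v ∉ e) (hab : s(a, b) ∈ E) (hc : c ≠ v) :
    Sparse ((E \ {s(a, b)}) ∪ {s(v, a), s(v, b), s(v, c)}) := by
  have ha : a ≠ v := by rintro rfl; exact hv _ hab (by simp)
  have hb : b ≠ v := by rintro rfl; exact hv _ hab (by simp)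
  refine sparse_core h v ?_ ?_ ?_
  · rintro e (he | rfl | rfl | rfl) hve
    · exact he.1
    · simp at hve
    · simp at hve
    · simp at hve
  · intro U hU
    have hold : ∀ e ∈ E, (∀ x ∈ e, x ∈ U) → e ∈ Ins E (U.erase v) := fun e he heU =>
      ⟨he, fun x hx => Finset.mem_erase.2 ⟨by rintro rfl; exact hv e he hx, heU x hx⟩⟩
    by_cases haU : a ∈ U
    · by_cases hbU : b ∈ U
      · have hmem : s(a, b) ∈ Ins E (U.erase v) := hold _ hab (by simp [haU, hbU])
        have h5 := Set.ncard_sdiff_singleton_add_one hmem (Set.toFinite _)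
        have h6 := ncard_insert2 s(v, a) s(v, b) (insert s(v, c) (Ins E (U.erase v) \ {s(a, b)}))
        have h7 := Set.ncard_insert_le s(v, c) (Ins E (U.erase v) \ {s(a, b)})
        have h8 : (Ins ((E \ {s(a, b)}) ∪ {s(v, a), s(v, b), s(v, c)}) U).ncard ≤ _ :=
          Set.ncard_le_ncard (t := (insert s(v, a) (insert s(v, b)
            (insert s(v, c) (Ins E (U.erase v) \ {s(a, b)}))))) (by
            rintro e ⟨he | rfl | rfl | rfl, heU⟩
            · exact Or.inr (Or.inr (Or.inr ⟨hold e he.1 heU, he.2⟩))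
            · simp
            · simp
            · simp) (Set.toFinite _)
        omega
      · refine (Set.ncard_le_ncard ?_ (Set.toFinite _)).trans (ncard_insert2 s(v, a) s(v, c) _)
        rintro e ⟨he | rfl | rfl | rfl, heU⟩
        · exact Or.inr (Or.inr (hold e he.1 heU))
        · simp
        · exact absurd (heU b (by simp)) hbU
        · simp
    · refine (Set.ncard_le_ncard ?_ (Set.toFinite _)).trans (ncard_insert2 s(v, b) s(v, c) _)
      rintro e ⟨he | rfl | rfl | rfl, heU⟩
      · exact Or.inr (Or.inr (hold e he.1 heU))
      · exact absurd (heU a (by simp)) haU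
      · simp
      · simp
  · rintro e (he | rfl | rfl | rfl) hve
    · exact absurd hve (hv e he.1)
    · exact ⟨a, ha, rfl⟩
    · exact ⟨b, hb, rfl⟩
    · exact ⟨c, hc, rfl⟩

end sparse

section steps

variable {V : Type*} [Fintype V] [DecidableEq V]

theorem sparse_VA {γ : V → V} {S : Finset V} {H H' : SimpleGraph V} {v w z : V}
    (hS : ∀ u ∈ S, γ u ∈ S) (hH : ∀ a b, H.Adj a b → a ∈ S ∧ b ∈ S)
    (hv : v ∉ S) (hw : w ∉ S) (hz : z ∉ S) (hvw : v ≠ w) (hwz : w ≠ z) (hvz : v ≠ z)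
    (hst : VertexAdditionStep γ S H H' v w z) (h : Sparse H.edgeSet) : Sparse H'.edgeSet := by
  obtain ⟨a, ha, b, hb, hab, hE⟩ := hst
  have hHe : ∀ e ∈ H.edgeSet, ∀ x ∈ e, x ∈ S := by
    intro e he; induction e using Sym2.ind with | h p q =>
    have := hH p q he
    simp [this]
  have ha1 := hS a ha
  have ha2 := hS _ ha1
  have hb1 := hS b hb
  have hb2 := hS _ hb1
  have hne : ∀ x ∈ S, ∀ y, y ∉ S → x ≠ y := fun x hx y hy hxy => hy (hxy ▸ hx)
  have s1 := h.ext0 (v := v) (a := a) (b := b) (fun e he hx => hv (hHe e he _ hx))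
    (hne _ ha _ hv) (hne _ hb _ hv)
  have s2 := s1.ext0 (v := w) (a := γ a) (b := γ b) (by
    rintro e (he | rfl | rfl)
    · exact fun hx => hw (hHe e he _ hx)
    all_goals simp only [Sym2.mem_iff]; grind) (hne _ ha1 _ hw) (hne _ hb1 _ hw)
  have s3 := s2.ext0 (v := z) (a := γ (γ a)) (b := γ (γ b)) (by
    rintro e ((he | rfl | rfl) | rfl | rfl)
    · exact fun hx => hz (hHe e he _ hx)
    all_goals simp only [Sym2.mem_iff]; grind) (hne _ ha2 _ hz) (hne _ hb2 _ hz)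
  refine s3.mono ?_
  rw [hE]
  intro e he
  simp only [Set.mem_union, Set.mem_insert_iff, Set.mem_singleton_iff] at he ⊢
  tauto

theorem sparse_ES {γ : V → V} (hγ : ∀ x, γ (γ (γ x)) = x)
    {S : Finset V} {H H' : SimpleGraph V} {v w z : V}
    (hS : ∀ u ∈ S, γ u ∈ S) (hH : ∀ a b, H.Adj a b → a ∈ S ∧ b ∈ S)
    (hHγ : ∀ a b, H.Adj a b → H.Adj (γ a) (γ b))
    (hv : v ∉ S) (hw : w ∉ S) (hz : z ∉ S) (hvw : v ≠ w) (hwz : w ≠ z) (hvz : v ≠ z)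
    (hst : EdgeSplitStep γ S H H' v w z) (h : Sparse H.edgeSet) : Sparse H'.edgeSet := by
  obtain ⟨a, ha, b, hb, c, hc, hab, hbc, hac, hadj, hfix, hE⟩ := hst
  have hHe : ∀ e ∈ H.edgeSet, ∀ x ∈ e, x ∈ S := by
    intro e he; induction e using Sym2.ind with | h p q =>
    have := hH p q he
    simp [this]
  have ha1 := hS a ha
  have ha2 := hS _ ha1
  have hb1 := hS b hb
  have hb2 := hS _ hb1
  have hc1 := hS c hc
  have hc2 := hS _ hc1
  have hadj1 := hHγ _ _ hadj
  have hadj2 := hHγ _ _ hadj1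
  have hne : ∀ x ∈ S, ∀ y, y ∉ S → x ≠ y := fun x hx y hy hxy => hy (hxy ▸ hx)
  have e12 : s(γ a, γ b) ≠ s(a, b) := by
    rw [Ne, Sym2.eq_iff]; grind
  have e23 : s(γ (γ a), γ (γ b)) ≠ s(γ a, γ b) := by
    rw [Ne, Sym2.eq_iff]; grind
  have e13 : s(γ (γ a), γ (γ b)) ≠ s(a, b) := by
    rw [Ne, Sym2.eq_iff]; grind
  have s1 := h.ext1 (v := v) (a := a) (b := b) (c := c) (fun e he hx => hv (hHe e he _ hx))
    hadj (hne _ hc _ hv)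
  have s2 := s1.ext1 (v := w) (a := γ a) (b := γ b) (c := γ c) (by
    rintro e (he | rfl | rfl | rfl)
    · exact fun hx => hw (hHe e he.1 _ hx)
    all_goals simp only [Sym2.mem_iff]; grind) (Or.inl ⟨hadj1, e12⟩) (hne _ hc1 _ hw)
  have s3 := s2.ext1 (v := z) (a := γ (γ a)) (b := γ (γ b)) (c := γ (γ c)) (by
    rintro e (⟨he | rfl | rfl | rfl, -⟩ | rfl | rfl | rfl)
    · exact fun hx => hz (hHe e he.1 _ hx)
    all_goals simp only [Sym2.mem_iff]; grind) (Or.inl ⟨Or.inl ⟨hadj2, e13⟩, e23⟩) (hne _ hc2 _ hz)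
  refine s3.mono ?_
  rw [hE]
  have key : ∀ x y p q : V, x ∉ S → p ∈ S → q ∈ S → s(x, y) ≠ s(p, q) := by
    intro x y p q hx hp hq
    rw [Ne, Sym2.eq_iff]; grind
  rintro e (⟨he, hn⟩ | rfl | rfl | rfl | rfl | rfl | rfl | rfl | rfl | rfl)
  · simp only [Set.mem_union, Set.mem_insert_iff, Set.mem_singleton_iff, Set.mem_sdiff] at he hn ⊢
    tauto
  all_goals
    simp only [Set.mem_union, Set.mem_insert_iff, Set.mem_singleton_iff, Set.mem_sdiff]
    simp [key _ _ _ _ hv ha2 hb2, key _ _ _ _ hw ha2 hb2, key _ _ _ _ hv ha1 hb1]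

theorem sparse_DE {γ : V → V} (hγ : ∀ x, γ (γ (γ x)) = x)
    {S : Finset V} {H H' : SimpleGraph V} {v w z : V}
    (hS : ∀ u ∈ S, γ u ∈ S) (hH : ∀ a b, H.Adj a b → a ∈ S ∧ b ∈ S)
    (hv : v ∉ S) (hw : w ∉ S) (hz : z ∉ S) (hvw : v ≠ w) (hwz : w ≠ z) (hvz : v ≠ z)
    (hst : DeltaExtensionStep γ S H H' v w z) (h : Sparse H.edgeSet) : Sparse H'.edgeSet := by
  obtain ⟨a, ha, hfix, hE⟩ := hst
  have hHe : ∀ e ∈ H.edgeSet, ∀ x ∈ e, x ∈ S := by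
    intro e he; induction e using Sym2.ind with | h p q =>
    have := hH p q he
    simp [this]
  have ha1 := hS a ha
  have ha2 := hS _ ha1
  have hne : ∀ x ∈ S, ∀ y, y ∉ S → x ≠ y := fun x hx y hy hxy => hy (hxy ▸ hx)
  have s1 := h.ext0 (v := v) (a := a) (b := γ (γ a)) (fun e he hx => hv (hHe e he _ hx))
    (hne _ ha _ hv) (hne _ ha2 _ hv)
  have s2 := s1.ext0 (v := w) (a := γ a) (b := v) (by
    rintro e (he | rfl | rfl)
    · exact fun hx => hw (hHe e he _ hx)
    all_goals simp only [Sym2.mem_iff]; grind) (hne _ ha1 _ hw) hvw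
  have s3 := s2.ext1 (v := z) (a := v) (b := γ (γ a)) (c := w) (by
    rintro e ((he | rfl | rfl) | rfl | rfl)
    · exact fun hx => hz (hHe e he _ hx)
    all_goals simp only [Sym2.mem_iff]; grind) (Or.inl (Or.inr (Or.inr rfl))) hwz
  refine s3.mono ?_
  rw [hE]
  have n1 : ∀ e ∈ H.edgeSet, e ≠ s(v, γ (γ a)) := by
    rintro e he rfl
    exact hv (hHe _ he v (by simp))
  have n2 : s(v, w) ≠ s(v, γ (γ a)) := by rw [Ne, Sym2.eq_iff]; grind
  have n3 : s(v, a) ≠ s(v, γ (γ a)) := by rw [Ne, Sym2.eq_iff]; grind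
  have n4 : s(w, γ a) ≠ s(v, γ (γ a)) := by rw [Ne, Sym2.eq_iff]; grind
  rintro e (he | rfl | rfl | rfl | rfl | rfl | rfl)
  · exact Or.inl ⟨Or.inl (Or.inl he), n1 e he⟩
  · exact Or.inl ⟨Or.inr (Or.inr Sym2.eq_swap), n2⟩
  · exact Or.inr (Or.inr (Or.inr Sym2.eq_swap))
  · exact Or.inr (Or.inl rfl)
  · exact Or.inl ⟨Or.inl (Or.inr (Or.inl rfl)), n3⟩
  · exact Or.inl ⟨Or.inr (Or.inl rfl), n4⟩
  · exact Or.inr (Or.inr (Or.inl rfl))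

end steps

/-- `(A, F)` is a tree with vertex set `A` and edge set `F`. -/
structure TreeOn {V : Type*} (A : Finset V) (F : Finset (Sym2 V)) : Prop where
  ne : A.Nonempty
  inc : ∀ e ∈ F, ∀ x ∈ e, x ∈ A
  card : F.card + 1 ≤ A.card
  conn : ∀ x ∈ A, ∀ y ∈ A, Relation.ReflTransGen (fun a b => s(a, b) ∈ F) x y

/-- Exactly two of `x, γ x, γ² x` lie in `A`. -/
def Two {V : Type*} (γ : V → V) (A : Finset V) (x : V) : Prop :=
  (x ∈ A ∧ γ x ∈ A ∧ γ (γ x) ∉ A) ∨ (x ∈ A ∧ γ x ∉ A ∧ γ (γ x) ∈ A) ∨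
    (x ∉ A ∧ γ x ∈ A ∧ γ (γ x) ∈ A)

/-- The invariant: a tree whose `γ`-orbit is a 3Tree2 partition. -/
structure Inv {V : Type*} (γ : V → V) (S : Finset V) (E : Set (Sym2 V)) (A : Finset V)
    (F : Finset (Sym2 V)) : Prop where
  tree : TreeOn A F
  sub : A ⊆ S
  two : ∀ x ∈ S, Two γ A x
  cov : ∀ e, e ∈ E ↔ e ∈ F ∨ Sym2.map γ e ∈ F ∨ Sym2.map γ (Sym2.map γ e) ∈ F
  dis : ∀ e ∈ F, Sym2.map γ e ∉ F

section trees

variable {V : Type*} [DecidableEq V]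

theorem rtg_symm {F : Finset (Sym2 V)} {x y : V}
    (h : Relation.ReflTransGen (fun a b => s(a, b) ∈ F) x y) :
    Relation.ReflTransGen (fun a b => s(a, b) ∈ F) y x := by
  induction h with
  | refl => exact .refl
  | tail _ hbc ih => exact .head (by rw [Sym2.eq_swap]; exact hbc) ih

theorem conn_of {A : Finset V} {F : Finset (Sym2 V)} (a : V)
    (h : ∀ x ∈ A, Relation.ReflTransGen (fun a b => s(a, b) ∈ F) x a) :
    ∀ x ∈ A, ∀ y ∈ A, Relation.ReflTransGen (fun a b => s(a, b) ∈ F) x y :=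
  fun x hx y hy => (h x hx).trans (rtg_symm (h y hy))

theorem TreeOn.leaf {A : Finset V} {F : Finset (Sym2 V)} (h : TreeOn A F) {a v : V}
    (ha : a ∈ A) (hv : v ∉ A) : TreeOn (insert v A) (insert s(v, a) F) where
  ne := by simp
  inc := by
    intro e he x hx
    rcases Finset.mem_insert.1 he with rfl | he
    · rcases Sym2.mem_iff.1 hx with rfl | rfl <;> simp [ha]
    · exact Finset.mem_insert_of_mem (h.inc e he x hx)
  card := by
    rw [Finset.card_insert_of_notMem hv]
    have := Finset.card_insert_le s(v, a) F
    have := h.card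
    omega
  conn := by
    apply conn_of a
    intro x hx
    rcases Finset.mem_insert.1 hx with rfl | hx
    · exact .single (by simp)
    · exact Relation.ReflTransGen.mono (fun p q hpq => Finset.mem_insert_of_mem hpq) _ _ (h.conn x hx a ha)

theorem TreeOn.subdiv {A : Finset V} {F : Finset (Sym2 V)} (h : TreeOn A F) {a b v : V}
    (hab : s(a, b) ∈ F) (hv : v ∉ A) :
    TreeOn (insert v A) (insert s(v, a) (insert s(v, b) (F.erase s(a, b)))) := by
  have ha : a ∈ A := h.inc _ hab a (by simp)
  have hb : b ∈ A := h.inc _ hab b (by simp)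
  refine ⟨by simp, ?_, ?_, ?_⟩
  · intro e he x hx
    rcases Finset.mem_insert.1 he with rfl | he
    · rcases Sym2.mem_iff.1 hx with rfl | rfl <;> simp [ha]
    rcases Finset.mem_insert.1 he with rfl | he
    · rcases Sym2.mem_iff.1 hx with rfl | rfl <;> simp [hb]
    · exact Finset.mem_insert_of_mem (h.inc e (Finset.mem_of_mem_erase he) x hx)
  · rw [Finset.card_insert_of_notMem hv]
    have := Finset.card_insert_le s(v, a) (insert s(v, b) (F.erase s(a, b)))
    have := Finset.card_insert_le s(v, b) (F.erase s(a, b))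
    have := Finset.card_erase_add_one hab
    have := h.card
    omega
  · apply conn_of a
    intro x hx
    rcases Finset.mem_insert.1 hx with rfl | hx
    · exact .single (by simp)
    · have hab' : Relation.ReflTransGen (fun p q => s(p, q) ∈
          insert s(v, a) (insert s(v, b) (F.erase s(a, b)))) a b :=
        .head (b := v) (by simp [Sym2.eq_swap]) (.single (by simp))
      have key : ∀ x y, Relation.ReflTransGen (fun p q => s(p, q) ∈ F) x y →
          Relation.ReflTransGen (fun p q => s(p, q) ∈
            insert s(v, a) (insert s(v, b) (F.erase s(a, b)))) x y := by
        intro x y hxy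
        induction hxy with
        | refl => exact .refl
        | tail _ hpq ih =>
          refine ih.trans ?_
          rename_i p q _
          by_cases hpe : s(p, q) = s(a, b)
          · rcases Sym2.eq_iff.1 hpe with ⟨rfl, rfl⟩ | ⟨rfl, rfl⟩
            · exact hab'
            · exact rtg_symm hab'
          · exact .single (by simp [hpe, hpq])
      exact key x a (h.conn x hx a ha)

theorem smap_iff {γ : V → V} (hγ : ∀ x, γ (γ (γ x)) = x) (e f : Sym2 V) :
    Sym2.map γ e = f ↔ e = Sym2.map γ (Sym2.map γ f) := by
  have h3 : ∀ e, Sym2.map γ (Sym2.map γ (Sym2.map γ e)) = e := by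
    intro e; induction e using Sym2.ind; simp [hγ]
  constructor
  · rintro rfl; exact (h3 e).symm
  · rintro rfl; exact h3 f

theorem Inv.step {γ : V → V} (hγ : ∀ x, γ (γ (γ x)) = x) {S S' : Finset V}
    {E E' : Set (Sym2 V)} {A A' : Finset V} {F F' : Finset (Sym2 V)} (h : Inv γ S E A F)
    {v w z : V} (hS : ∀ u ∈ S, γ u ∈ S)
    (hv : v ∉ S) (hw : w ∉ S) (hz : z ∉ S) (gv : γ v = w) (gw : γ w = z) (gz : γ z = v)
    (hS' : ∀ x, x ∈ S' ↔ x ∈ S ∨ x = v ∨ x = w ∨ x = z)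
    (D N : Finset (Sym2 V)) (hD : D ⊆ F) (ht : TreeOn A' F')
    (hF' : ∀ e, e ∈ F' ↔ (e ∈ F ∧ e ∉ D) ∨ e ∈ N)
    (hsub : A' ⊆ S') (hA : ∀ x ∈ S, x ∈ A' ↔ x ∈ A) (htwo : Two γ A' v)
    (hN : ∀ e ∈ N, ∃ x ∈ e, x ∉ S) (hNd : ∀ e ∈ N, Sym2.map γ e ∉ N)
    (hE' : ∀ e, e ∈ E' ↔ (e ∈ E ∧ e ∉ D ∧ Sym2.map γ e ∉ D ∧ Sym2.map γ (Sym2.map γ e) ∉ D) ∨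
      e ∈ N ∨ Sym2.map γ e ∈ N ∨ Sym2.map γ (Sym2.map γ e) ∈ N) :
    Inv γ S' E' A' F' := by
  have h3 : ∀ e, Sym2.map γ (Sym2.map γ (Sym2.map γ e)) = e := by
    intro e; induction e using Sym2.ind; simp [hγ]
  have hFS : ∀ e ∈ F, ∀ x ∈ e, x ∈ S := fun e he x hx => h.sub (h.tree.inc e he x hx)
  have hn1 : ∀ e ∈ N, Sym2.map γ e ∉ F := by
    intro e he hF
    obtain ⟨x, hx, hxS⟩ := hN e he
    have := hFS _ hF (γ x) (Sym2.mem_map.2 ⟨x, hx, rfl⟩)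
    have := hS _ (hS _ this)
    rw [hγ] at this
    exact hxS this
  have hn2 : ∀ e ∈ F, Sym2.map γ e ∉ N := by
    intro e he hF
    obtain ⟨x, hx, hxS⟩ := hN _ hF
    obtain ⟨y, hy, rfl⟩ := Sym2.mem_map.1 hx
    exact hxS (hS _ (hFS _ he y hy))
  refine ⟨ht, hsub, ?_, ?_, ?_⟩
  · intro x hx
    have hvwz : ∀ x, Two γ A' x → Two γ A' (γ x) := by
      intro x; unfold Two; rw [hγ]; tauto
    rcases (hS' x).1 hx with hx | rfl | rfl | rfl
    · have := h.two x hx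
      unfold Two at *
      rw [hA x hx, hA _ (hS x hx), hA _ (hS _ (hS x hx))]
      exact this
    · exact htwo
    · rw [← gv]; exact hvwz _ htwo
    · rw [← gw, ← gv]; exact hvwz _ (hvwz _ htwo)
  · intro e
    have d1 := h.dis e
    have d2 := h.dis (Sym2.map γ e)
    have d3 := h.dis (Sym2.map γ (Sym2.map γ e))
    rw [h3] at d3
    have hD' := fun e he => @hD e he
    have D1 := hD' e
    have D2 := hD' (Sym2.map γ e)
    have D3 := hD' (Sym2.map γ (Sym2.map γ e))
    rw [hE', h.cov, hF', hF', hF']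
    clear * - d1 d2 d3 D1 D2 D3
    grind
  · intro e he he'
    rw [hF'] at he he'
    rcases he with he | he <;> rcases he' with he' | he'
    · exact h.dis e he.1 he'.1
    · exact hn2 e he.1 he'
    · exact hn1 e he he'.1
    · exact hNd e he he'

end trees

section invsteps

variable {V : Type*} [DecidableEq V]

theorem inv_VA0 {γ : V → V} (hγ : ∀ x, γ (γ (γ x)) = x) {S S' : Finset V}
    {E E' : Set (Sym2 V)} {A : Finset V} {F : Finset (Sym2 V)} (h : Inv γ S E A F)
    {v w z : V} (hS : ∀ u ∈ S, γ u ∈ S)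
    (hv : v ∉ S) (hw : w ∉ S) (hz : z ∉ S) (hvw : v ≠ w) (hwz : w ≠ z) (hvz : v ≠ z)
    (gv : γ v = w) (gw : γ w = z) (gz : γ z = v)
    (hS' : ∀ x, x ∈ S' ↔ x ∈ S ∨ x = v ∨ x = w ∨ x = z)
    {a b : V} (ha : a ∈ A) (hb : b ∈ S) (hab : a ≠ b)
    (hE : E' = E ∪ {s(v, a), s(v, b), s(w, γ a), s(w, γ b), s(z, γ (γ a)), s(z, γ (γ b))}) :
    ∃ A' F', Inv γ S' E' A' F' := by
  have hsub := h.sub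
  have hsub' := fun x hx => @hsub x hx
  have haS := hsub' a ha
  have ha1 := hS _ haS
  have ha2 := hS _ ha1
  have hb1 := hS _ hb
  have hb2 := hS _ hb1
  have hvA : v ∉ A := fun hh => hv (hsub hh)
  have hwA : w ∉ A := fun hh => hw (hsub hh)
  have hzA : z ∉ A := fun hh => hz (hsub hh)
  have hbt : γ b ∈ A ∨ γ (γ b) ∈ A := by
    have := h.two b hb
    unfold Two at this; tauto
  rcases hbt with hbt | hbt
  · have t := (h.tree.leaf ha hvA).leaf (a := γ b) (v := w) (Finset.mem_insert_of_mem hbt)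
      (by simp [hwA, hvw.symm])
    refine ⟨_, _, h.step hγ hS hv hw hz gv gw gz hS' ∅ {s(v, a), s(w, γ b)} (by simp) t
      ?_ ?_ ?_ ?_ ?_ ?_ ?_⟩
    · intro e; simp only [Finset.mem_insert, Finset.mem_singleton, Finset.notMem_empty]; tauto
    · intro x hx; rw [hS']; simp only [Finset.mem_insert] at hx; grind
    · intro x hx; simp only [Finset.mem_insert]; grind
    · unfold Two; simp only [gv, gw, Finset.mem_insert]; grind
    · intro e he; simp only [Finset.mem_insert, Finset.mem_singleton] at he
      rcases he with rfl | rfl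
      · exact ⟨v, by simp, hv⟩
      · exact ⟨w, by simp, hw⟩
    · intro e he; simp only [Finset.mem_insert, Finset.mem_singleton] at he ⊢
      rcases he with rfl | rfl <;> simp only [Sym2.map_mk, gv, gw, Sym2.eq_iff] <;> grind
    · intro e
      rw [hE]
      simp only [Set.mem_union, Set.mem_insert_iff, Set.mem_singleton_iff, Finset.mem_insert,
        Finset.mem_singleton, Finset.notMem_empty, smap_iff hγ, Sym2.map_mk, gv, gw, gz, hγ]
      grind
  · have t := (h.tree.leaf ha hvA).leaf (a := γ (γ b)) (v := z) (Finset.mem_insert_of_mem hbt)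
      (by simp [hzA, hvz.symm])
    refine ⟨_, _, h.step hγ hS hv hw hz gv gw gz hS' ∅ {s(v, a), s(z, γ (γ b))} (by simp) t
      ?_ ?_ ?_ ?_ ?_ ?_ ?_⟩
    · intro e; simp only [Finset.mem_insert, Finset.mem_singleton, Finset.notMem_empty]; tauto
    · intro x hx; rw [hS']; simp only [Finset.mem_insert] at hx; grind
    · intro x hx; simp only [Finset.mem_insert]; grind
    · unfold Two; simp only [gv, gw, Finset.mem_insert]; grind
    · intro e he; simp only [Finset.mem_insert, Finset.mem_singleton] at he
      rcases he with rfl | rfl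
      · exact ⟨v, by simp, hv⟩
      · exact ⟨z, by simp, hz⟩
    · intro e he; simp only [Finset.mem_insert, Finset.mem_singleton] at he ⊢
      rcases he with rfl | rfl <;> simp only [Sym2.map_mk, gv, gz, hγ, Sym2.eq_iff] <;> grind
    · intro e
      rw [hE]
      simp only [Set.mem_union, Set.mem_insert_iff, Set.mem_singleton_iff, Finset.mem_insert,
        Finset.mem_singleton, Finset.notMem_empty, smap_iff hγ, Sym2.map_mk, gv, gw, gz, hγ]
      grind

theorem inv_VA {γ : V → V} (hγ : ∀ x, γ (γ (γ x)) = x) {S S' : Finset V}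
    {E E' : Set (Sym2 V)} {A : Finset V} {F : Finset (Sym2 V)} (h : Inv γ S E A F)
    {v w z : V} (hS : ∀ u ∈ S, γ u ∈ S)
    (hv : v ∉ S) (hw : w ∉ S) (hz : z ∉ S) (hvw : v ≠ w) (hwz : w ≠ z) (hvz : v ≠ z)
    (gv : γ v = w) (gw : γ w = z) (gz : γ z = v)
    (hS' : ∀ x, x ∈ S' ↔ x ∈ S ∨ x = v ∨ x = w ∨ x = z)
    {a b : V} (ha : a ∈ S) (hb : b ∈ S) (hab : a ≠ b)
    (hE : E' = E ∪ {s(v, a), s(v, b), s(w, γ a), s(w, γ b), s(z, γ (γ a)), s(z, γ (γ b))}) :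
    ∃ A' F', Inv γ S' E' A' F' := by
  have hat : a ∈ A ∨ γ a ∈ A := by
    have := h.two a ha
    unfold Two at this; tauto
  rcases hat with hat | hat
  · exact inv_VA0 hγ h hS hv hw hz hvw hwz hvz gv gw gz hS' hat hb hab hE
  · refine inv_VA0 hγ h hS hw hz hv hwz hvz.symm hvw.symm gw gz gv
      (by intro x; rw [hS']; tauto) hat (hS _ hb) (by grind) (hE.trans ?_)
    ext e
    simp only [Set.mem_union, Set.mem_insert_iff, Set.mem_singleton_iff, hγ]
    tauto

theorem inv_DE0 {γ : V → V} (hγ : ∀ x, γ (γ (γ x)) = x) {S S' : Finset V}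
    {E E' : Set (Sym2 V)} {A : Finset V} {F : Finset (Sym2 V)} (h : Inv γ S E A F)
    {v w z : V} (hS : ∀ u ∈ S, γ u ∈ S)
    (hv : v ∉ S) (hw : w ∉ S) (hz : z ∉ S) (hvw : v ≠ w) (hwz : w ≠ z) (hvz : v ≠ z)
    (gv : γ v = w) (gw : γ w = z) (gz : γ z = v)
    (hS' : ∀ x, x ∈ S' ↔ x ∈ S ∨ x = v ∨ x = w ∨ x = z)
    {a : V} (ha : a ∈ A)
    (hE : E' = E ∪ {s(v, w), s(w, z), s(z, v), s(v, a), s(w, γ a), s(z, γ (γ a))}) :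
    ∃ A' F', Inv γ S' E' A' F' := by
  have hsub := h.sub
  have hsub' := fun x hx => @hsub x hx
  have haS := hsub' a ha
  have ha1 := hS _ haS
  have ha2 := hS _ ha1
  have hvA : v ∉ A := fun hh => hv (hsub hh)
  have hwA : w ∉ A := fun hh => hw (hsub hh)
  have hzA : z ∉ A := fun hh => hz (hsub hh)
  have t := (h.tree.leaf ha hvA).leaf (a := v) (v := w) (by simp) (by simp [hwA, hvw.symm])
  refine ⟨_, _, h.step hγ hS hv hw hz gv gw gz hS' ∅ {s(v, a), s(w, v)} (by simp) t
    ?_ ?_ ?_ ?_ ?_ ?_ ?_⟩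
  · intro e; simp only [Finset.mem_insert, Finset.mem_singleton, Finset.notMem_empty]; tauto
  · intro x hx; rw [hS']; simp only [Finset.mem_insert] at hx; grind
  · intro x hx; simp only [Finset.mem_insert]; grind
  · unfold Two; simp only [gv, gw, Finset.mem_insert]; grind
  · intro e he; simp only [Finset.mem_insert, Finset.mem_singleton] at he
    rcases he with rfl | rfl
    · exact ⟨v, by simp, hv⟩
    · exact ⟨w, by simp, hw⟩
  · intro e he; simp only [Finset.mem_insert, Finset.mem_singleton] at he ⊢
    rcases he with rfl | rfl <;> simp only [Sym2.map_mk, gv, gw, Sym2.eq_iff] <;> grind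
  · intro e
    rw [hE, Sym2.eq_swap (a := v) (b := w), Sym2.eq_swap (a := w) (b := z),
      Sym2.eq_swap (a := z) (b := v)]
    simp only [Set.mem_union, Set.mem_insert_iff, Set.mem_singleton_iff, Finset.mem_insert,
      Finset.mem_singleton, Finset.notMem_empty, smap_iff hγ, Sym2.map_mk, gv, gw, gz, hγ]
    grind

theorem inv_DE {γ : V → V} (hγ : ∀ x, γ (γ (γ x)) = x) {S S' : Finset V}
    {E E' : Set (Sym2 V)} {A : Finset V} {F : Finset (Sym2 V)} (h : Inv γ S E A F)
    {v w z : V} (hS : ∀ u ∈ S, γ u ∈ S)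
    (hv : v ∉ S) (hw : w ∉ S) (hz : z ∉ S) (hvw : v ≠ w) (hwz : w ≠ z) (hvz : v ≠ z)
    (gv : γ v = w) (gw : γ w = z) (gz : γ z = v)
    (hS' : ∀ x, x ∈ S' ↔ x ∈ S ∨ x = v ∨ x = w ∨ x = z)
    {a : V} (ha : a ∈ S)
    (hE : E' = E ∪ {s(v, w), s(w, z), s(z, v), s(v, a), s(w, γ a), s(z, γ (γ a))}) :
    ∃ A' F', Inv γ S' E' A' F' := by
  have hat : a ∈ A ∨ γ a ∈ A := by
    have := h.two a ha
    unfold Two at this; tauto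
  rcases hat with hat | hat
  · exact inv_DE0 hγ h hS hv hw hz hvw hwz hvz gv gw gz hS' hat hE
  · refine inv_DE0 hγ h hS hw hz hv hwz hvz.symm hvw.symm gw gz gv
      (by intro x; rw [hS']; tauto) hat (hE.trans ?_)
    ext e
    simp only [Set.mem_union, Set.mem_insert_iff, Set.mem_singleton_iff, hγ]
    tauto

theorem inv_ES0 {γ : V → V} (hγ : ∀ x, γ (γ (γ x)) = x) {S S' : Finset V}
    {E E' : Set (Sym2 V)} {A : Finset V} {F : Finset (Sym2 V)} (h : Inv γ S E A F)
    {v w z : V} (hS : ∀ u ∈ S, γ u ∈ S)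
    (hv : v ∉ S) (hw : w ∉ S) (hz : z ∉ S) (hvw : v ≠ w) (hwz : w ≠ z) (hvz : v ≠ z)
    (gv : γ v = w) (gw : γ w = z) (gz : γ z = v)
    (hS' : ∀ x, x ∈ S' ↔ x ∈ S ∨ x = v ∨ x = w ∨ x = z)
    {a b c : V} (hF : s(a, b) ∈ F) (hc : c ∈ S) (hbc : b ≠ c) (hac : a ≠ c)
    (hE : E' = (E \ {s(a, b), s(γ a, γ b), s(γ (γ a), γ (γ b))}) ∪
      {s(v, a), s(v, b), s(v, c), s(w, γ a), s(w, γ b), s(w, γ c),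
       s(z, γ (γ a)), s(z, γ (γ b)), s(z, γ (γ c))}) :
    ∃ A' F', Inv γ S' E' A' F' := by
  have hsub := h.sub
  have hsub' := fun x hx => @hsub x hx
  have ha : a ∈ A := h.tree.inc _ hF a (by simp)
  have hb : b ∈ A := h.tree.inc _ hF b (by simp)
  have haS := hsub' a ha
  have ha1 := hS _ haS
  have ha2 := hS _ ha1
  have hbS := hsub' b hb
  have hb1 := hS _ hbS
  have hb2 := hS _ hb1
  have hc1 := hS _ hc
  have hc2 := hS _ hc1
  have hvA : v ∉ A := fun hh => hv (hsub hh)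
  have hwA : w ∉ A := fun hh => hw (hsub hh)
  have hzA : z ∉ A := fun hh => hz (hsub hh)
  have hvF : ∀ x, s(v, x) ∉ F := fun x hx => hvA (h.tree.inc _ hx v (by simp))
  have hct : γ c ∈ A ∨ γ (γ c) ∈ A := by
    have := h.two c hc
    unfold Two at this; tauto
  rcases hct with hct | hct
  · have t := (h.tree.subdiv hF hvA).leaf (a := γ c) (v := w) (Finset.mem_insert_of_mem hct)
      (by simp [hwA, hvw.symm])
    refine ⟨_, _, h.step hγ hS hv hw hz gv gw gz hS' {s(a, b)} {s(v, a), s(v, b), s(w, γ c)}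
      (by simpa using hF) t ?_ ?_ ?_ ?_ ?_ ?_ ?_⟩
    · intro e; simp only [Finset.mem_insert, Finset.mem_singleton, Finset.mem_erase]; tauto
    · intro x hx; rw [hS']; simp only [Finset.mem_insert] at hx; grind
    · intro x hx; simp only [Finset.mem_insert]; grind
    · unfold Two; simp only [gv, gw, Finset.mem_insert]; grind
    · intro e he; simp only [Finset.mem_insert, Finset.mem_singleton] at he
      rcases he with rfl | rfl | rfl
      · exact ⟨v, by simp, hv⟩
      · exact ⟨v, by simp, hv⟩
      · exact ⟨w, by simp, hw⟩
    · intro e he; simp only [Finset.mem_insert, Finset.mem_singleton] at he ⊢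
      rcases he with rfl | rfl | rfl <;> simp only [Sym2.map_mk, gv, gw, Sym2.eq_iff] <;> grind
    · intro e
      rw [hE]
      simp only [Set.mem_union, Set.mem_insert_iff, Set.mem_singleton_iff, Finset.mem_insert,
        Finset.mem_singleton, Set.mem_sdiff, smap_iff hγ, Sym2.map_mk, gv, gw, gz, hγ]
      grind
  · have t := (h.tree.subdiv hF hvA).leaf (a := γ (γ c)) (v := z)
      (Finset.mem_insert_of_mem hct) (by simp [hzA, hvz.symm])
    refine ⟨_, _, h.step hγ hS hv hw hz gv gw gz hS' {s(a, b)}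
      {s(v, a), s(v, b), s(z, γ (γ c))}
      (by simpa using hF) t ?_ ?_ ?_ ?_ ?_ ?_ ?_⟩
    · intro e; simp only [Finset.mem_insert, Finset.mem_singleton, Finset.mem_erase]; tauto
    · intro x hx; rw [hS']; simp only [Finset.mem_insert] at hx; grind
    · intro x hx; simp only [Finset.mem_insert]; grind
    · unfold Two; simp only [gv, gw, Finset.mem_insert]; grind
    · intro e he; simp only [Finset.mem_insert, Finset.mem_singleton] at he
      rcases he with rfl | rfl | rfl
      · exact ⟨v, by simp, hv⟩
      · exact ⟨v, by simp, hv⟩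
      · exact ⟨z, by simp, hz⟩
    · intro e he; simp only [Finset.mem_insert, Finset.mem_singleton] at he ⊢
      rcases he with rfl | rfl | rfl <;>
        simp only [Sym2.map_mk, gv, gz, hγ, Sym2.eq_iff] <;> grind
    · intro e
      rw [hE]
      simp only [Set.mem_union, Set.mem_insert_iff, Set.mem_singleton_iff, Finset.mem_insert,
        Finset.mem_singleton, Set.mem_sdiff, smap_iff hγ, Sym2.map_mk, gv, gw, gz, hγ]
      grind

theorem inv_ES {γ : V → V} (hγ : ∀ x, γ (γ (γ x)) = x) {S S' : Finset V}
    {E E' : Set (Sym2 V)} {A : Finset V} {F : Finset (Sym2 V)} (h : Inv γ S E A F)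
    {v w z : V} (hS : ∀ u ∈ S, γ u ∈ S)
    (hv : v ∉ S) (hw : w ∉ S) (hz : z ∉ S) (hvw : v ≠ w) (hwz : w ≠ z) (hvz : v ≠ z)
    (gv : γ v = w) (gw : γ w = z) (gz : γ z = v)
    (hS' : ∀ x, x ∈ S' ↔ x ∈ S ∨ x = v ∨ x = w ∨ x = z)
    {a b c : V} (hab : s(a, b) ∈ E) (hc : c ∈ S) (hbc : b ≠ c) (hac : a ≠ c)
    (hE : E' = (E \ {s(a, b), s(γ a, γ b), s(γ (γ a), γ (γ b))}) ∪
      {s(v, a), s(v, b), s(v, c), s(w, γ a), s(w, γ b), s(w, γ c),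
       s(z, γ (γ a)), s(z, γ (γ b)), s(z, γ (γ c))}) :
    ∃ A' F', Inv γ S' E' A' F' := by
  rcases (h.cov _).1 hab with hF | hF | hF
  · exact inv_ES0 hγ h hS hv hw hz hvw hwz hvz gv gw gz hS' hF hc hbc hac hE
  · rw [Sym2.map_mk] at hF
    refine inv_ES0 hγ h hS hw hz hv hwz hvz.symm hvw.symm gw gz gv
      (by intro x; rw [hS']; tauto) hF (hS _ hc) (by grind) (by grind) (hE.trans ?_)
    ext e
    simp only [Set.mem_union, Set.mem_insert_iff, Set.mem_singleton_iff, Set.mem_sdiff, hγ]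
    grind
  · rw [Sym2.map_mk, Sym2.map_mk] at hF
    refine inv_ES0 hγ h hS hz hv hw hvz.symm hvw hwz.symm gz gv gw
      (by intro x; rw [hS']; tauto) hF (hS _ (hS _ hc)) (by grind) (by grind) (hE.trans ?_)
    ext e
    simp only [Set.mem_union, Set.mem_insert_iff, Set.mem_singleton_iff, Set.mem_sdiff, hγ]
    grind

end invsteps

section final

variable {V : Type*} [Fintype V] [DecidableEq V]

theorem edgeSet_coe_card {G : SimpleGraph V} (T : G.Subgraph) :
    Nat.card T.coe.edgeSet = T.edgeSet.ncard := by
  rw [← T.image_coe_edgeSet_coe,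
    Set.ncard_image_of_injective _ (Sym2.map.injective Subtype.val_injective)]
  rfl

theorem isTree_of {G : SimpleGraph V} (T : G.Subgraph) {A : Finset V} {F : Finset (Sym2 V)}
    (h : TreeOn A F) (hv : ∀ x, x ∈ T.verts ↔ x ∈ A) (ha : ∀ x y, T.Adj x y ↔ s(x, y) ∈ F) :
    T.coe.IsTree := by
  have hconn : T.coe.Connected := by
    obtain ⟨a, haA⟩ := h.ne
    rw [SimpleGraph.connected_iff_exists_forall_reachable]
    refine ⟨⟨a, (hv a).2 haA⟩, ?_⟩
    rintro ⟨w, hw⟩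
    have := h.conn a haA w ((hv w).1 hw)
    have key : ∃ hw' : w ∈ T.verts, T.coe.Reachable ⟨a, (hv a).2 haA⟩ ⟨w, hw'⟩ := by
      clear hw
      induction this with
      | refl => exact ⟨(hv a).2 haA, SimpleGraph.Reachable.refl _⟩
      | tail _ hpq ih =>
        obtain ⟨hp, hr⟩ := ih
        have hadj := (ha _ _).2 hpq
        refine ⟨T.edge_vert hadj.symm, hr.trans ?_⟩
        apply SimpleGraph.Adj.reachable
        exact hadj
    exact key.2
  rw [SimpleGraph.isTree_iff_connected_and_card]
  refine ⟨hconn, ?_⟩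
  have h1 := hconn.card_vert_le_card_edgeSet_add_one
  have h2 : Nat.card T.verts = A.card := by
    have : T.verts = (A : Set V) := by ext x; simp [hv]
    rw [this]; simp
  have h3 : Nat.card T.coe.edgeSet = F.card := by
    rw [edgeSet_coe_card]
    have : T.edgeSet = (F : Set (Sym2 V)) := by
      ext e; induction e using Sym2.ind; simp [ha]
    rw [this, Set.ncard_coe_finset]
  have := h.card
  omega

theorem TreeOn.image {A : Finset V} {F : Finset (Sym2 V)} (h : TreeOn A F) {g : V → V}
    (hg : Function.Injective g) : TreeOn (A.image g) (F.image (Sym2.map g)) where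
  ne := h.ne.image g
  inc := by
    intro e he x hx
    obtain ⟨e', he', rfl⟩ := Finset.mem_image.1 he
    obtain ⟨y, hy, rfl⟩ := Sym2.mem_map.1 hx
    exact Finset.mem_image_of_mem _ (h.inc _ he' _ hy)
  card := by
    rw [Finset.card_image_of_injective _ hg, Finset.card_image_of_injective _ (Sym2.map.injective hg)]
    exact h.card
  conn := by
    intro x hx y hy
    obtain ⟨x', hx', rfl⟩ := Finset.mem_image.1 hx
    obtain ⟨y', hy', rfl⟩ := Finset.mem_image.1 hy
    have hc := h.conn x' hx' y' hy'
    clear hx hy hx' hy'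
    induction hc with
    | refl => exact .refl
    | tail _ hab ih => exact ih.tail (Finset.mem_image.2 ⟨_, hab, rfl⟩)

theorem proper_of_sparse {G : SimpleGraph V} (hs : Sparse G.edgeSet) (Si Sj : G.Subgraph)
    (hd : ∀ e, e ∈ Si.edgeSet → e ∉ Sj.edgeSet) (hi : Si.coe.IsTree) (hj : Sj.coe.IsTree)
    (h2 : 2 ≤ Si.verts.ncard) : Si.verts ≠ Sj.verts := by
  intro heq
  have ci := ((SimpleGraph.isTree_iff_connected_and_card).1 hi).2
  have cj := ((SimpleGraph.isTree_iff_connected_and_card).1 hj).2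
  rw [edgeSet_coe_card] at ci cj
  rw [Nat.card_coe_set_eq] at ci cj
  rw [← heq] at cj
  have hU := hs Si.verts.toFinite.toFinset
  rw [← Set.ncard_eq_toFinset_card] at hU
  have hsub : Si.edgeSet ∪ Sj.edgeSet ⊆ Ins G.edgeSet Si.verts.toFinite.toFinset := by
    rintro e (he | he)
    · refine ⟨Si.edgeSet_subset he, fun x hx => ?_⟩
      simpa using Si.mem_verts_of_mem_edge he hx
    · refine ⟨Sj.edgeSet_subset he, fun x hx => ?_⟩
      simpa [heq] using Sj.mem_verts_of_mem_edge he hx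
  have h3 := Set.ncard_le_ncard hsub (Set.toFinite _)
  rw [Set.ncard_union_eq (Set.disjoint_left.2 hd) (Set.toFinite _) (Set.toFinite _)] at h3
  omega

theorem seq_inv {G : SimpleGraph V} {γ : V → V} (hγ : ∀ x, γ (γ (γ x)) = x)
    (hseq : C3ConstructionSeq G γ) :
    Sparse G.edgeSet ∧ ∃ A F, Inv γ Finset.univ G.edgeSet A F := by
  obtain ⟨k, S, H, hc, hH0, hf, hinv, hstep, hSk, hHk⟩ := hseq
  have main : ∀ i ≤ k, Sparse (H i).edgeSet ∧ ∃ A F, Inv γ (S i) (H i).edgeSet A F := by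
    intro i
    induction i with
    | zero =>
      intro _
      obtain ⟨u, hu⟩ : (S 0).Nonempty := Finset.card_pos.1 (by omega)
      obtain ⟨hu1, n1⟩ := hf u hu
      obtain ⟨hu2, n2⟩ := hf _ hu1
      have n3 : γ (γ u) ≠ u := by
        intro h; have := hγ u; rw [h] at this; exact n1 this
      have hS0 : S 0 = {u, γ u, γ (γ u)} := by
        symm
        apply Finset.eq_of_subset_of_card_le
        · intro x hx
          simp only [Finset.mem_insert, Finset.mem_singleton] at hx
          rcases hx with rfl | rfl | rfl <;> assumption
        · rw [hc, Finset.card_eq_three.2 ⟨u, γ u, γ (γ u), n1.symm, n3.symm, n2.symm, rfl⟩]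
      have hE : ∀ e, e ∈ (H 0).edgeSet ↔
          e = s(γ u, u) ∨ e = s(γ (γ u), γ u) ∨ e = s(u, γ (γ u)) := by
        intro e; induction e using Sym2.ind with | h a b =>
        rw [SimpleGraph.mem_edgeSet, hH0, hS0]
        simp only [Finset.mem_insert, Finset.mem_singleton, Sym2.eq_iff]
        grind
      constructor
      · have s0 : Sparse (∅ : Set (Sym2 V)) := by
          intro U; simp [Ins]
        have s1 := s0.ext0 (v := γ u) (a := u) (b := u) (by simp) n1.symm n1.symm
        have s2 := s1.ext0 (v := γ (γ u)) (a := γ u) (b := u) (by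
          intro e he
          simp only [Set.empty_union, Set.mem_insert_iff, Set.mem_singleton_iff, or_self] at he
          subst he
          simp only [Sym2.mem_iff]; grind) n2.symm n3.symm
        refine s2.mono ?_
        intro e he
        rcases (hE e).1 he with rfl | rfl | rfl
        · simp
        · simp
        · exact Or.inr (Or.inr Sym2.eq_swap)
      · have t0 : TreeOn ({u} : Finset V) ∅ := by
          refine ⟨by simp, by simp, by simp, ?_⟩
          intro x hx y hy
          rw [Finset.mem_singleton.1 hx, Finset.mem_singleton.1 hy]
        have t1 := t0.leaf (a := u) (v := γ u) (by simp) (by simpa using n1)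
        refine ⟨_, _, t1, ?_, ?_, ?_, ?_⟩
        · rw [hS0]; intro x; simp only [Finset.mem_insert, Finset.mem_singleton]; tauto
        · rw [hS0]; intro x; simp only [Finset.mem_insert, Finset.mem_singleton, Two]
          grind
        · intro e
          rw [hE]
          simp only [Finset.mem_insert, Finset.notMem_empty, or_false, smap_iff hγ, Sym2.map_mk,
            hγ]
          tauto
        · intro e
          simp only [Finset.mem_insert, Finset.notMem_empty, or_false]
          rintro rfl
          rw [Sym2.map_mk, Sym2.eq_iff]; grind
    | succ i ih =>
      intro hi
      obtain ⟨hsp, A, F, hI⟩ := ih (by omega)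
      obtain ⟨v, w, z, hv, hw, hz, hvw, hwz, hvz, gv, gw, gz, hS', hst⟩ := hstep i (by omega)
      obtain ⟨hS, hH, hHγ⟩ := hinv i (by omega)
      have hS'' : ∀ x, x ∈ S (i + 1) ↔ x ∈ S i ∨ x = v ∨ x = w ∨ x = z := by
        intro x; rw [hS']; simp; tauto
      rcases hst with hst | hst | hst
      · refine ⟨sparse_VA hS hH hv hw hz hvw hwz hvz hst hsp, ?_⟩
        obtain ⟨a, ha, b, hb, hab, hE⟩ := hst
        exact inv_VA hγ hI hS hv hw hz hvw hwz hvz gv gw gz hS'' ha hb hab hE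
      · refine ⟨sparse_ES hγ hS hH hHγ hv hw hz hvw hwz hvz hst hsp, ?_⟩
        obtain ⟨a, ha, b, hb, c, hc, hab, hbc, hac, hadj, hfix, hE⟩ := hst
        exact inv_ES hγ hI hS hv hw hz hvw hwz hvz gv gw gz hS'' hadj hc hbc hac hE
      · refine ⟨sparse_DE hγ hS hH hv hw hz hvw hwz hvz hst hsp, ?_⟩
        obtain ⟨a, ha, hfix, hE⟩ := hst
        exact inv_DE hγ hI hS hv hw hz hvw hwz hvz gv gw gz hS'' ha hE
  have := main k le_rfl
  rwa [hSk, hHk] at this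

/-- Inverses of the powers of `γ`. -/
def cinv {V : Type*} (γ : V → V) : Fin 3 → V → V := ![id, fun x => γ (γ x), γ]

/-- The tree built from a base tree by pulling back. -/
def mkT {V : Type*} {G : SimpleGraph V} (f : V → V) (A : Finset V) (F : Finset (Sym2 V))
    (h1 : ∀ x y, s(f x, f y) ∈ F → G.Adj x y) (h2 : ∀ e ∈ F, ∀ x ∈ e, x ∈ A) : G.Subgraph where
  verts := {x | f x ∈ A}
  Adj x y := s(f x, f y) ∈ F
  adj_sub := fun {x y} h => h1 x y h
  edge_vert := fun {x y} h => h2 _ h (f x) (by simp)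
  symm := ⟨fun x y h => by rw [Sym2.eq_swap]; exact h⟩

end final

/-- If there is a `(C₃, Φ)` construction sequence for `(G, γ)` (where `γ³ = id` and
`|V(G)| ≥ 3`), then `G` has a proper `(C₃, γ)` 3Tree2 partition. -/
theorem c3_construction_implies_3Tree2 {V : Type*} [Fintype V] [DecidableEq V]
    (G : SimpleGraph V) (hV : 3 ≤ Fintype.card V)
    (γ : G ≃g G) (hγ3 : ∀ v, γ (γ (γ v)) = v)
    (hseq : C3ConstructionSeq G (fun v => γ v)) :
    ∃ T : Fin 3 → G.Subgraph,
      IsC3_3Tree2Partition G γ T ∧ IsProper3Tree2Partition G T := by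
  obtain ⟨hsp, A, F, hI⟩ := seq_inv hγ3 hseq
  have hcov : ∀ x y, G.Adj x y ↔ s(x, y) ∈ F ∨ s(γ x, γ y) ∈ F ∨ s(γ (γ x), γ (γ y)) ∈ F :=
    fun x y => hI.cov s(x, y)
  have hdis : ∀ x y, s(x, y) ∈ F → s(γ x, γ y) ∉ F := fun x y => hI.dis s(x, y)
  have hdis2 : ∀ x y, s(x, y) ∈ F → s(γ (γ x), γ (γ y)) ∉ F := fun x y h1 h2 => by
    have := hdis _ _ h2
    rw [hγ3, hγ3] at this
    exact this h1
  have h1 : ∀ i x y, s(cinv γ i x, cinv γ i y) ∈ F → G.Adj x y := by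
    intro i x y h
    rw [hcov]
    fin_cases i <;> simp [cinv] at h <;> tauto
  let T : Fin 3 → G.Subgraph := fun i => mkT (cinv γ i) A F (h1 i) hI.tree.inc
  have hTv : ∀ i x, x ∈ (T i).verts ↔ cinv γ i x ∈ A := fun i x => Iff.rfl
  have hTa : ∀ i x y, (T i).Adj x y ↔ s(cinv γ i x, cinv γ i y) ∈ F := fun i x y => Iff.rfl
  have hTdis : ∀ i j x y, (T i).Adj x y → (T j).Adj x y → i = j := by
    intro i j x y hi hj
    rw [hTa] at hi hj
    have a1 := hdis x y
    have a2 := hdis2 x y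
    have a3 := hdis (γ x) (γ y)
    fin_cases i <;> fin_cases j <;> simp [cinv] at hi hj ⊢ <;> tauto
  have hT : Is3Tree2Partition G T := by
    refine ⟨?_, ?_, ?_⟩
    · intro i
      obtain ⟨g, hg1, hg2⟩ : ∃ g : V → V, (∀ x, g (cinv γ i x) = x) ∧ ∀ x, cinv γ i (g x) = x := by
        fin_cases i
        · exact ⟨id, by simp [cinv], by simp [cinv]⟩
        · exact ⟨γ, by simp [cinv, hγ3], by simp [cinv, hγ3]⟩
        · exact ⟨fun x => γ (γ x), by simp [cinv, hγ3], by simp [cinv, hγ3]⟩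
      have hinj : Function.Injective g := fun x y h => by rw [← hg2 x, h, hg2]
      refine isTree_of (T i) (hI.tree.image hinj) ?_ ?_
      · intro x
        rw [hTv, Finset.mem_image]
        constructor
        · exact fun h => ⟨_, h, hg1 x⟩
        · rintro ⟨a, ha, rfl⟩; rwa [hg2]
      · intro x y
        rw [hTa, Finset.mem_image]
        constructor
        · exact fun h => ⟨_, h, by simp [hg1]⟩
        · rintro ⟨e, he, hxy⟩
          have : Sym2.map (cinv γ i) (Sym2.map g e) = e := by
            induction e using Sym2.ind; simp [hg2]
          rw [hxy, Sym2.map_mk] at this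
          rwa [this]
    · intro e he
      induction e using Sym2.ind with | h x y =>
      have hex : ∃ i, (T i).Adj x y := by
        rcases (hcov x y).1 he with h | h | h
        · exact ⟨0, h⟩
        · exact ⟨2, h⟩
        · exact ⟨1, h⟩
      obtain ⟨i, hi⟩ := hex
      exact ⟨i, hi, fun j hj => hTdis j i x y hj hi⟩
    · intro x
      have ht := hI.two x (Finset.mem_univ x)
      have h0 : x ∈ (T 0).verts ↔ x ∈ A := Iff.rfl
      have h1 : x ∈ (T 1).verts ↔ γ (γ x) ∈ A := Iff.rfl
      have h2 : x ∈ (T 2).verts ↔ γ x ∈ A := Iff.rfl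
      unfold Two at ht
      rw [Set.ncard_eq_two]
      rcases ht with ⟨p, q, r⟩ | ⟨p, q, r⟩ | ⟨p, q, r⟩
      · refine ⟨0, 2, by decide, ?_⟩
        ext i; fin_cases i <;> simp [h0, h1, h2, p, q, r]
      · refine ⟨0, 1, by decide, ?_⟩
        ext i; fin_cases i <;> simp [h0, h1, h2, p, q, r]
      · refine ⟨1, 2, by decide, ?_⟩
        ext i; fin_cases i <;> simp [h0, h1, h2, p, q, r]
  refine ⟨T, ⟨hT, ?_⟩, hT, ?_⟩
  · intro i
    have hc : ∀ x, cinv γ (i + 1) (γ x) = cinv γ i x := by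
      intro x
      fin_cases i
      · exact hγ3 x
      · rfl
      · rfl
    apply SimpleGraph.Subgraph.ext
    · ext x
      rw [hTv, SimpleGraph.Subgraph.map_verts]
      constructor
      · rintro ⟨y, hy, rfl⟩
        exact (hc y).symm ▸ hy
      · intro hx
        refine ⟨γ (γ x), ?_, hγ3 x⟩
        rw [hTv, ← hc, hγ3]
        exact hx
    · ext x y
      rw [hTa, SimpleGraph.Subgraph.map_adj]
      constructor
      · rintro ⟨a, b, hab, rfl, rfl⟩
        rw [hTa] at hab
        exact (hc a).symm ▸ (hc b).symm ▸ hab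
      · intro hx
        refine ⟨γ (γ x), γ (γ y), ?_, hγ3 x, hγ3 y⟩
        rw [hTa, ← hc, hγ3, ← hc, hγ3]
        exact hx
  · intro i j hij Si Sj hi hj ti tj ci _
    refine proper_of_sparse hsp Si Sj ?_ ti tj ci
    intro e hei hej
    induction e using Sym2.ind with | h x y =>
    exact hij (hTdis i j x y (hi.2 hei) (hj.2 hej))

end C3Laman
end
end

section
/- Let G be a finite simple graph with |V(G)| ≥ 3 and let γ be an automorphism of G with γ³ = id. If G has a proper (C₃,γ) 3Tree2 partition, then there exists an isostatic framework (G,p) in ℝ² that is C₃-symmetric of type γ. -/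
open Matrix

set_option linter.unusedSectionVars false

noncomputable section

namespace C3Laman

variable {V : Type*} [Fintype V] [DecidableEq V]

/-- Rotation of the plane about the origin by the angle 2π/3. -/
def R3 : Matrix (Fin 2) (Fin 2) ℝ :=
  !![-(1/2 : ℝ), -(Real.sqrt 3 / 2); Real.sqrt 3 / 2, -(1/2)]

/-- `(G, p)` is a framework: adjacent vertices get distinct points. -/
def IsFramework (G : SimpleGraph V) (p : V → Fin 2 → ℝ) : Prop :=
  ∀ u w, G.Adj u w → p u ≠ p w

/-- `m` is an infinitesimal motion of the framework `(G, p)`. -/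
def IsInfMotion (G : SimpleGraph V) (p m : V → Fin 2 → ℝ) : Prop :=
  ∀ u w, G.Adj u w → (p u - p w) ⬝ᵥ (m u - m w) = 0

/-- `m` is an infinitesimal rigid motion of `p`: it comes from a skew-symmetric matrix
`S` and a translation vector `t`. -/
def IsInfRigidMotion (p m : V → Fin 2 → ℝ) : Prop :=
  ∃ S : Matrix (Fin 2) (Fin 2) ℝ, Sᵀ = -S ∧ ∃ t : Fin 2 → ℝ,
    ∀ v, m v = S.mulVec (p v) + t

/-- `(G, p)` is infinitesimally rigid. -/
def InfRigid (G : SimpleGraph V) (p : V → Fin 2 → ℝ) : Prop :=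
  ∀ m, IsInfMotion G p m → IsInfRigidMotion p m

/-- The row of the rigidity matrix corresponding to the edge `e`: at an endpoint `u` of
`e = {u, w}` it has the entries of `p u - p w` (note `p u - p w = 2 • p u - (p u + p w)`),
at the other endpoint `w` it has the entries of `p w - p u`, and `0` elsewhere. -/
def rigidityRow (p : V → Fin 2 → ℝ) (e : Sym2 V) : V → Fin 2 → ℝ :=
  fun x => if x ∈ e then
    (2 : ℝ) • p x - Sym2.lift ⟨fun u w => p u + p w, fun _ _ => add_comm _ _⟩ e
  else 0

/-- `(G, p)` is independent: the rows of the rigidity matrix are linearly independent. -/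
def Independent (G : SimpleGraph V) (p : V → Fin 2 → ℝ) : Prop :=
  LinearIndependent ℝ (fun e : G.edgeSet => rigidityRow p (e : Sym2 V))

/-- `(G, p)` is isostatic: it is a framework that is infinitesimally rigid and
independent. -/
def Isostatic (G : SimpleGraph V) (p : V → Fin 2 → ℝ) : Prop :=
  IsFramework G p ∧ InfRigid G p ∧ Independent G p

/-- `(G, p)` is `C₃`-symmetric of type `γ`. -/
def C3Symmetric (G : SimpleGraph V) (γ : G ≃g G) (p : V → Fin 2 → ℝ) : Prop :=
  ∀ v, p (γ v) = R3.mulVec (p v)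

lemma rigidityRow_add (p q : V → Fin 2 → ℝ) (t : ℝ) (e : Sym2 V) :
    rigidityRow (p + t • q) e = rigidityRow p e + t • rigidityRow q e := by
  induction e using Sym2.ind with
  | _ u w =>
    funext x
    by_cases h : x ∈ s(u, w)
    · simp only [rigidityRow, h, if_true, Sym2.lift_mk, Pi.add_apply, Pi.smul_apply]
      module
    · simp [rigidityRow, h]

lemma rigidityRow_eq_smul (p q : V → Fin 2 → ℝ) (t : ℝ) (u w : V)
    (h : p u - p w = t • (q u - q w)) :
    rigidityRow p s(u, w) = t • rigidityRow q s(u, w) := by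
  funext x
  by_cases hx : x ∈ s(u, w)
  · simp only [rigidityRow, hx, if_true, Sym2.lift_mk, Pi.smul_apply]
    rcases Sym2.mem_iff.1 hx with rfl | rfl
    · rw [show (2 : ℝ) • p x - (p x + p w) = p x - p w by module, h]; module
    · rw [show (2 : ℝ) • p x - (p u + p x) = -(p u - p x) by module, h]; module
  · simp [rigidityRow, hx]

lemma rigidityRow_dot (p m : V → Fin 2 → ℝ) (u w : V) (huw : u ≠ w) :
    ∑ v, rigidityRow p s(u, w) v ⬝ᵥ m v = (p u - p w) ⬝ᵥ (m u - m w) := by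
  have : ∀ v, rigidityRow p s(u, w) v ⬝ᵥ m v =
      (if v = u then (p u - p w) ⬝ᵥ m u else 0) + (if v = w then (p w - p u) ⬝ᵥ m w else 0) := by
    intro v
    by_cases h1 : v = u
    · subst h1
      simp only [rigidityRow, Sym2.mem_mk_left, if_true, Sym2.lift_mk, huw, if_false, add_zero]
      congr 1; module
    · by_cases h2 : v = w
      · subst h2
        simp only [rigidityRow, Sym2.mem_mk_right, if_true, Sym2.lift_mk, h1, if_false, zero_add]
        congr 1; module
      · simp [rigidityRow, h1, h2]
  simp only [this, Finset.sum_add_distrib, Finset.sum_ite_eq', Finset.mem_univ, if_true]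
  simp [dotProduct, Fin.sum_univ_two]; ring

lemma rigidityRow_eq_zero {p : V → Fin 2 → ℝ} {u w : V} (h : rigidityRow p s(u, w) = 0) :
    p u = p w := by
  have := congrFun h u
  simp only [rigidityRow, Sym2.mem_mk_left, if_true, Sym2.lift_mk, Pi.zero_apply] at this
  rw [← sub_eq_zero, ← this]; module

/-- annihilator of a family of rows -/
def ann {E : Type*} (r : E → V → Fin 2 → ℝ) : Submodule ℝ (V → Fin 2 → ℝ) where
  carrier := {m | ∀ e, ∑ v, r e v ⬝ᵥ m v = 0}
  add_mem' := by
    intro a b ha hb e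
    simp only [Pi.add_apply, dotProduct_add, Finset.sum_add_distrib]
    rw [ha e, hb e, add_zero]
  zero_mem' := by intro e; simp
  smul_mem' := by
    intro c a ha e
    simp only [Pi.smul_apply, dotProduct_smul, ← Finset.smul_sum]
    rw [ha e, smul_zero]

lemma mem_ann {E : Type*} {r : E → V → Fin 2 → ℝ} {m : V → Fin 2 → ℝ} :
    m ∈ ann r ↔ ∀ e, ∑ v, r e v ⬝ᵥ m v = 0 := Iff.rfl

lemma finrank_ann {E : Type*} [Fintype E] (r : E → V → Fin 2 → ℝ) :
    Module.finrank ℝ (Submodule.span ℝ (Set.range r)) + Module.finrank ℝ (ann r)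
      = 2 * Fintype.card V := by
  classical
  let c : (V → Fin 2 → ℝ) ≃ₗ[ℝ] (V × Fin 2 → ℝ) := (LinearEquiv.curry ℝ ℝ V (Fin 2)).symm
  let M : Matrix E (V × Fin 2) ℝ := Matrix.of fun e => c (r e)
  have h1 : M.rank = Module.finrank ℝ (Submodule.span ℝ (Set.range r)) := by
    rw [Matrix.rank_eq_finrank_span_row]
    have h : Set.range M.row = c.toLinearMap '' Set.range r := by
      rw [← Set.range_comp]; rfl
    rw [h, ← Submodule.map_span c.toLinearMap (Set.range r)]
    exact LinearEquiv.finrank_map_eq c _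
  have h2 : LinearMap.ker M.mulVecLin = (ann r).map c.toLinearMap := by
    ext x
    have h : x ∈ (ann r).map c.toLinearMap ↔ c.symm x ∈ ann r :=
      Submodule.mem_map_equiv (e := c) _
    rw [h, LinearMap.mem_ker, mem_ann, funext_iff]
    refine forall_congr' fun e => ?_
    have h' : (M.mulVecLin x) e = ∑ v, r e v ⬝ᵥ (c.symm x) v := by
      simp only [Matrix.mulVecLin_apply, Matrix.mulVec, dotProduct, Fintype.sum_prod_type]
      rfl
    rw [h']; rfl
  have h3 := M.mulVecLin.finrank_range_add_finrank_ker
  rw [h2] at h3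
  have h4 : Module.finrank ℝ ((ann r).map c.toLinearMap) =
    Module.finrank ℝ (ann r) := LinearEquiv.finrank_map_eq c _
  rw [h4, Module.finrank_fintype_fun_eq_card, Fintype.card_prod, Fintype.card_fin] at h3
  rw [← h1, Matrix.rank]
  omega

/-- vertices of the equilateral triangle -/
def zz : Fin 3 → Fin 2 → ℝ :=
  ![![1, 0], ![-(1/2), Real.sqrt 3 / 2], ![-(1/2), -(Real.sqrt 3 / 2)]]

/-- directions of the edges of the triangle -/
def dd (i : Fin 3) : Fin 2 → ℝ := zz (i + 1) - zz (i + 2)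

lemma R3_zz (i : Fin 3) : R3.mulVec (zz i) = zz (i + 1) := by
  have h3 : Real.sqrt 3 * Real.sqrt 3 = 3 := Real.mul_self_sqrt (by norm_num)
  fin_cases i <;> ext j <;> fin_cases j <;>
    simp [R3, zz, Matrix.mulVec, dotProduct, Fin.sum_univ_two] <;> nlinarith

lemma R3_dd (i : Fin 3) : R3.mulVec (dd i) = dd (i + 1) := by
  rw [dd, Matrix.mulVec_sub, R3_zz, R3_zz, dd, add_right_comm i 1 1, add_right_comm i 2 1]

lemma dd_indep (i j : Fin 3) (hij : i ≠ j) (m : Fin 2 → ℝ) (h1 : dd i ⬝ᵥ m = 0)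
    (h2 : dd j ⬝ᵥ m = 0) : m = 0 := by
  have h3 : Real.sqrt 3 * Real.sqrt 3 = 3 := Real.mul_self_sqrt (by norm_num)
  have h0 : 0 < Real.sqrt 3 := by positivity
  have key : ∀ a b : ℝ, (a + b * Real.sqrt 3 = 0) → (a - b * Real.sqrt 3 = 0) → a = 0 ∧ b = 0 := by
    intro a b h h'
    have ha : a = 0 := by linarith
    have hb : b * Real.sqrt 3 = 0 := by linarith
    exact ⟨ha, (mul_eq_zero.1 hb).resolve_right h0.ne'⟩
  have : m 0 = 0 ∧ m 1 = 0 := by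
    fin_cases i <;> fin_cases j <;> simp [dd, zz, dotProduct, Fin.sum_univ_two, h0.ne'] at h1 h2 hij <;>
    constructor <;> nlinarith
  ext k; fin_cases k <;> simp [this]

lemma dd_ne_zero (i : Fin 3) : dd i ≠ 0 := by
  intro h
  have h0 := congrFun (dd_indep i (i + 1) (by fin_cases i <;> simp) ![1, 0] (by rw [h]; simp)
    (by rw [← R3_dd, h]; simp)) 0
  simp at h0

lemma R3_cube (x : Fin 2 → ℝ) : R3.mulVec (R3.mulVec (R3.mulVec x)) = x := by
  have h3 : Real.sqrt 3 * Real.sqrt 3 = 3 := Real.mul_self_sqrt (by norm_num)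
  have h4 : Real.sqrt 3 * Real.sqrt 3 * Real.sqrt 3 = 3 * Real.sqrt 3 := by rw [h3]
  have : R3 * R3 * R3 = 1 := by
    ext i j; fin_cases i <;> fin_cases j <;>
    simp [R3, Matrix.mul_apply, Fin.sum_univ_two] <;> nlinarith [h4]
  rw [Matrix.mulVec_mulVec, Matrix.mulVec_mulVec, this, Matrix.one_mulVec]

lemma exists_class (G : SimpleGraph V) (T : Fin 3 → G.Subgraph)
    (h : ∀ v : V, ({i : Fin 3 | v ∈ (T i).verts}).ncard = 2) :
    ∃ c : V → Fin 3, ∀ v i, v ∈ (T i).verts ↔ i ≠ c v := by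
  have : ∀ v, ∃ c, ∀ i, v ∈ (T i).verts ↔ i ≠ c := by
    intro v
    have h1 := Set.ncard_add_ncard_compl {i : Fin 3 | v ∈ (T i).verts}
    rw [h v, Nat.card_eq_fintype_card, Fintype.card_fin] at h1
    obtain ⟨c, hc⟩ := Set.ncard_eq_one.1
      (show ({i : Fin 3 | v ∈ (T i).verts}ᶜ).ncard = 1 by omega)
    refine ⟨c, fun i => ?_⟩
    have := Set.ext_iff.1 hc i
    simp only [Set.mem_compl_iff, Set.mem_ofPred_eq, Set.mem_singleton_iff] at this
    tauto
  choose c hc using this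
  exact ⟨c, hc⟩

lemma card_edges (G : SimpleGraph V) (T : Fin 3 → G.Subgraph) (hT : Is3Tree2Partition G T)
    (c : V → Fin 3) (hc : ∀ v i, v ∈ (T i).verts ↔ i ≠ c v) :
    Nat.card G.edgeSet + 3 = 2 * Fintype.card V := by
  classical
  have hE : Nat.card G.edgeSet = ∑ i, Nat.card (T i).edgeSet := by
    rw [← Nat.card_sigma]
    symm
    apply Nat.card_eq_of_bijective
      (fun x : (Σ i, (T i).edgeSet) => (⟨x.2.1, (T x.1).edgeSet_subset x.2.2⟩ : G.edgeSet))
    constructor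
    · rintro ⟨i, e, he⟩ ⟨j, e', he'⟩ h
      simp only [Subtype.mk.injEq] at h
      subst h
      obtain rfl := (hT.2.1 e ((T i).edgeSet_subset he)).unique he he'
      rfl
    · rintro ⟨e, he⟩
      obtain ⟨i, hi, -⟩ := hT.2.1 e he
      exact ⟨⟨i, e, hi⟩, rfl⟩
  have hTi : ∀ i, Nat.card (T i).edgeSet + 1 = Nat.card (T i).verts := by
    intro i
    rw [← (SimpleGraph.isTree_iff_connected_and_card.1 (hT.1 i)).2]
    congr 1
    rw [← (T i).image_coe_edgeSet_coe]
    exact Nat.card_image_of_injective (Sym2.map.injective Subtype.val_injective) _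
  have hVt : ∑ i, Nat.card (T i).verts = 2 * Fintype.card V := by
    have : ∀ i, Nat.card (T i).verts = ∑ v, if i ≠ c v then 1 else 0 := by
      intro i
      rw [Finset.sum_boole, Nat.cast_id, Nat.card_eq_card_toFinset]
      congr 1
      ext v; simp [hc]
    simp only [this]
    rw [Finset.sum_comm]
    have h2 : ∀ k : Fin 3, (∑ i, if i ≠ k then 1 else 0) = 2 := by decide
    simp only [h2]
    simp [mul_comm]
  rw [hE, ← hVt, ← Finset.sum_congr rfl (fun i _ => hTi i), Finset.sum_add_distrib]
  simp

lemma base_indep (G : SimpleGraph V) (T : Fin 3 → G.Subgraph) (hT : Is3Tree2Partition G T)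
    (c : V → Fin 3) (hc : ∀ v i, v ∈ (T i).verts ↔ i ≠ c v)
    (τ : G.edgeSet → Fin 3) (hτ : ∀ (e : G.edgeSet) i, (e : Sym2 V) ∈ (T i).edgeSet ↔ i = τ e)
    (f : V → ℝ) (hf : Function.Injective f) :
    LinearIndependent ℝ (fun e : G.edgeSet =>
      rigidityRow (fun v => f v • dd (τ e)) (e : Sym2 V)) := by
  classical
  set r := fun e : G.edgeSet => rigidityRow (fun v => f v • dd (τ e)) (e : Sym2 V) with hr
  have hcard := card_edges G T hT c hc
  have hrank := finrank_ann r
  have hadj : ∀ m ∈ ann r, ∀ i u w, (T i).Adj u w → dd i ⬝ᵥ m u = dd i ⬝ᵥ m w := by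
    intro m hm i u w h
    have hG : G.Adj u w := (T i).adj_sub h
    have h1 := hm ⟨s(u, w), hG⟩
    have h2 : i = τ ⟨s(u, w), hG⟩ := (hτ _ i).1 h
    simp only [hr] at h1
    rw [rigidityRow_dot _ _ _ _ hG.ne, ← h2, ← sub_smul, smul_dotProduct, smul_eq_mul,
      mul_eq_zero, sub_eq_zero, dotProduct_sub, sub_eq_zero] at h1
    exact h1.resolve_left fun h => hG.ne (hf h)
  have hconst : ∀ m ∈ ann r, ∀ i, ∀ u w : (T i).verts, dd i ⬝ᵥ m u = dd i ⬝ᵥ m w := by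
    intro m hm i u w
    obtain ⟨p⟩ := (hT.1 i).connected.preconnected u w
    induction p with
    | nil => rfl
    | cons h _ ih => exact (hadj m hm i _ _ h).trans ih
  have hne : ∀ i, Nonempty (T i).verts := fun i => (hT.1 i).connected.nonempty
  let b : ∀ i, (T i).verts := fun i => (hne i).some
  let L : ann r →ₗ[ℝ] (Fin 3 → ℝ) :=
    { toFun := fun m i => dd i ⬝ᵥ m.1 (b i)
      map_add' := by intro x y; ext i; simp [dotProduct_add]
      map_smul' := by intro a x; ext i; simp only [Submodule.coe_smul, Pi.smul_apply, dotProduct_smul, RingHom.id_apply] }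
  have hL : Function.Injective L := by
    rw [← LinearMap.ker_eq_bot, LinearMap.ker_eq_bot']
    rintro ⟨m, hm⟩ h
    have h0 : ∀ i, ∀ v ∈ (T i).verts, dd i ⬝ᵥ m v = 0 := by
      intro i v hv
      rw [hconst m hm i ⟨v, hv⟩ (b i)]
      exact congrFun h i
    ext1
    funext v
    exact dd_indep (c v + 1) (c v + 2) (by generalize c v = k; revert k; decide) _
      (h0 _ v ((hc _ _).2 (by generalize c v = k; revert k; decide)))
      (h0 _ v ((hc _ _).2 (by generalize c v = k; revert k; decide)))
  have h3 := LinearMap.finrank_le_finrank_of_injective hL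
  rw [Module.finrank_fintype_fun_eq_card, Fintype.card_fin] at h3
  rw [linearIndependent_iff_card_eq_finrank_span]
  have h4 := finrank_range_le_card (R := ℝ) r
  rw [Nat.card_eq_fintype_card] at hcard
  rw [Set.finrank] at h4 ⊢
  omega

lemma rigid_of_indep (G : SimpleGraph V) (hcard : Nat.card G.edgeSet + 3 = 2 * Fintype.card V)
    (p : V → Fin 2 → ℝ) (a b : V) (hab : p a ≠ p b) (hp : Independent G p) : InfRigid G p := by
  classical
  set r := fun e : G.edgeSet => rigidityRow p (e : Sym2 V) with hr
  have hrank := finrank_ann r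
  have h1 := linearIndependent_iff_card_eq_finrank_span.1 hp
  rw [Set.finrank] at h1
  rw [Nat.card_eq_fintype_card] at hcard
  change _ = Module.finrank ℝ (Submodule.span ℝ (Set.range r)) at h1
  have h3 : Module.finrank ℝ (ann r) = 3 := by omega
  let L : (Fin 3 → ℝ) →ₗ[ℝ] (V → Fin 2 → ℝ) :=
    { toFun := fun x v => ![- x 0 * p v 1 + x 1, x 0 * p v 0 + x 2]
      map_add' := by
        intro x y; ext v i; fin_cases i <;> simp <;> ring
      map_smul' := by
        intro x y; ext v i; fin_cases i <;> simp <;> ring }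
  have hL : Function.Injective L := by
    rw [← LinearMap.ker_eq_bot, LinearMap.ker_eq_bot']
    intro x h
    have e1 := congrFun (congrFun h a) 0
    have e2 := congrFun (congrFun h a) 1
    have e3 := congrFun (congrFun h b) 0
    have e4 := congrFun (congrFun h b) 1
    simp [L] at e1 e2 e3 e4
    have hx : x 0 = 0 := by
      by_contra hx
      apply hab
      ext i
      fin_cases i
      · exact mul_left_cancel₀ hx (show x 0 * p a 0 = x 0 * p b 0 by linarith)
      · exact mul_left_cancel₀ hx (show x 0 * p a 1 = x 0 * p b 1 by linarith)
    rw [hx] at e1 e2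
    ext i; fin_cases i <;> simp <;> linarith
  have hle : LinearMap.range L ≤ ann r := by
    rintro _ ⟨x, rfl⟩ ⟨e, he⟩
    induction e using Sym2.ind with
    | _ u w =>
      have hG : G.Adj u w := he
      simp only [hr]
      rw [rigidityRow_dot _ _ _ _ hG.ne]
      simp [L, dotProduct, Fin.sum_univ_two]; ring
  have heq : LinearMap.range L = ann r := by
    apply Submodule.eq_of_le_of_finrank_eq hle
    rw [LinearMap.finrank_range_of_inj hL, h3]; simp
  intro m hm
  have : m ∈ ann r := by
    rintro ⟨e, he⟩
    induction e using Sym2.ind with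
    | _ u w =>
      have hG : G.Adj u w := he
      simp only [hr]
      rw [rigidityRow_dot _ _ _ _ hG.ne]
      exact hm u w hG
  rw [← heq] at this
  obtain ⟨x, rfl⟩ := this
  refine ⟨!![0, - x 0; x 0, 0], ?_, ![x 1, x 2], fun v => ?_⟩
  · ext i j; fin_cases i <;> fin_cases j <;> simp
  · ext i; fin_cases i <;> simp [L, Matrix.mulVec, dotProduct, Fin.sum_univ_two]

lemma split_aux (G : SimpleGraph V) (T : Fin 3 → G.Subgraph)
    (c : V → Fin 3) (hc : ∀ v i, v ∈ (T i).verts ↔ i ≠ c v)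
    (U : Set V) (i j k : Fin 3) (hU : ∀ v ∈ U, c v = i) (hijk : ∀ l, l = i ∨ l = j ∨ l = k)
    (hn : ¬ ((T j).induce U).coe.Preconnected) :
    ∃ A ⊆ U, (∃ a, a ∈ A) ∧ (∃ b ∈ U, b ∉ A) ∧
      ∀ u ∈ A, ∀ w ∈ U, w ∉ A → ∀ l, (T l).Adj u w → l = k := by
  simp only [SimpleGraph.Preconnected, not_forall] at hn
  obtain ⟨a, b, hab⟩ := hn
  refine ⟨{v | ∃ h : v ∈ U, ((T j).induce U).coe.Reachable a ⟨v, h⟩}, ?_, ⟨a, a.2, ?_⟩,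
    ⟨b, b.2, ?_⟩, ?_⟩
  · rintro v ⟨h, -⟩; exact h
  · exact SimpleGraph.Reachable.refl _
  · rintro ⟨_, h⟩; exact hab h
  · rintro u ⟨hu, hau⟩ w hw hwA l hl
    rcases hijk l with rfl | rfl | rfl
    · exact absurd (hU u hu).symm ((hc u l).1 ((T l).edge_vert hl))
    · exfalso
      apply hwA
      refine ⟨hw, hau.trans ?_⟩
      apply SimpleGraph.Adj.reachable
      exact ⟨hu, hw, hl⟩
    · rfl

lemma exists_split (G : SimpleGraph V) (T : Fin 3 → G.Subgraph)
    (hT : IsProper3Tree2Partition G T)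
    (c : V → Fin 3) (hc : ∀ v i, v ∈ (T i).verts ↔ i ≠ c v)
    (U : Set V) (i : Fin 3) (hU : ∀ v ∈ U, c v = i) (hU2 : 2 ≤ U.ncard) :
    ∃ k : Fin 3, ∃ A ⊆ U, (∃ a, a ∈ A) ∧ (∃ b ∈ U, b ∉ A) ∧
      ∀ u ∈ A, ∀ w ∈ U, w ∉ A → ∀ l, (T l).Adj u w → l = k := by
  have hne : Nonempty U := by
    by_contra h
    rw [not_nonempty_iff, Set.isEmpty_coe_sort] at h
    simp [h] at hU2
  by_cases h1 : ((T (i + 1)).induce U).coe.Preconnected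
  · by_cases h2 : ((T (i + 2)).induce U).coe.Preconnected
    · exfalso
      have key : ∀ j, j ≠ i → ((T j).induce U).coe.Preconnected →
          (T j).induce U ≤ T j ∧ ((T j).induce U).coe.IsTree := by
        intro j hj hp
        have hle : (T j).induce U ≤ T j := by
          refine ⟨fun v hv => (hc v j).2 ?_, fun u w h => h.2.2⟩
          rw [hU v hv]; exact hj
        refine ⟨hle, ⟨?_, ?_⟩⟩
        · have : Nonempty ((T j).induce U).verts := hne
          exact ⟨hp⟩
        · exact (hT.1.1 j).isAcyclic.comap (SimpleGraph.Subgraph.inclusion hle)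
            (SimpleGraph.Subgraph.inclusion.injective hle)
      have k1 := key (i + 1) (by clear * -; revert i; decide) h1
      have k2 := key (i + 2) (by clear * -; revert i; decide) h2
      exact hT.2 (i + 1) (i + 2) (by clear * -; revert i; decide) _ _ k1.1 k2.1 k1.2 k2.2 hU2 hU2 rfl
    · exact ⟨i + 1, split_aux G T c hc U i (i + 2) (i + 1) hU (by clear * -; revert i; decide) h2⟩
  · exact ⟨i + 2, split_aux G T c hc U i (i + 1) (i + 2) hU (by clear * -; revert i; decide) h1⟩

/-- The invariant of the perturbation process. -/
structure Inv_s4 (G : SimpleGraph V) (γ : G ≃g G) (c : V → Fin 3)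
    (B : G.edgeSet → V → Fin 2 → ℝ) (p : V → Fin 2 → ℝ) (r : G.edgeSet → V → Fin 2 → ℝ) :
    Prop where
  sym : C3Symmetric G γ p
  cls : ∀ u w, p u = p w → c u = c w
  li : LinearIndependent ℝ r
  edge : ∀ e : G.edgeSet, (∃ s : ℝ, s ≠ 0 ∧ rigidityRow p (e : Sym2 V) = s • r e) ∨
    (rigidityRow p (e : Sym2 V) = 0 ∧ r e = B e)

lemma inv_step (G : SimpleGraph V) (γ : G ≃g G) (c : V → Fin 3)
    (B : G.edgeSet → V → Fin 2 → ℝ) (p : V → Fin 2 → ℝ) (r : G.edgeSet → V → Fin 2 → ℝ)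
    (h : Inv_s4 G γ c B p r) (x : V → Fin 2 → ℝ) (hx : C3Symmetric G γ x)
    (hxB : ∀ e : G.edgeSet, rigidityRow p (e : Sym2 V) = 0 →
      ∃ s : ℝ, rigidityRow x (e : Sym2 V) = s • B e)
    (a b : V) (hab : p a = p b) (hxab : x a ≠ x b) :
    ∃ p' r', Inv_s4 G γ c B p' r' ∧ (∀ u w, p' u = p' w → p u = p w) ∧ p' a ≠ p' b := by
  classical
  have hy : ∀ e : G.edgeSet, ∃ y : V → Fin 2 → ℝ,
      (∃ s : ℝ, s ≠ 0 ∧ rigidityRow p (e : Sym2 V) = s • r e ∧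
        y = s⁻¹ • rigidityRow x (e : Sym2 V)) ∨
      (rigidityRow p (e : Sym2 V) = 0 ∧ r e = B e ∧ y = 0) := by
    intro e
    rcases h.edge e with ⟨s, hs, hs'⟩ | h'
    · exact ⟨_, Or.inl ⟨s, hs, hs', rfl⟩⟩
    · exact ⟨0, Or.inr ⟨h'.1, h'.2, rfl⟩⟩
  choose y hy using hy
  have ev1 : ∀ᶠ t : ℝ in nhds 0, LinearIndependent ℝ (r + t • y) := by
    have hcont : Continuous (fun t : ℝ => r + t • y) := by fun_prop
    have h0 : LinearIndependent ℝ (r + (0 : ℝ) • y) := by simpa using h.li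
    exact hcont.continuousAt.eventually (LinearIndependent.eventually h0)
  have ev2 : ∀ᶠ t : ℝ in nhds 0, ∀ u w, p u ≠ p w → (p + t • x) u ≠ (p + t • x) w := by
    rw [Filter.eventually_all]; intro u
    rw [Filter.eventually_all]; intro w
    by_cases huw : p u = p w
    · simp [huw]
    · have hcont : Continuous (fun t : ℝ => (p + t • x) u - (p + t • x) w) := by
        simp only [Pi.add_apply, Pi.smul_apply]; fun_prop
      have := hcont.continuousAt.eventually_ne (x := 0) (y := 0)
        (by simpa [sub_eq_zero] using huw)
      filter_upwards [this] with t ht _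
      exact sub_ne_zero.1 ht
  obtain ⟨t, ⟨ht1, ht2⟩, ht0⟩ :=
    (((ev1.and ev2).filter_mono (nhdsWithin_le_nhds (s := {0}ᶜ))).and
      (eventually_mem_nhdsWithin)).exists
  have ht0 : t ≠ 0 := ht0
  have hback : ∀ u w, (p + t • x) u = (p + t • x) w → p u = p w := by
    intro u w h1
    by_contra h2
    exact ht2 u w h2 h1
  refine ⟨p + t • x, r + t • y, ⟨?_, ?_, ht1, ?_⟩, hback, ?_⟩
  · intro v
    simp only [Pi.add_apply, Pi.smul_apply, Matrix.mulVec_add, Matrix.mulVec_smul]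
    rw [h.sym v, hx v]
  · intro u w h1; exact h.cls u w (hback u w h1)
  · intro e
    rw [rigidityRow_add]
    rcases hy e with ⟨s, hs, h1, h2⟩ | ⟨h1, h2, h3⟩
    · left
      refine ⟨s, hs, ?_⟩
      rw [h1, Pi.add_apply, Pi.smul_apply, h2, smul_add, smul_comm s t, smul_inv_smul₀ hs]
    · obtain ⟨s, hs⟩ := hxB e h1
      by_cases h0 : s = 0
      · right
        rw [h1, hs, h0, Pi.add_apply, Pi.smul_apply, h2, h3]; simp
      · left
        refine ⟨t * s, mul_ne_zero ht0 h0, ?_⟩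
        rw [h1, hs, Pi.add_apply, Pi.smul_apply, h3, ← h2]; simp [mul_smul]
  · simp only [Pi.add_apply, Pi.smul_apply, hab]
    intro h1
    exact hxab (smul_right_injective _ ht0 (add_left_cancel h1))

/-- Base rows. -/
def baseRow (G : SimpleGraph V) (f : V → ℝ) (τ : G.edgeSet → Fin 3) (e : G.edgeSet) :
    V → Fin 2 → ℝ :=
  rigidityRow (fun v => f v • dd (τ e)) (e : Sym2 V)

lemma row_base (G : SimpleGraph V) (f : V → ℝ) (hf : Function.Injective f)
    (τ : G.edgeSet → Fin 3) (x : V → Fin 2 → ℝ) (u w : V) (h : G.Adj u w) (s : ℝ)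
    (hs : x u - x w = s • dd (τ ⟨s(u, w), h⟩)) :
    ∃ s' : ℝ, rigidityRow x s(u, w) = s' • baseRow G f τ ⟨s(u, w), h⟩ := by
  have hne : f u - f w ≠ 0 := sub_ne_zero.2 fun h' => h.ne (hf h')
  refine ⟨s / (f u - f w), ?_⟩
  apply rigidityRow_eq_smul
  rw [hs, ← sub_smul, smul_smul, div_mul_cancel₀ _ hne]

lemma class_map (G : SimpleGraph V) (γ : G ≃g G) (T : Fin 3 → G.Subgraph)
    (hmap : ∀ i : Fin 3, (T i).map γ.toHom = T (i + 1))
    (c : V → Fin 3) (hc : ∀ v i, v ∈ (T i).verts ↔ i ≠ c v) (v : V) :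
    c (γ v) = c v + 1 := by
  have key : ∀ i, i ≠ c v → i + 1 ≠ c (γ v) := by
    intro i hi
    rw [← hc, ← hmap]
    exact ⟨v, (hc v i).2 hi, rfl⟩
  generalize c (γ v) = k at *
  generalize c v = l at *
  clear * - key
  revert k l
  decide

lemma exists_x (G : SimpleGraph V) (γ : G ≃g G) (hγ3 : ∀ v, γ (γ (γ v)) = v)
    (T : Fin 3 → G.Subgraph) (hT : IsProper3Tree2Partition G T)
    (hmap : ∀ i : Fin 3, (T i).map γ.toHom = T (i + 1))
    (c : V → Fin 3) (hc : ∀ v i, v ∈ (T i).verts ↔ i ≠ c v)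
    (p : V → Fin 2 → ℝ) (hp : C3Symmetric G γ p) (hcls : ∀ u w, p u = p w → c u = c w)
    (a₀ b₀ : V) (hne : a₀ ≠ b₀) (hab : p a₀ = p b₀) :
    ∃ x : V → Fin 2 → ℝ, C3Symmetric G γ x ∧
      (∀ u w l, (T l).Adj u w → p u = p w → ∃ s : ℝ, x u - x w = s • dd l) ∧
      ∃ a b, p a = p b ∧ x a ≠ x b := by
  classical
  have hcγ := class_map G γ T hmap c hc
  have hadj : ∀ l u w, (T l).Adj u w → (T (l + 1)).Adj (γ u) (γ w) := by
    intro l u w h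
    rw [← hmap]
    exact ⟨u, w, h, rfl, rfl⟩
  obtain ⟨k, A, hAU, ⟨a, ha⟩, ⟨b, hbU, hbA⟩, hA⟩ := exists_split G T hT c hc
    {v | p v = p a₀} (c a₀) (fun v hv => hcls _ _ hv) (by
      refine (Set.ncard_pair hne).ge.trans ?_
      refine Set.ncard_le_ncard ?_ (Set.toFinite _)
      rintro v (rfl | rfl)
      · rfl
      · exact hab.symm)
  have hpA : ∀ v ∈ A, p v = p a₀ := fun v hv => hAU hv
  have hcA : ∀ v ∈ A, c v = c a₀ := fun v hv => hcls _ _ (hpA v hv)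
  let χ : V → ℝ := fun v => if v ∈ A then 1 else 0
  let x : V → Fin 2 → ℝ := fun v =>
    χ v • dd k + χ (γ (γ v)) • dd (k + 1) + χ (γ v) • dd (k + 2)
  have hxsym : C3Symmetric G γ x := by
    intro v
    simp only [x, hγ3, Matrix.mulVec_add, Matrix.mulVec_smul, R3_dd]
    have e1 : k + 1 + 1 = k + 2 := by clear * -; revert k; decide
    have e2 : k + 2 + 1 = k := by clear * -; revert k; decide
    rw [e1, e2]; abel
  have hx0 : ∀ v, c v = c a₀ → x v = χ v • dd k := by
    intro v hv
    have h1 : χ (γ v) = 0 := by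
      simp only [χ]; rw [if_neg]
      intro h
      have := hcA _ h
      rw [hcγ, hv] at this
      clear * - this
      revert this; generalize c a₀ = l; revert l; decide
    have h2 : χ (γ (γ v)) = 0 := by
      simp only [χ]; rw [if_neg]
      intro h
      have := hcA _ h
      rw [hcγ, hcγ, hv] at this
      clear * - this
      revert this; generalize c a₀ = l; revert l; decide
    simp [x, h1, h2]
  have main : ∀ u w l, c u = c a₀ → (T l).Adj u w → p u = p w →
      ∃ s : ℝ, x u - x w = s • dd l := by
    intro u w l hu h huw
    have hw : c w = c a₀ := (hcls _ _ huw).symm.trans hu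
    rw [hx0 u hu, hx0 w hw]
    by_cases h1 : u ∈ A
    · by_cases h2 : w ∈ A
      · exact ⟨0, by simp [χ, h1, h2]⟩
      · have := hA u h1 w (huw.symm.trans (hpA u h1)) h2 l h
        exact ⟨1, by simp [χ, h1, h2, this]⟩
    · by_cases h2 : w ∈ A
      · have := hA w h2 u (huw.trans (hpA w h2)) h1 l h.symm
        exact ⟨-1, by simp [χ, h1, h2, this]⟩
      · exact ⟨0, by simp [χ, h1, h2]⟩
  have rot : ∀ u w l, (∃ s : ℝ, x (γ u) - x (γ w) = s • dd (l + 1)) →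
      ∃ s : ℝ, x u - x w = s • dd l := by
    rintro u w l ⟨s, hs⟩
    refine ⟨s, ?_⟩
    rw [hxsym u, hxsym w, ← R3_dd, ← Matrix.mulVec_sub, ← Matrix.mulVec_smul] at hs
    rw [← R3_cube (x u - x w), hs, R3_cube]
  have hpγ : ∀ u w, p u = p w → p (γ u) = p (γ w) := by
    intro u w h; rw [hp u, hp w, h]
  refine ⟨x, hxsym, ?_, a, b, ?_, ?_⟩
  · intro u w l h huw
    have h3 : c u = c a₀ ∨ c u + 1 = c a₀ ∨ c u + 1 + 1 = c a₀ := by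
      generalize c u = m
      generalize c a₀ = n
      clear * -
      revert m n; decide
    rcases h3 with h3 | h3 | h3
    · exact main u w l h3 h huw
    · exact rot _ _ _ (main _ _ _ (by rw [hcγ, h3]) (hadj _ _ _ h) (hpγ _ _ huw))
    · exact rot _ _ _ (rot _ _ _ (main _ _ _ (by rw [hcγ, hcγ, h3])
        (hadj _ _ _ (hadj _ _ _ h)) (hpγ _ _ (hpγ _ _ huw))))
  · rw [hpA a ha]; exact (show p b = p a₀ from hbU).symm
  · rw [hx0 a (hcA a ha), hx0 b (hcls _ _ hbU)]
    simpa [χ, ha, hbA] using dd_ne_zero k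

lemma exists_injective (G : SimpleGraph V) (γ : G ≃g G) (hγ3 : ∀ v, γ (γ (γ v)) = v)
    (T : Fin 3 → G.Subgraph) (hT : IsProper3Tree2Partition G T)
    (hmap : ∀ i : Fin 3, (T i).map γ.toHom = T (i + 1))
    (c : V → Fin 3) (hc : ∀ v i, v ∈ (T i).verts ↔ i ≠ c v)
    (τ : G.edgeSet → Fin 3) (hτ : ∀ (e : G.edgeSet) i, (e : Sym2 V) ∈ (T i).edgeSet ↔ i = τ e)
    (f : V → ℝ) (hf : Function.Injective f) (n : ℕ) :
    ∀ p r, Inv_s4 G γ c (baseRow G f τ) p r →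
      ({x : V × V | p x.1 = p x.2}).ncard = n →
      ∃ p' r', Inv_s4 G γ c (baseRow G f τ) p' r' ∧ Function.Injective p' := by
  induction n using Nat.strong_induction_on with
  | _ n ih =>
    intro p r hI hn
    by_cases hinj : Function.Injective p
    · exact ⟨p, r, hI, hinj⟩
    · simp only [Function.Injective, not_forall] at hinj
      obtain ⟨a₀, b₀, hab₀, hne⟩ := hinj
      obtain ⟨x, hx, hxT, a, b, hab, hxab⟩ := exists_x G γ hγ3 T hT hmap c hc p hI.sym hI.cls
        a₀ b₀ hne hab₀
      obtain ⟨p', r', hI', hsub, hab'⟩ := inv_step G γ c _ p r hI x hx (by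
        rintro ⟨e, he⟩ h0
        induction e using Sym2.ind with
        | _ u w =>
          have hG : G.Adj u w := he
          obtain ⟨s, hs⟩ := hxT u w (τ ⟨s(u, w), he⟩) ((hτ ⟨s(u, w), he⟩ _).2 rfl)
            (rigidityRow_eq_zero h0)
          exact row_base G f hf τ x u w hG s hs) a b hab hxab
      refine ih _ ?_ p' r' hI' rfl
      rw [← hn]
      refine Set.ncard_lt_ncard ?_ (Set.toFinite _)
      refine ⟨fun y hy => hsub _ _ hy, fun h => ?_⟩
      exact hab' (h (show (a, b) ∈ {x : V × V | p x.1 = p x.2} from hab))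

/-- If `G` (with `|V(G)| ≥ 3` and automorphism `γ` with `γ³ = id`) has a proper
`(C₃, γ)` 3Tree2 partition, then there exists an isostatic framework `(G, p)` in `ℝ²`
that is `C₃`-symmetric of type `γ`. -/
theorem c3_3Tree2_implies_isostatic {V : Type*} [Fintype V] [DecidableEq V]
    (G : SimpleGraph V) (hV : 3 ≤ Fintype.card V)
    (γ : G ≃g G) (hγ3 : ∀ v, γ (γ (γ v)) = v)
    (T : Fin 3 → G.Subgraph)
    (hT : IsC3_3Tree2Partition G γ T ∧ IsProper3Tree2Partition G T) :
    ∃ p : V → Fin 2 → ℝ, Isostatic G p ∧ C3Symmetric G γ p := by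
  classical
  obtain ⟨⟨h1, hmap⟩, h2⟩ := hT
  obtain ⟨c, hc⟩ := exists_class G T h1.2.2
  have hτ : ∀ e : G.edgeSet, ∃ k, ∀ i, (e : Sym2 V) ∈ (T i).edgeSet ↔ i = k := by
    rintro ⟨e, he⟩
    obtain ⟨k, hk, hu⟩ := h1.2.1 e he
    exact ⟨k, fun i => ⟨fun h => hu i h, fun h => h ▸ hk⟩⟩
  choose τ hτ using hτ
  obtain ⟨f, hf⟩ : ∃ f : V → ℝ, Function.Injective f :=
    ⟨fun v => ((Fintype.equivFin V v : ℕ) : ℝ), fun u w h =>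
      (Fintype.equivFin V).injective (Fin.ext (Nat.cast_injective h))⟩
  have hzz : Function.Injective zz := by
    intro i j hij
    have h3 : 0 < Real.sqrt 3 := by positivity
    have e0 := congrFun hij 0
    have e1 := congrFun hij 1
    fin_cases i <;> fin_cases j <;> simp [zz] at e0 e1 ⊢ <;> linarith
  have hI : Inv_s4 G γ c (baseRow G f τ) (fun v => zz (c v)) (baseRow G f τ) := by
    refine ⟨fun v => ?_, fun u w h => hzz h, base_indep G T h1 c hc τ hτ f hf, ?_⟩
    · simp only [class_map G γ T hmap c hc v, R3_zz]
    · rintro ⟨e, he⟩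
      induction e using Sym2.ind with
      | _ u w =>
        have hG : G.Adj u w := he
        have hadj : (T (τ ⟨s(u, w), he⟩)).Adj u w := (hτ ⟨s(u, w), he⟩ _).2 rfl
        have hu := (hc _ _).1 ((T _).edge_vert hadj)
        have hw := (hc _ _).1 ((T _).edge_vert hadj.symm)
        have : ∃ s : ℝ, zz (c u) - zz (c w) = s • dd (τ ⟨s(u, w), he⟩) := by
          generalize τ ⟨s(u, w), he⟩ = l at *
          have h3 : ∀ x l : Fin 3, l ≠ x → x = l + 1 ∨ x = l + 2 := by decide
          rcases h3 _ _ hu with hu | hu <;> rcases h3 _ _ hw with hw | hw <;> rw [hu, hw]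
          · exact ⟨0, by simp⟩
          · exact ⟨1, by simp [dd]⟩
          · exact ⟨-1, by simp [dd]⟩
          · exact ⟨0, by simp⟩
        obtain ⟨s, hs⟩ := this
        obtain ⟨s', hs'⟩ := row_base G f hf τ (fun v => zz (c v)) u w hG s hs
        by_cases h0 : s' = 0
        · right
          exact ⟨by rw [hs', h0, zero_smul], rfl⟩
        · left
          exact ⟨s', h0, hs'⟩
  obtain ⟨p, r, hp, hinj⟩ := exists_injective G γ hγ3 T h2 hmap c hc τ hτ f hf _ _ _ hI rfl
  have hs : ∀ e : G.edgeSet, ∃ s : ℝˣ, rigidityRow p (e : Sym2 V) = s • r e := by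
    intro e
    rcases hp.edge e with ⟨s, hs, h⟩ | ⟨h, -⟩
    · exact ⟨Units.mk0 s hs, h⟩
    · exfalso
      obtain ⟨e, he⟩ := e
      induction e using Sym2.ind with
      | _ u w =>
        have hG : G.Adj u w := he
        exact hG.ne (hinj (rigidityRow_eq_zero h))
  choose s hs using hs
  have hind : Independent G p := by
    have := hp.li.units_smul s
    unfold Independent
    convert this using 1
    funext e
    exact hs e
  obtain ⟨a, b, hab⟩ := Fintype.exists_pair_of_one_lt_card (show 1 < Fintype.card V by omega)
  exact ⟨p, ⟨fun u w h hpw => h.ne (hinj hpw),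
    rigid_of_indep G (card_edges G T h1 c hc) p a b (fun h => hab (hinj h)) hind, hind⟩, hp.sym⟩


end C3Laman
end
end

section
/- Let G be a finite simple graph with |V(G)| ≥ 3 and let γ be an automorphism of G with γ³ = id. Then G satisfies the Laman conditions and γ(v) ≠ v for every vertex v of G if and only if G has a proper (C₃,γ) 3Tree2 partition. -/
open Matrix

noncomputable section

namespace C3Laman

variable {V : Type*} [Fintype V] [DecidableEq V]

/-- The Laman conditions: `|E(G)| = 2|V(G)| - 3`, and `|E(H)| ≤ 2|V(H)| - 3` for every
subgraph `H` of `G` with at least two vertices. -/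
def Laman (G : SimpleGraph V) : Prop :=
  (G.edgeSet.ncard : ℤ) = 2 * Fintype.card V - 3 ∧
  ∀ H : G.Subgraph, 2 ≤ H.verts.ncard →
    (H.edgeSet.ncard : ℤ) ≤ 2 * (H.verts.ncard : ℤ) - 3

set_option linter.unusedSectionVars false

/-- Rotation of a vertex set. -/
def rot (γ : Equiv.Perm V) (X : Finset V) : Finset V := X.image γ

/-- Edges of `E` inside `X`. -/
def ins (E : Finset (Sym2 V)) (X : Finset V) : Finset (Sym2 V) := E.filter (· ∈ X.sym2)

/-- The freedom count. -/
def fr (E : Finset (Sym2 V)) (X : Finset V) : ℤ := 2 * (X.card : ℤ) - 3 - ((ins E X).card : ℤ)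

structure Good (γ : Equiv.Perm V) (S : Finset V) (E : Finset (Sym2 V)) : Prop where
  invS : ∀ v ∈ S, γ v ∈ S
  invE : ∀ e ∈ E, e.map γ ∈ E
  sub : ∀ e ∈ E, e ∈ S.sym2
  nd : ∀ e ∈ E, ¬ e.IsDiag
  sparse : ∀ X ⊆ S, 2 ≤ X.card → 0 ≤ fr E X
  tight : (E.card : ℤ) = 2 * (S.card : ℤ) - 3

/-- `F` meets the orbit of `e`. -/
def Cov (γ : Equiv.Perm V) (F : Finset (Sym2 V)) (e : Sym2 V) : Prop :=
  e ∈ F ∨ e.map γ ∈ F ∨ (e.map γ).map γ ∈ F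

structure Sol (γ : Equiv.Perm V) (S : Finset V) (E : Finset (Sym2 V)) (A : Finset V)
    (F : Finset (Sym2 V)) : Prop where
  subA : A ⊆ S
  subF : F ⊆ E
  two : ∀ v ∈ S, v ∈ A ∨ γ v ∈ A
  nthree : ∀ v, ¬ (v ∈ A ∧ γ v ∈ A ∧ γ (γ v) ∈ A)
  supp : ∀ e ∈ F, e ∈ A.sym2
  cov : ∀ e ∈ E, Cov γ F e
  card : F.card * 3 ≤ E.card
  conn : ∃ r ∈ A, ∀ x ∈ A, Relation.ReflTransGen (fun x y => s(x, y) ∈ F) r x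

section core
variable {γ : Equiv.Perm V}

lemma mem_rot (h3 : ∀ v, γ (γ (γ v)) = v) (X : Finset V) (y : V) :
    y ∈ rot γ X ↔ γ (γ y) ∈ X := by
  unfold rot
  rw [Finset.mem_image]
  constructor
  · rintro ⟨x, hx, rfl⟩
    rwa [h3]
  · intro h
    exact ⟨_, h, h3 y⟩

lemma map3 (h3 : ∀ v, γ (γ (γ v)) = v) (e : Sym2 V) :
    ((e.map γ).map γ).map γ = e := by
  induction e with
  | _ x y => simp [h3]

lemma card_rot (X : Finset V) : (rot γ X).card = X.card :=
  Finset.card_image_of_injective _ γ.injective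

lemma mem_ins {E : Finset (Sym2 V)} {X : Finset V} {e : Sym2 V} :
    e ∈ ins E X ↔ e ∈ E ∧ ∀ a ∈ e, a ∈ X := by
  unfold ins
  rw [Finset.mem_filter, Finset.mem_sym2_iff]

lemma ins_rot (h3 : ∀ v, γ (γ (γ v)) = v) {E : Finset (Sym2 V)}
    (hE : ∀ e ∈ E, e.map γ ∈ E) (X : Finset V) :
    (ins E (rot γ X)).card = (ins E X).card := by
  have : ins E (rot γ X) = (ins E X).image (Sym2.map γ) := by
    ext e
    rw [Finset.mem_image]
    constructor
    · intro h
      refine ⟨(e.map γ).map γ, ?_, map3 h3 e⟩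
      rw [mem_ins] at h ⊢
      refine ⟨hE _ (hE _ h.1), ?_⟩
      intro a ha
      rw [Sym2.mem_map] at ha
      obtain ⟨b, hb, rfl⟩ := ha
      rw [Sym2.mem_map] at hb
      obtain ⟨c, hc, rfl⟩ := hb
      exact (mem_rot h3 X c).1 (h.2 c hc)
    · rintro ⟨d, hd, rfl⟩
      rw [mem_ins] at hd ⊢
      refine ⟨hE _ hd.1, ?_⟩
      intro a ha
      rw [Sym2.mem_map] at ha
      obtain ⟨b, hb, rfl⟩ := ha
      rw [mem_rot h3, h3]
      exact hd.2 b hb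
  rw [this, Finset.card_image_of_injective _ (Sym2.map.injective γ.injective)]

lemma fr_rot (h3 : ∀ v, γ (γ (γ v)) = v) {E : Finset (Sym2 V)}
    (hE : ∀ e ∈ E, e.map γ ∈ E) (X : Finset V) :
    fr E (rot γ X) = fr E X := by
  unfold fr
  rw [ins_rot h3 hE, card_rot]

lemma fr_sub (E : Finset (Sym2 V)) (X Y : Finset V) :
    fr E (X ∪ Y) + fr E (X ∩ Y) ≤ fr E X + fr E Y := by
  unfold fr
  have h1 := Finset.card_union_add_card_inter X Y
  have h2 := Finset.card_union_add_card_inter (ins E X) (ins E Y)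
  have h3 : (ins E X ∪ ins E Y).card ≤ (ins E (X ∪ Y)).card := by
    apply Finset.card_le_card
    intro e
    simp only [Finset.mem_union, mem_ins]
    rintro (h | h)
    · exact ⟨h.1, fun a ha => Or.inl (h.2 a ha)⟩
    · exact ⟨h.1, fun a ha => Or.inr (h.2 a ha)⟩
  have h4 : (ins E X ∩ ins E Y).card ≤ (ins E (X ∩ Y)).card := by
    apply Finset.card_le_card
    intro e
    simp only [Finset.mem_inter, mem_ins]
    rintro ⟨h, h'⟩
    exact ⟨h.1, fun a ha => ⟨h.2 a ha, h'.2 a ha⟩⟩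
  omega

/-- A free order-three action on a finite set: cardinality divisible by 3. -/
lemma dvd_card {α : Type*} (f : α → α) (X : Finset α)
    (hX : ∀ x ∈ X, f x ∈ X) (h3 : ∀ x, f (f (f x)) = x)
    (hf : ∀ x ∈ X, f x ≠ x) : 3 ∣ X.card := by
  classical
  have : Fact (Nat.Prime 3) := ⟨by norm_num⟩
  let g : Function.End X := fun x => ⟨f x, hX _ x.2⟩
  have hg : g ^ 3 ^ 1 = 1 := by
    funext x
    apply Subtype.ext
    exact h3 x
  have := Equiv.Perm.card_fixedPoints_modEq hg
  rw [Fintype.card_coe] at this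
  have h0 : Fintype.card (Function.fixedPoints g) = 0 := by
    rw [Fintype.card_eq_zero_iff]
    constructor
    rintro ⟨x, hx⟩
    exact hf x x.2 (congrArg Subtype.val hx)
  rw [h0] at this
  exact (Nat.modEq_zero_iff_dvd).1 this

lemma edge_free (h3 : ∀ v, γ (γ (γ v)) = v) (hf : ∀ v, γ v ≠ v) (e : Sym2 V) :
    e.map γ ≠ e := by
  induction e with
  | _ x y =>
    rw [Sym2.map_mk]
    intro h
    rcases Sym2.eq_iff.1 h with ⟨h, _⟩ | ⟨h, h'⟩
    · exact hf _ h
    · apply hf x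
      have := h3 x
      rw [h, h'] at this
      rw [h]; rw [← this, h]
  
lemma fr_mod (h3 : ∀ v, γ (γ (γ v)) = v) (hf : ∀ v, γ v ≠ v) {E : Finset (Sym2 V)}
    (hE : ∀ e ∈ E, e.map γ ∈ E) (X : Finset V) (hX : rot γ X = X) : (3 : ℤ) ∣ fr E X := by
  have h1 : 3 ∣ X.card := by
    apply dvd_card γ X _ h3 (fun x _ => hf x)
    intro x hx
    rw [← hX, mem_rot h3, h3]
    exact hx
  have h2 : 3 ∣ (ins E X).card := by
    apply dvd_card (Sym2.map γ) _ _ (map3 h3) (fun x _ => edge_free h3 hf x)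
    intro e he
    rw [mem_ins] at he ⊢
    refine ⟨hE _ he.1, ?_⟩
    intro a ha
    rw [Sym2.mem_map] at ha
    obtain ⟨b, hb, rfl⟩ := ha
    rw [← hX, mem_rot h3, h3]
    exact he.2 b hb
  unfold fr
  omega

/-- Key uncrossing lemma. -/
lemma key (h3 : ∀ v, γ (γ (γ v)) = v) (hf : ∀ v, γ v ≠ v) {E : Finset (Sym2 V)}
    (hE : ∀ e ∈ E, e.map γ ∈ E) {S : Finset V} (hS : ∀ v ∈ S, γ v ∈ S) {a b : V}
    (hp : ∀ X ⊆ S, a ∈ X → b ∈ X → 1 ≤ fr E X)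
    (X : Finset V) (hXS : X ⊆ S) (ha : a ∈ X) (hb : b ∈ X) (ha1 : γ a ∈ X) (hb1 : γ b ∈ X) :
    2 ≤ fr E X ∧ (γ (γ a) ∈ X → γ (γ b) ∈ X → 3 ≤ fr E X) := by
  have hrS : ∀ X ⊆ S, rot γ X ⊆ S := by
    intro X hX y hy
    rw [mem_rot h3] at hy
    have := hS _ (hX hy)
    rwa [h3] at this
  have hp1 : ∀ X ⊆ S, γ a ∈ X → γ b ∈ X → 1 ≤ fr E X := by
    intro X hX h1 h2
    rw [← fr_rot h3 hE, ← fr_rot h3 hE]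
    apply hp _ (hrS _ (hrS _ hX)) <;> simp only [mem_rot h3, h3] <;> assumption
  have hp3 : ∀ X ⊆ S, rot γ X = X → a ∈ X → b ∈ X → 3 ≤ fr E X := by
    intro X hX hr h1 h2
    have := hp X hX h1 h2
    have := fr_mod h3 hf hE X hr
    omega
  set Y := rot γ X with hY
  set Z := rot γ Y with hZ
  have hYS : Y ⊆ S := hrS _ hXS
  have hZS : Z ⊆ S := hrS _ hYS
  have fY : fr E Y = fr E X := fr_rot h3 hE X
  have fZ : fr E Z = fr E X := by rw [hZ, fr_rot h3 hE, fY]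
  have mY : ∀ y, y ∈ Y ↔ γ (γ y) ∈ X := mem_rot h3 X
  have mZ : ∀ y, y ∈ Z ↔ γ y ∈ X := by
    intro y; rw [hZ, mem_rot h3, mY, h3]
  have s1 := fr_sub E X Y
  have s2 := fr_sub E (X ∪ Y) Z
  have s3 := fr_sub E ((X ∪ Y) ∩ Z) (X ∩ Y)
  have u : 3 ≤ fr E (X ∪ Y ∪ Z) := by
    apply hp3
    · exact Finset.union_subset (Finset.union_subset hXS hYS) hZS
    · ext y; simp only [mem_rot h3, Finset.mem_union, mY, mZ, h3]; tauto
    · simp [ha]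
    · simp [hb]
  have p1 : 1 ≤ fr E (X ∩ Y) := by
    apply hp1
    · exact Finset.inter_subset_left.trans hXS
    · simp [mY, h3, ha, ha1]
    · simp [mY, h3, hb, hb1]
  have p2 : 1 ≤ fr E ((X ∪ Y) ∩ Z) := by
    apply hp
    · exact Finset.inter_subset_right.trans hZS
    · simp [mZ, ha, ha1]
    · simp [mZ, hb, hb1]
  refine ⟨by omega, ?_⟩
  intro ha2 hb2
  have m : 3 ≤ fr E ((X ∪ Y) ∩ Z ∪ X ∩ Y) := by
    apply hp3
    · exact Finset.union_subset (Finset.inter_subset_right.trans hZS)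
        (Finset.inter_subset_left.trans hXS)
    · ext y; simp only [mem_rot h3, Finset.mem_union, Finset.mem_inter, mY, mZ, h3]; tauto
    · simp [mZ, ha, ha1]
    · simp [mZ, hb, hb1]
  have i : 3 ≤ fr E ((X ∪ Y) ∩ Z ∩ (X ∩ Y)) := by
    apply hp3
    · exact Finset.inter_subset_right.trans (Finset.inter_subset_left.trans hXS)
    · ext y; simp only [mem_rot h3, Finset.mem_union, Finset.mem_inter, mY, mZ, h3]; tauto
    · simp [mZ, mY, ha, ha1, ha2]
    · simp [mZ, mY, hb, hb1, hb2]
  omega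

lemma Cov.rot_iff (h3 : ∀ v, γ (γ (γ v)) = v) {F : Finset (Sym2 V)} {e : Sym2 V} :
    Cov γ F (e.map γ) ↔ Cov γ F e := by
  unfold Cov
  rw [map3 h3]
  tauto

lemma Cov.trans (h3 : ∀ v, γ (γ (γ v)) = v) {Q F : Finset (Sym2 V)} {e : Sym2 V}
    (h : Cov γ Q e) (hQ : ∀ q ∈ Q, Cov γ F q) : Cov γ F e := by
  rcases h with h | h | h
  · exact hQ _ h
  · exact (Cov.rot_iff h3).1 (hQ _ h)
  · exact (Cov.rot_iff h3).1 ((Cov.rot_iff h3).1 (hQ _ h))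

lemma cover_card (h3 : ∀ v, γ (γ (γ v)) = v) {Q E : Finset (Sym2 V)}
    (h : ∀ e ∈ E, Cov γ Q e) : E.card ≤ Q.card * 3 := by
  have hs : E ⊆ Q ∪ (Q.image (Sym2.map γ) ∪ (Q.image (Sym2.map γ)).image (Sym2.map γ)) := by
    intro e he
    simp only [Finset.mem_union]
    rcases h e he with h | h | h
    · exact Or.inl h
    · refine Or.inr (Or.inr ?_)
      rw [← map3 h3 e]
      exact Finset.mem_image_of_mem _ (Finset.mem_image_of_mem _ h)
    · refine Or.inr (Or.inl ?_)
      rw [← map3 h3 e]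
      exact Finset.mem_image_of_mem _ h
  have h1 := Finset.card_le_card hs
  have h2 := Finset.card_union_le Q
    (Q.image (Sym2.map γ) ∪ (Q.image (Sym2.map γ)).image (Sym2.map γ))
  have h4 := Finset.card_union_le (Q.image (Sym2.map γ))
    ((Q.image (Sym2.map γ)).image (Sym2.map γ))
  have h5 : (Q.image (Sym2.map γ)).card ≤ Q.card := Finset.card_image_le
  have h6 : ((Q.image (Sym2.map γ)).image (Sym2.map γ)).card ≤ (Q.image (Sym2.map γ)).card :=
    Finset.card_image_le
  omega

lemma cover_card' (h3 : ∀ v, γ (γ (γ v)) = v) {Q E D : Finset (Sym2 V)}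
    (h : ∀ e ∈ E, e ∉ D → Cov γ Q e) : E.card ≤ D.card + Q.card * 3 := by
  have h1 : (E \ D).card ≤ Q.card * 3 := by
    apply cover_card h3
    intro e he
    rw [Finset.mem_sdiff] at he
    exact h e he.1 he.2
  have := Finset.le_card_sdiff D E
  omega

lemma Sol.uniq (h3 : ∀ v, γ (γ (γ v)) = v) (hf : ∀ v, γ v ≠ v) {S A : Finset V}
    {E F : Finset (Sym2 V)} (h : Sol γ S E A F) (e : Sym2 V) (he : e ∈ F) : e.map γ ∉ F := by
  intro he'
  have h1 : E.card ≤ (F.erase (e.map γ)).card * 3 := by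
    apply cover_card h3
    intro d hd
    apply Cov.trans h3 (h.cov d hd)
    intro q hq
    by_cases hqe : q = e.map γ
    · subst hqe
      rw [Cov.rot_iff h3]
      exact Or.inl (Finset.mem_erase.2 ⟨(edge_free h3 hf e).symm, he⟩)
    · exact Or.inl (Finset.mem_erase.2 ⟨hqe, hq⟩)
  rw [Finset.card_erase_of_mem he'] at h1
  have := h.card
  have : 0 < F.card := Finset.card_pos.2 ⟨_, he⟩
  omega

/-- Adding two consecutive vertices of a new orbit. -/
lemma ext_A (h3 : ∀ v, γ (γ (γ v)) = v) (hf : ∀ v, γ v ≠ v) {S S' A : Finset V}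
    (hS : ∀ v ∈ S, γ v ∈ S) {x : V} (hx : x ∈ S)
    (hS' : ∀ y, y ∈ S' ↔ y ∈ S ∧ y ≠ x ∧ y ≠ γ x ∧ y ≠ γ (γ x))
    (hA : A ⊆ S') (two : ∀ v ∈ S', v ∈ A ∨ γ v ∈ A)
    (nthree : ∀ v, ¬ (v ∈ A ∧ γ v ∈ A ∧ γ (γ v) ∈ A)) :
    insert x (insert (γ x) A) ⊆ S ∧
    (∀ v ∈ S, v ∈ insert x (insert (γ x) A) ∨ γ v ∈ insert x (insert (γ x) A)) ∧
    ∀ v, ¬ (v ∈ insert x (insert (γ x) A) ∧ γ v ∈ insert x (insert (γ x) A) ∧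
      γ (γ v) ∈ insert x (insert (γ x) A)) := by
  have f1 := hf x
  have f2 : γ (γ x) ≠ x := fun h => by
    have := h3 x
    rw [h] at this
    exact hf x this
  have f3 : γ (γ x) ≠ γ x := hf _
  have n0 : x ∉ A := fun h => ((hS' _).1 (hA h)).2.1 rfl
  have n1 : γ x ∉ A := fun h => ((hS' _).1 (hA h)).2.2.1 rfl
  have n2 : γ (γ x) ∉ A := fun h => ((hS' _).1 (hA h)).2.2.2 rfl
  have hinj : ∀ y z, γ y = γ z ↔ y = z := fun y z => γ.injective.eq_iff
  refine ⟨?_, ?_, ?_⟩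
  · intro y hy
    simp only [Finset.mem_insert] at hy
    rcases hy with rfl | rfl | hy
    · exact hx
    · exact hS _ hx
    · exact ((hS' _).1 (hA hy)).1
  · intro y hy
    simp only [Finset.mem_insert]
    by_cases hy' : y ∈ S'
    · rcases two y hy' with h | h <;> tauto
    · rw [hS'] at hy'
      by_cases y = x
      · tauto
      · by_cases y = γ x
        · tauto
        · have : y = γ (γ x) := by tauto
          rw [this, h3]; tauto
  · intro y
    simp only [Finset.mem_insert]
    rintro ⟨h0, h1, h2⟩
    rcases h0 with rfl | rfl | h0
    · tauto
    · rw [h3] at h2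
      tauto
    · have k := (hS' _).1 (hA h0)
      have k1 : γ y ∈ A := by
        rcases h1 with h | h | h
        · have := h3 y
          rw [h] at this
          exact absurd this.symm k.2.2.2
        · exact absurd ((hinj _ _).1 h) k.2.1
        · exact h
      have k2 : γ (γ y) ∈ A := by
        rcases h2 with h | h | h
        · have := h3 y
          rw [h] at this
          exact absurd this.symm k.2.2.1
        · have := (hinj _ _).1 h
          rw [this] at k1
          exact absurd k1 n0
        · exact h
      exact nthree y ⟨h0, k1, k2⟩

lemma step0 (h3 : ∀ v, γ (γ (γ v)) = v) (hf : ∀ v, γ v ≠ v) {S S' A : Finset V}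
    {E F : Finset (Sym2 V)} (hg : Good γ S E) {x p y q: V} (hx : x ∈ S)
    (hS' : ∀ y, y ∈ S' ↔ y ∈ S ∧ y ≠ x ∧ y ≠ γ x ∧ y ≠ γ (γ x))
    (hs : Sol γ S' (ins E S') A F)
    (hE' : (ins E S').card + 6 ≤ E.card)
    (hp : p ∈ A) (hxp : s(x, p) ∈ E)
    (hyq : s(y, q) ∈ E) (hy : y = γ x ∧ (q ∈ A ∨ q = x))
    (hc : ∀ e ∈ E, e ∉ ins E S' → Cov γ {s(x, p), s(y, q)} e) :
    ∃ A F, Sol γ S E A F := by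
  obtain ⟨e1, e2, e3⟩ := ext_A h3 hf hg.invS hx hS' hs.subA hs.two hs.nthree
  refine ⟨_, insert s(x, p) (insert s(y, q) F), e1, ?_, e2, e3, ?_, ?_, ?_, ?_⟩
  · intro e he
    simp only [Finset.mem_insert] at he
    rcases he with rfl | rfl | he
    · exact hxp
    · exact hyq
    · exact (mem_ins.1 (hs.subF he)).1
  · intro e he
    simp only [Finset.mem_insert] at he
    rcases he with rfl | rfl | he
    · simp [hp]
    · rw [Finset.mk_mem_sym2_iff]
      rcases hy with ⟨rfl, hq | rfl⟩
      · simp [hq]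
      · simp
    · have := hs.supp e he
      rw [Finset.mem_sym2_iff] at this ⊢
      intro a ha
      simp [this a ha]
  · intro e he
    by_cases h : e ∈ ins E S'
    · apply Cov.trans h3 (hs.cov e h)
      intro q hq
      left; simp [hq]
    · apply Cov.trans h3 (hc e he h)
      intro q hq
      left
      simp only [Finset.mem_insert, Finset.mem_singleton] at hq
      rcases hq with rfl | rfl <;> simp
  · have := hs.card
    have h1 := Finset.card_insert_le s(x, p) (insert s(y, q) F)
    have h2 := Finset.card_insert_le s(y, q) F
    omega
  · obtain ⟨r, hr, hconn⟩ := hs.conn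
    have c : ∀ z ∈ A, Relation.ReflTransGen
        (fun u w => s(u, w) ∈ insert s(x, p) (insert s(y, q) F)) r z := by
      intro z hz
      refine Relation.ReflTransGen.mono ?_ _ _ (hconn z hz)
      intro u w h
      simp [h]
    have cx : Relation.ReflTransGen
        (fun u w => s(u, w) ∈ insert s(x, p) (insert s(y, q) F)) r x :=
      (c p hp).tail (by simp [Sym2.eq_swap])
    refine ⟨r, by simp [hr], ?_⟩
    intro z hz
    simp only [Finset.mem_insert] at hz
    rcases hz with rfl | rfl | hz
    · exact cx
    · obtain ⟨rfl, hq | rfl⟩ := hy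
      · exact (c q hq).tail (by simp [Sym2.eq_swap])
      · exact cx.tail (by simp [Sym2.eq_swap])
    · exact c z hz

/-- One-extension. `t` is the vertex of the orbit of `v` that becomes a leaf. -/
lemma step1 (h3 : ∀ v, γ (γ (γ v)) = v) (hf : ∀ v, γ v ≠ v) {S S' A : Finset V}
    {E E' F : Finset (Sym2 V)} (hg : Good γ S E) {v a b t c : V} (hv : v ∈ S)
    (hS' : ∀ y, y ∈ S' ↔ y ∈ S ∧ y ≠ v ∧ y ≠ γ v ∧ y ≠ γ (γ v))
    (hs : Sol γ S' E' A F)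
    (hE'c : E'.card + 6 ≤ E.card)
    (hE' : ∀ e ∈ E', e ∈ E ∨ e = s(a, b) ∨ e = s(a, b).map γ ∨ e = (s(a, b).map γ).map γ)
    (hE'' : ∀ e ∈ ins E S', e ∈ E')
    (hab : s(a, b) ∉ E)
    (habF : s(a, b) ∈ F)
    (hva : s(v, a) ∈ E) (hvb : s(v, b) ∈ E) (htc : s(t, c) ∈ E) (hcA : c ∈ A)
    (ht : t = γ v ∨ v = γ t)
    (hc : ∀ e ∈ E, e ∉ ins E S' → Cov γ {s(v, a), s(v, b), s(t, c)} e) :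
    ∃ A F, Sol γ S E A F := by
  have haA : a ∈ A ∧ b ∈ A := by
    have := hs.supp _ habF
    rwa [Finset.mk_mem_sym2_iff] at this
  have hinv2 : ∀ e, e.map γ ∈ E → e ∈ E := by
    intro e he
    have := hg.invE _ (hg.invE _ he)
    rwa [map3 h3] at this
  have hext : insert t (insert v A) ⊆ S ∧
    (∀ w ∈ S, w ∈ insert t (insert v A) ∨ γ w ∈ insert t (insert v A)) ∧
    ∀ w, ¬ (w ∈ insert t (insert v A) ∧ γ w ∈ insert t (insert v A) ∧
      γ (γ w) ∈ insert t (insert v A)) := by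
    rcases ht with rfl | rfl
    · rw [Finset.insert_comm]
      exact ext_A h3 hf hg.invS hv hS' hs.subA hs.two hs.nthree
    · refine ext_A h3 hf hg.invS ?_ ?_ hs.subA hs.two hs.nthree
      · have := hg.invS _ (hg.invS _ hv)
        rwa [h3] at this
      · intro y
        rw [hS', h3]
        tauto
  obtain ⟨e1, e2, e3⟩ := hext
  have hu := hs.uniq h3 hf
  refine ⟨_, insert s(v, a) (insert s(v, b) (insert s(t, c) (F.erase s(a, b)))),
    e1, ?_, e2, e3, ?_, ?_, ?_, ?_⟩
  · intro e he
    simp only [Finset.mem_insert, Finset.mem_erase] at he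
    rcases he with rfl | rfl | rfl | ⟨he0, he⟩
    · exact hva
    · exact hvb
    · exact htc
    · rcases hE' e (hs.subF he) with h | h | h | h
      · exact h
      · exact absurd h he0
      · exact absurd (h ▸ he) (hu _ habF)
      · have := hu _ he
        rw [h, map3 h3] at this
        exact absurd habF this
  · intro e he
    simp only [Finset.mem_insert, Finset.mem_erase] at he
    rcases he with rfl | rfl | rfl | ⟨he0, he⟩
    · simp [haA]
    · simp [haA]
    · simp [hcA]
    · have := hs.supp e he
      rw [Finset.mem_sym2_iff] at this ⊢
      intro a ha
      simp [this a ha]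
  · intro e he
    by_cases h : e ∈ ins E S'
    · have hne : ∀ q, q ∈ E → q ∈ F →
          q ∈ insert s(v, a) (insert s(v, b) (insert s(t, c) (F.erase s(a, b)))) := by
        intro q hq hqF
        have : q ≠ s(a, b) := fun h => hab (h ▸ hq)
        simp [this, hqF]
      rcases hs.cov e (hE'' e h) with h | h | h
      · exact Or.inl (hne _ he h)
      · exact Or.inr (Or.inl (hne _ (hg.invE _ he) h))
      · exact Or.inr (Or.inr (hne _ (hg.invE _ (hg.invE _ he)) h))
    · apply Cov.trans h3 (hc e he h)
      intro q hq
      left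
      simp only [Finset.mem_insert, Finset.mem_singleton] at hq
      rcases hq with rfl | rfl | rfl <;> simp
  · have := hs.card
    have h1 := Finset.card_insert_le s(v, a) (insert s(v, b) (insert s(t, c) (F.erase s(a, b))))
    have h2 := Finset.card_insert_le s(v, b) (insert s(t, c) (F.erase s(a, b)))
    have h4 := Finset.card_insert_le s(t, c) (F.erase s(a, b))
    have h5 := Finset.card_erase_of_mem habF
    have : 0 < F.card := Finset.card_pos.2 ⟨_, habF⟩
    omega
  · obtain ⟨r, hr, hconn⟩ := hs.conn
    set F2 := insert s(v, a) (insert s(v, b) (insert s(t, c) (F.erase s(a, b)))) with hF2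
    have k1 : s(v, a) ∈ F2 := by simp [hF2]
    have k2 : s(v, b) ∈ F2 := by simp [hF2]
    have k3 : s(t, c) ∈ F2 := by simp [hF2]
    have c' : ∀ z, Relation.ReflTransGen (fun u w => s(u, w) ∈ F) r z →
        Relation.ReflTransGen (fun u w => s(u, w) ∈ F2) r z := by
      intro z hz
      induction hz with
      | refl => exact Relation.ReflTransGen.refl
      | @tail u w _ huw ih =>
        by_cases h : s(u, w) = s(a, b)
        · rcases Sym2.eq_iff.1 h with ⟨rfl, rfl⟩ | ⟨rfl, rfl⟩
          · exact (ih.tail (show s(u, v) ∈ F2 by rwa [Sym2.eq_swap])).tail k2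
          · exact (ih.tail (show s(u, v) ∈ F2 by rwa [Sym2.eq_swap])).tail k1
        · exact ih.tail (by simp [hF2, huw, h])
    refine ⟨r, by simp [hr], ?_⟩
    intro z hz
    simp only [Finset.mem_insert] at hz
    rcases hz with rfl | rfl | hz
    · exact (c' c (hconn c hcA)).tail (show s(c, z) ∈ F2 by rwa [Sym2.eq_swap])
    · exact (c' a (hconn a haA.1)).tail (show s(a, z) ∈ F2 by rwa [Sym2.eq_swap])
    · exact c' z (hconn z hz)

lemma sparse_add (h3 : ∀ v, γ (γ (γ v)) = v) (hf : ∀ v, γ v ≠ v) {E : Finset (Sym2 V)}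
    (hE : ∀ e ∈ E, e.map γ ∈ E) {S : Finset V} (hS : ∀ v ∈ S, γ v ∈ S) {a b : V}
    (hsp : ∀ X ⊆ S, 2 ≤ X.card → 0 ≤ fr E X)
    (hp : ∀ X ⊆ S, a ∈ X → b ∈ X → 1 ≤ fr E X)
    (X : Finset V) (hXS : X ⊆ S) (hX2 : 2 ≤ X.card) :
    0 ≤ fr (ins E S ∪ {s(a, b), s(a, b).map γ, (s(a, b).map γ).map γ}) X := by
  classical
  set P0 : Finset (Sym2 V) := if a ∈ X ∧ b ∈ X then {s(a, b)} else ∅ with hP0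
  set P1 : Finset (Sym2 V) := if γ a ∈ X ∧ γ b ∈ X then {s(a, b).map γ} else ∅ with hP1
  set P2 : Finset (Sym2 V) :=
    if γ (γ a) ∈ X ∧ γ (γ b) ∈ X then {(s(a, b).map γ).map γ} else ∅ with hP2
  have hsub : ins (ins E S ∪ {s(a, b), s(a, b).map γ, (s(a, b).map γ).map γ}) X ⊆
      ins E X ∪ (P0 ∪ (P1 ∪ P2)) := by
    intro e he
    rw [mem_ins] at he
    obtain ⟨he, heX⟩ := he
    simp only [Finset.mem_union, Finset.mem_insert, Finset.mem_singleton] at he ⊢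
    rcases he with he | rfl | rfl | rfl
    · exact Or.inl (mem_ins.2 ⟨(mem_ins.1 he).1, heX⟩)
    · refine Or.inr (Or.inl ?_)
      rw [hP0, if_pos ⟨heX _ (by simp), heX _ (by simp)⟩]
      simp
    · refine Or.inr (Or.inr (Or.inl ?_))
      rw [hP1, if_pos ⟨heX _ (by simp), heX _ (by simp)⟩]
      simp
    · refine Or.inr (Or.inr (Or.inr ?_))
      rw [hP2, if_pos ⟨heX _ (by simp), heX _ (by simp)⟩]
      simp
  have c0 := Finset.card_le_card hsub
  have c1 := Finset.card_union_le (ins E X) (P0 ∪ (P1 ∪ P2))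
  have c2 := Finset.card_union_le P0 (P1 ∪ P2)
  have c3 := Finset.card_union_le P1 P2
  have hrS : ∀ X ⊆ S, rot γ X ⊆ S := by
    intro X hX y hy
    rw [mem_rot h3] at hy
    have := hS _ (hX hy)
    rwa [h3] at this
  suffices h : (P0.card : ℤ) + P1.card + P2.card ≤ fr E X by
    unfold fr at h ⊢
    omega
  have hX0 := hsp X hXS hX2
  have d0 : P0.card = if a ∈ X ∧ b ∈ X then 1 else 0 := by
    rw [hP0]; split_ifs <;> simp
  have d1 : P1.card = if γ a ∈ X ∧ γ b ∈ X then 1 else 0 := by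
    rw [hP1]; split_ifs <;> simp
  have d2 : P2.card = if γ (γ a) ∈ X ∧ γ (γ b) ∈ X then 1 else 0 := by
    rw [hP2]; split_ifs <;> simp
  rw [d0, d1, d2]
  have key0 := key h3 hf hE hS hp
  have r1 : fr E (rot γ X) = fr E X := fr_rot h3 hE X
  have r2 : fr E (rot γ (rot γ X)) = fr E X := by rw [fr_rot h3 hE, r1]
  have s1 := hrS _ hXS
  have s2 := hrS _ s1
  have q0 := hp X hXS
  have q1 := hp _ s1
  have q2 := hp _ s2
  have k0 := key0 X hXS
  have k1 := key0 _ s1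
  have k2 := key0 _ s2
  simp only [mem_rot h3, h3, r1, r2] at q1 q2 k1 k2
  by_cases t0 : a ∈ X ∧ b ∈ X <;> by_cases t1 : γ a ∈ X ∧ γ b ∈ X <;>
    by_cases t2 : γ (γ a) ∈ X ∧ γ (γ b) ∈ X
  · have := (k0 t0.1 t0.2 t1.1 t1.2).2 t2.1 t2.2
    simpa [t0, t1, t2] using this
  · have := (k0 t0.1 t0.2 t1.1 t1.2).1
    simpa [t0, t1, t2] using this
  · have := (k1 t2.1 t2.2 t0.1 t0.2).1
    simpa [t0, t1, t2] using this
  · have := q0 t0.1 t0.2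
    simpa [t0, t1, t2] using this
  · have := (k2 t1.1 t1.2 t2.1 t2.2).1
    simpa [t0, t1, t2] using this
  · have := q2 t1.1 t1.2
    simpa [t0, t1, t2] using this
  · have := q1 t2.1 t2.2
    simpa [t0, t1, t2] using this
  · simpa [t0, t1, t2] using hX0

lemma ins_mono (E : Finset (Sym2 V)) {X Y : Finset V} (h : X ⊆ Y) : ins E X ⊆ ins E Y := by
  intro e he
  rw [mem_ins] at he ⊢
  exact ⟨he.1, fun a ha => h (he.2 a ha)⟩

lemma ins_disj {E : Finset (Sym2 V)} (nd : ∀ e ∈ E, ¬ e.IsDiag) {X Y : Finset V}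
    (h : (X ∩ Y).card ≤ 1) : Disjoint (ins E X) (ins E Y) := by
  rw [Finset.disjoint_left]
  intro e h1 h2
  rw [mem_ins] at h1 h2
  apply nd e h1.1
  obtain ⟨h1', h1⟩ := h1
  obtain ⟨_, h2⟩ := h2
  induction e with
  | _ x y =>
    rw [Finset.card_le_one] at h
    exact h x (by simp [h1, h2]) y (by simp [h1, h2])

lemma three_tight {E : Finset (Sym2 V)} (nd : ∀ e ∈ E, ¬ e.IsDiag) {S : Finset V}
    {a b c : V} (hac : a ≠ c)
    (hsp : ∀ X ⊆ S, 2 ≤ X.card → 0 ≤ fr E X)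
    (h : ∀ X ⊆ S, a ∈ X → b ∈ X → c ∈ X → 1 ≤ fr E X) :
    (∀ X ⊆ S, a ∈ X → b ∈ X → 1 ≤ fr E X) ∨ (∀ X ⊆ S, b ∈ X → c ∈ X → 1 ≤ fr E X) ∨
    (∀ X ⊆ S, a ∈ X → c ∈ X → 1 ≤ fr E X) := by
  by_contra! hcon
  obtain ⟨⟨X, hX, aX, bX, fX⟩, ⟨Y, hY, bY, cY, fY⟩, ⟨Z, hZ, aZ, cZ, fZ⟩⟩ := hcon
  have aux : ∀ P Q : Finset V, P ⊆ S → Q ⊆ S → a ∈ P ∪ Q → b ∈ P ∪ Q → c ∈ P ∪ Q →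
      fr E P < 1 → fr E Q < 1 → (P ∩ Q).card ≤ 1 := by
    intro P Q hP hQ ha hb hc fP fQ
    by_contra! hlt
    have h1 := hsp (P ∩ Q) (Finset.inter_subset_left.trans hP) hlt
    have h2 := h (P ∪ Q) (Finset.union_subset hP hQ) ha hb hc
    have h4 := fr_sub E P Q
    omega
  have iXY := aux X Y hX hY (by simp [*]) (by simp [*]) (by simp [*]) fX fY
  have iXZ := aux X Z hX hZ (by simp [*]) (by simp [*]) (by simp [*]) fX fZ
  have iYZ := aux Y Z hY hZ (by simp [*]) (by simp [*]) (by simp [*]) fY fZ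
  have dXY := ins_disj nd iXY
  have dXZ := ins_disj nd iXZ
  have dYZ := ins_disj nd iYZ
  have hU := h (X ∪ Y ∪ Z) (Finset.union_subset (Finset.union_subset hX hY) hZ)
    (by simp [*]) (by simp [*]) (by simp [*])
  have hs : ins E X ∪ ins E Y ∪ ins E Z ⊆ ins E (X ∪ Y ∪ Z) := by
    apply Finset.union_subset (Finset.union_subset _ _)
    all_goals apply ins_mono; intro z hz; simp [hz]
  have hc := Finset.card_le_card hs
  rw [Finset.card_union_of_disjoint (Finset.disjoint_union_left.2 ⟨dXZ, dYZ⟩),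
    Finset.card_union_of_disjoint dXY] at hc
  have u1 := Finset.card_union_add_card_inter X Y
  have u2 := Finset.card_union_add_card_inter (X ∪ Y) Z
  have u3 : 0 < (X ∩ Y).card := Finset.card_pos.2 ⟨b, by simp [*]⟩
  have u4 : 1 < ((X ∪ Y) ∩ Z).card :=
    Finset.one_lt_card.2 ⟨a, by simp [*], c, by simp [*], hac⟩
  unfold fr at *
  omega

lemma out_cov (h3 : ∀ v, γ (γ (γ v)) = v) {E : Finset (Sym2 V)} {S S' N : Finset V}
    (hg : Good γ S E) {v : V}
    (hS' : ∀ y, y ∈ S' ↔ y ∈ S ∧ y ≠ v ∧ y ≠ γ v ∧ y ≠ γ (γ v))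
    (hN : ∀ w, w ∈ N ↔ s(v, w) ∈ E) :
    ∀ e ∈ E, e ∉ ins E S' → Cov γ (N.image (fun w => s(v, w))) e := by
  have main : ∀ e ∈ E, v ∈ e → e ∈ N.image (fun w => s(v, w)) := by
    intro e he hv
    obtain ⟨w, rfl⟩ := Sym2.mem_iff_exists.1 hv
    exact Finset.mem_image_of_mem _ ((hN w).2 he)
  intro e he hne
  rw [mem_ins] at hne
  push Not at hne
  obtain ⟨y, hy, hyS'⟩ := hne he
  have hyS : y ∈ S := Finset.mem_sym2_iff.1 (hg.sub e he) y hy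
  rw [hS'] at hyS'
  by_cases h0 : y = v
  · exact Or.inl (main e he (h0 ▸ hy))
  by_cases h1 : y = γ v
  · refine Or.inr (Or.inr (main _ (hg.invE _ (hg.invE _ he)) ?_))
    rw [← h3 v, ← h1]
    exact Sym2.mem_map.2 ⟨_, Sym2.mem_map.2 ⟨_, hy, rfl⟩, rfl⟩
  · have h2 : y = γ (γ v) := by tauto
    refine Or.inr (Or.inl (main _ (hg.invE _ he) ?_))
    rw [← h3 v, ← h2]
    exact Sym2.mem_map.2 ⟨_, hy, rfl⟩

lemma low_deg {E : Finset (Sym2 V)} {S : Finset V} (hg : Good γ S E) :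
    ∃ v ∈ S, (S.filter (fun w => s(v, w) ∈ E)).card ≤ 3 := by
  by_contra! hcon
  have h1 : ∀ v ∈ S, (S.filter (fun w => s(v, w) ∈ E)).card ≤ (E.filter (fun e => v ∈ e)).card := by
    intro v _
    apply Finset.card_le_card_of_injOn (fun w => s(v, w))
    · intro w hw
      simp only [Finset.coe_filter, Set.mem_ofPred_eq] at hw ⊢
      exact ⟨hw.2, by simp⟩
    · intro w _ w' _ h
      exact Sym2.congr_right.1 h
  have h2 : ∑ v ∈ S, (E.filter (fun e => v ∈ e)).card = ∑ e ∈ E, (S.filter (fun v => v ∈ e)).card :=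
    Finset.sum_card_bipartiteAbove_eq_sum_card_bipartiteBelow (fun v e => v ∈ e)
  have h3 : ∀ e ∈ E, (S.filter (fun v => v ∈ e)).card ≤ 2 := by
    intro e _
    induction e with
    | _ x y =>
      refine (Finset.card_le_card (t := {x, y}) ?_).trans Finset.card_le_two
      intro z hz
      simpa using (Finset.mem_filter.1 hz).2
  have h4 : ∑ v ∈ S, 4 ≤ ∑ v ∈ S, (E.filter (fun e => v ∈ e)).card :=
    Finset.sum_le_sum (fun v hv => (hcon v hv).trans_le (h1 v hv))
  have h5 := Finset.sum_le_sum h3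
  rw [h2] at h4
  simp only [Finset.sum_const, smul_eq_mul] at h4 h5
  have := hg.tight
  omega

lemma high_deg {E : Finset (Sym2 V)} {S : Finset V} (hg : Good γ S E) (v : V) (hv : v ∈ S)
    (hc : 3 ≤ S.card) :
    2 ≤ (S.filter (fun w => s(v, w) ∈ E)).card := by
  have h1 : E ⊆ ins E (S.erase v) ∪ (S.filter (fun w => s(v, w) ∈ E)).image (fun w => s(v, w)) := by
    intro e he
    rw [Finset.mem_union]
    have hs := Finset.mem_sym2_iff.1 (hg.sub e he)
    by_cases hve : v ∈ e
    · right
      obtain ⟨w, rfl⟩ := Sym2.mem_iff_exists.1 hve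
      exact Finset.mem_image_of_mem _ (Finset.mem_filter.2 ⟨hs w (by simp), he⟩)
    · left
      rw [mem_ins]
      refine ⟨he, fun a ha => Finset.mem_erase.2 ⟨?_, hs a ha⟩⟩
      rintro rfl
      exact hve ha
  have h2 := Finset.card_le_card h1
  have h3 := Finset.card_union_le (ins E (S.erase v))
    ((S.filter (fun w => s(v, w) ∈ E)).image (fun w => s(v, w)))
  have h4 : ((S.filter (fun w => s(v, w) ∈ E)).image (fun w => s(v, w))).card ≤ _ :=
    Finset.card_image_le
  have h5 := Finset.card_erase_of_mem hv
  have h6 := hg.sparse (S.erase v) (Finset.erase_subset _ _) (by omega)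
  have h7 := hg.tight
  unfold fr at h6
  omega

lemma base (h3 : ∀ v, γ (γ (γ v)) = v) (hf : ∀ v, γ v ≠ v)
    {E : Finset (Sym2 V)} {S : Finset V} (hg : Good γ S E) (v : V) (hv : v ∈ S)
    (hS : ∀ y ∈ S, y = v ∨ y = γ v ∨ y = γ (γ v)) : ∃ A F, Sol γ S E A F := by
  have f1 := hf v
  have f2 : γ (γ v) ≠ v := fun h => by
    have := h3 v
    rw [h] at this
    exact hf v this
  have hv1 := hg.invS _ hv
  have hv2 := hg.invS _ hv1
  have hc : ∀ e ∈ E, Cov γ {s(v, γ v)} e := by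
    intro e he
    have hs := Finset.mem_sym2_iff.1 (hg.sub e he)
    have hd := hg.nd e he
    induction e with
    | _ x y =>
      have hx := hS x (hs x (by simp))
      have hy := hS y (hs y (by simp))
      rw [Sym2.mk_isDiag_iff] at hd
      rcases hx with rfl | rfl | rfl <;> rcases hy with rfl | rfl | rfl <;>
        simp_all [Cov]
  have hS3 : 2 ≤ S.card := Finset.one_lt_card.2 ⟨_, hv1, _, hv, f1⟩
  have hE0 : 0 < E.card := by have := hg.tight; omega
  obtain ⟨e, he⟩ := Finset.card_pos.1 hE0
  have hE : s(v, γ v) ∈ E := by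
    rcases hc e he with h | h | h <;> rw [Finset.mem_singleton] at h <;> rw [← h]
    · exact he
    · exact hg.invE _ he
    · exact hg.invE _ (hg.invE _ he)
  have hx := ext_A (S' := ∅) (A := ∅) h3 hf hg.invS hv (fun y => by
    have := hS y
    simp only [Finset.notMem_empty, false_iff]; tauto) (by simp) (by simp) (by simp)
  refine ⟨_, {s(v, γ v)}, hx.1, by simpa using hE, hx.2.1, hx.2.2, by simp, hc, ?_, ?_⟩
  · have : 3 ≤ S.card := by
      have : ({v, γ v, γ (γ v)} : Finset V).card = 3 :=
        Finset.card_eq_three.2 ⟨_, _, _, f1.symm, f2.symm, (hf _).symm, rfl⟩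
      rw [← this]
      apply Finset.card_le_card
      intro y hy
      simp only [Finset.mem_insert, Finset.mem_singleton] at hy
      rcases hy with rfl | rfl | rfl <;> assumption
    have := hg.tight
    simp
    omega
  · refine ⟨v, by simp, ?_⟩
    intro x hx
    simp only [Finset.mem_insert, Finset.notMem_empty, or_false] at hx
    rcases hx with rfl | rfl
    · exact Relation.ReflTransGen.refl
    · exact Relation.ReflTransGen.single (by simp)

lemma good_of {E E' : Finset (Sym2 V)} {S S' : Finset V} (hg : Good γ S E)
    (hS' : ∀ v ∈ S', γ v ∈ S')
    (hE' : ∀ e ∈ E', e.map γ ∈ E') (hsub : ∀ e ∈ E', e ∈ S'.sym2) (nd : ∀ e ∈ E', ¬ e.IsDiag)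
    (hsp : ∀ X ⊆ S', 2 ≤ X.card → 0 ≤ fr E' X)
    (h2 : 2 ≤ S'.card) (hc : S.card = S'.card + 3) (hcE : E.card ≤ E'.card + 6) :
    Good γ S' E' ∧ E'.card + 6 ≤ E.card := by
  have h := hsp S' subset_rfl h2
  have hi : ins E' S' = E' := by
    ext e
    rw [mem_ins]
    exact ⟨fun h => h.1, fun h => ⟨h, Finset.mem_sym2_iff.1 (hsub e h)⟩⟩
  unfold fr at h
  rw [hi] at h
  have ht := hg.tight
  refine ⟨⟨hS', hE', hsub, nd, hsp, ?_⟩, ?_⟩ <;> omega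

/-- Description of the complement of an orbit. -/
def Compl (γ : Equiv.Perm V) (S S' : Finset V) (v : V) : Prop :=
  ∀ y, y ∈ S' ↔ y ∈ S ∧ y ≠ v ∧ y ≠ γ v ∧ y ≠ γ (γ v)

lemma Compl.rot (h3 : ∀ v, γ (γ (γ v)) = v) {S S' : Finset V} {v : V} (h : Compl γ S S' v) :
    Compl γ S S' (γ v) := by
  intro y
  rw [h y, h3]
  tauto

lemma Compl.inv (h3 : ∀ v, γ (γ (γ v)) = v) {S S' : Finset V} {v : V} (h : Compl γ S S' v)
    (hS : ∀ v ∈ S, γ v ∈ S) : ∀ y ∈ S', γ y ∈ S' := by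
  have hinj : ∀ y z, γ y = γ z ↔ y = z := fun y z => γ.injective.eq_iff
  intro y hy
  rw [h y] at hy
  rw [h]
  refine ⟨hS _ hy.1, ?_, ?_, ?_⟩
  · intro hh
    have := h3 y
    rw [hh] at this
    exact hy.2.2.2 this.symm
  · rw [Ne, hinj]; exact hy.2.1
  · rw [Ne, hinj]; exact hy.2.2.1

lemma step0_full (h3 : ∀ v, γ (γ (γ v)) = v) (hf : ∀ v, γ v ≠ v) {S S' A : Finset V}
    {E F : Finset (Sym2 V)} (hg : Good γ S E) {v a b : V} (hv : v ∈ S)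
    (hS' : Compl γ S S' v)
    (hs : Sol γ S' (ins E S') A F)
    (hE' : (ins E S').card + 6 ≤ E.card)
    (ha : a ∈ S') (hb : b ∈ S') (hva : s(v, a) ∈ E) (hvb : s(v, b) ∈ E)
    (hc : ∀ e ∈ E, e ∉ ins E S' → Cov γ {s(v, a), s(v, b)} e) :
    ∃ A F, Sol γ S E A F := by
  let D : V → V → V → Prop := fun x p q => x ∈ S ∧ Compl γ S S' x ∧ s(x, p) ∈ E ∧ s(x, q) ∈ E ∧
    ∀ e ∈ E, e ∉ ins E S' → Cov γ {s(x, p), s(x, q)} e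
  have swap : ∀ x p q, D x p q → D x q p := by
    rintro x p q ⟨h1, h2, h4, h5, h6⟩
    refine ⟨h1, h2, h5, h4, ?_⟩
    rwa [Finset.pair_comm]
  have rt : ∀ x p q, D x p q → D (γ x) (γ p) (γ q) := by
    rintro x p q ⟨h1, h2, h4, h5, h6⟩
    refine ⟨hg.invS _ h1, h2.rot h3, hg.invE _ h4, hg.invE _ h5, ?_⟩
    intro e he he'
    refine (h6 e he he').trans h3 ?_
    intro d hd
    right; left
    simp only [Finset.mem_insert, Finset.mem_singleton] at hd ⊢
    rcases hd with rfl | rfl <;> simp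
  have go : ∀ x p q, D x p q → p ∈ A → γ q ∈ A → ∃ A F, Sol γ S E A F := by
    rintro x p q ⟨h1, h2, h4, h5, h6⟩ hp hq
    refine step0 (x := x) (p := p) (y := γ x) (q := γ q) h3 hf hg h1 h2 hs hE' hp h4 (hg.invE _ h5)
      ⟨rfl, Or.inl hq⟩ ?_
    intro e he he'
    refine (h6 e he he').trans h3 ?_
    intro d hd
    simp only [Finset.mem_insert, Finset.mem_singleton] at hd
    rcases hd with rfl | rfl
    · left; simp
    · right; left; simp
  have d0 : D v a b := ⟨hv, hS', hva, hvb, hc⟩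
  have d1 := rt _ _ _ d0
  have d2 := rt _ _ _ d1
  have inv := hS'.inv h3 hg.invS
  have a0 := hs.two a ha
  have a1 := hs.two _ (inv _ ha)
  have a2 := hs.two _ (inv _ (inv _ ha))
  have b0 := hs.two b hb
  have b1 := hs.two _ (inv _ hb)
  have b2 := hs.two _ (inv _ (inv _ hb))
  rw [h3] at a2 b2
  by_cases k : a ∈ A
  · by_cases l : γ b ∈ A
    · exact go _ _ _ d0 k l
    · exact go _ _ _ (swap _ _ _ d2) (by tauto) (by rw [h3]; exact k)
  · by_cases l : γ (γ b) ∈ A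
    · exact go _ _ _ d1 (by tauto) l
    · exact go _ _ _ (swap _ _ _ d0) (by tauto) (by tauto)

lemma loop_full (h3 : ∀ v, γ (γ (γ v)) = v) (hf : ∀ v, γ v ≠ v) {S S' A : Finset V}
    {E F : Finset (Sym2 V)} (hg : Good γ S E) {v a : V} (hv : v ∈ S)
    (hS' : Compl γ S S' v)
    (hs : Sol γ S' (ins E S') A F)
    (hE' : (ins E S').card + 6 ≤ E.card)
    (ha : a ∈ S') (hva : s(v, a) ∈ E) (hvv : s(v, γ v) ∈ E)
    (hc : ∀ e ∈ E, e ∉ ins E S' → Cov γ {s(v, a), s(v, γ v)} e) :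
    ∃ A F, Sol γ S E A F := by
  rcases hs.two a ha with h | h
  · refine step0 (x := v) (p := a) (y := γ v) (q := v) h3 hf hg hv hS' hs hE' h hva
      (by rwa [Sym2.eq_swap]) ⟨rfl, Or.inr rfl⟩ ?_
    rwa [Sym2.eq_swap (a := γ v)]
  · refine step0 (x := γ v) (p := γ a) (y := γ (γ v)) (q := γ v) h3 hf hg (hg.invS _ hv)
      (hS'.rot h3) hs hE' h (hg.invE _ hva)
      (by rw [Sym2.eq_swap]; exact hg.invE _ hvv) ⟨rfl, Or.inr rfl⟩ ?_
    intro e he he'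
    refine (hc e he he').trans h3 ?_
    intro d hd
    right; left
    simp only [Finset.mem_insert, Finset.mem_singleton] at hd ⊢
    rcases hd with rfl | rfl <;> simp

lemma step1_full (h3 : ∀ v, γ (γ (γ v)) = v) (hf : ∀ v, γ v ≠ v) {S S' : Finset V}
    {E : Finset (Sym2 V)} (hg : Good γ S E) {v a b c : V} (hv : v ∈ S)
    (hS' : Compl γ S S' v) (h2 : 2 ≤ S'.card) (hcard : S.card = S'.card + 3)
    (ih : ∀ E', Good γ S' E' → ∃ A F, Sol γ S' E' A F)
    (ha : a ∈ S') (hb : b ∈ S') (hcS : c ∈ S') (hab : a ≠ b)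
    (hva : s(v, a) ∈ E) (hvb : s(v, b) ∈ E) (hvc : s(v, c) ∈ E)
    (hc : ∀ e ∈ E, e ∉ ins E S' → Cov γ {s(v, a), s(v, b), s(v, c)} e)
    (hp : ∀ X ⊆ S', a ∈ X → b ∈ X → 1 ≤ fr E X) :
    ∃ A F, Sol γ S E A F := by
  have inv := hS'.inv h3 hg.invS
  have hsubS : S' ⊆ S := fun y hy => ((hS' y).1 hy).1
  have e0 : s(a, b) ∉ E := by
    intro he
    have := hp {a, b} (by intro y hy; simp only [Finset.mem_insert, Finset.mem_singleton] at hy; rcases hy with rfl | rfl <;> assumption)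
      (by simp) (by simp)
    have h1 : 0 < (ins E {a, b}).card :=
      Finset.card_pos.2 ⟨s(a, b), mem_ins.2 ⟨he, by simp⟩⟩
    have h4 : ({a, b} : Finset V).card ≤ 2 := Finset.card_le_two
    unfold fr at this
    omega
  have hinv2 : ∀ e, e.map γ ∈ E → e ∈ E := by
    intro e he
    have := hg.invE _ (hg.invE _ he)
    rwa [map3 h3] at this
  have e1 : s(a, b).map γ ∉ E := fun h => e0 (hinv2 _ h)
  have e2 : (s(a, b).map γ).map γ ∉ E := fun h => e1 (hinv2 _ h)
  set O : Finset (Sym2 V) := {s(a, b), s(a, b).map γ, (s(a, b).map γ).map γ} with hO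
  have hOcard : O.card = 3 := by
    refine Finset.card_eq_three.2 ⟨_, _, _, (edge_free h3 hf _).symm, ?_,
      (edge_free h3 hf _).symm, rfl⟩
    intro h
    have := map3 h3 s(a, b)
    rw [← h] at this
    exact edge_free h3 hf _ this
  have hmem : ∀ e, e ∈ O ↔ e = s(a, b) ∨ e = s(a, b).map γ ∨ e = (s(a, b).map γ).map γ := by
    intro e; simp only [hO, Finset.mem_insert, Finset.mem_singleton]
  have hdisj : Disjoint (ins E S') O := by
    rw [Finset.disjoint_left]
    intro e he heO
    have he := (mem_ins.1 he).1
    rcases (hmem e).1 heO with rfl | rfl | rfl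
    · exact e0 he
    · exact e1 he
    · exact e2 he
  have hcE : E.card ≤ (ins E S' ∪ O).card + 6 := by
    rw [Finset.card_union_of_disjoint hdisj, hOcard]
    have := cover_card' h3 hc
    have h4 : ({s(v, a), s(v, b), s(v, c)} : Finset (Sym2 V)).card ≤ 3 := Finset.card_le_three
    omega
  obtain ⟨hg', hE6⟩ := good_of (E' := ins E S' ∪ O) hg inv (by
      intro e he
      rw [Finset.mem_union] at he ⊢
      rcases he with he | he
      · left
        rw [mem_ins] at he ⊢
        refine ⟨hg.invE _ he.1, ?_⟩
        intro y hy
        obtain ⟨z, hz, rfl⟩ := Sym2.mem_map.1 hy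
        exact inv _ (he.2 z hz)
      · right
        rw [hmem] at he ⊢
        rcases he with rfl | rfl | rfl
        · simp
        · simp
        · left; exact map3 h3 _) (by
      intro e he
      rw [Finset.mem_union] at he
      rcases he with he | he
      · rw [Finset.mem_sym2_iff]
        exact (mem_ins.1 he).2
      · rcases (hmem e).1 he with rfl | rfl | rfl
        · exact Finset.mk_mem_sym2_iff.2 ⟨ha, hb⟩
        · exact Finset.mk_mem_sym2_iff.2 ⟨inv _ ha, inv _ hb⟩
        · exact Finset.mk_mem_sym2_iff.2 ⟨inv _ (inv _ ha), inv _ (inv _ hb)⟩) (by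
      intro e he
      rw [Finset.mem_union] at he
      rcases he with he | he
      · exact hg.nd _ (mem_ins.1 he).1
      · rcases (hmem e).1 he with rfl | rfl | rfl <;> simpa using hab)
    (sparse_add h3 hf hg.invE inv (fun X hX => hg.sparse X (hX.trans hsubS)) hp) h2 hcard hcE
  obtain ⟨A, F, hs⟩ := ih _ hg'
  let D : V → V → V → V → Prop := fun x p q r => x ∈ S ∧ Compl γ S S' x ∧ r ∈ S' ∧
    s(x, p) ∈ E ∧ s(x, q) ∈ E ∧ s(x, r) ∈ E ∧ s(p, q) ∉ E ∧
    (∀ e ∈ ins E S' ∪ O, e ∈ E ∨ e = s(p, q) ∨ e = s(p, q).map γ ∨ e = (s(p, q).map γ).map γ) ∧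
    ∀ e ∈ E, e ∉ ins E S' → Cov γ {s(x, p), s(x, q), s(x, r)} e
  have rt : ∀ x p q r, D x p q r → D (γ x) (γ p) (γ q) (γ r) := by
    rintro x p q r ⟨h1, h2, hr, h4, h5, h5', hpq, hh, h6⟩
    refine ⟨hg.invS _ h1, h2.rot h3, inv _ hr, hg.invE _ h4, hg.invE _ h5, hg.invE _ h5',
      fun h => hpq (hinv2 s(p, q) h), ?_, ?_⟩
    · intro e he
      have := hh e he
      simp only [Sym2.map_mk, h3] at this ⊢
      tauto
    · intro e he he'
      refine (h6 e he he').trans h3 ?_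
      intro d hd
      right; left
      simp only [Finset.mem_insert, Finset.mem_singleton] at hd ⊢
      rcases hd with rfl | rfl | rfl <;> simp
  have go : ∀ x p q r, D x p q r → s(p, q) ∈ F → ∃ A F, Sol γ S E A F := by
    rintro x p q r ⟨h1, h2, hr, h4, h5, h5', hpq, hh, h6⟩ hF
    rcases hs.two _ (inv _ hr) with hrA | hrA
    · refine step1 (v := x) (a := p) (b := q) (t := γ x) (c := γ r) h3 hf hg h1 h2 hs hE6 hh
        (fun e he => Finset.mem_union_left _ he) hpq hF h4 h5 (hg.invE _ h5') hrA (Or.inl rfl) ?_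
      intro e he he'
      refine (h6 e he he').trans h3 ?_
      intro d hd
      simp only [Finset.mem_insert, Finset.mem_singleton] at hd
      rcases hd with rfl | rfl | rfl
      · left; simp
      · left; simp
      · right; left; simp
    · refine step1 (v := x) (a := p) (b := q) (t := γ (γ x)) (c := γ (γ r)) h3 hf hg h1 h2 hs hE6 hh
        (fun e he => Finset.mem_union_left _ he) hpq hF h4 h5 (hg.invE _ (hg.invE _ h5')) hrA
        (Or.inr (h3 x).symm) ?_
      intro e he he'
      refine (h6 e he he').trans h3 ?_
      intro d hd
      simp only [Finset.mem_insert, Finset.mem_singleton] at hd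
      rcases hd with rfl | rfl | rfl
      · left; simp
      · left; simp
      · right; right; simp
  have d0 : D v a b c := ⟨hv, hS', hcS, hva, hvb, hvc, e0, by
    intro e he
    rw [Finset.mem_union, hmem] at he
    rcases he with he | he
    · exact Or.inl (mem_ins.1 he).1
    · exact Or.inr he, hc⟩
  have d1 := rt _ _ _ _ d0
  have d2 := rt _ _ _ _ d1
  rcases hs.cov s(a, b) (Finset.mem_union_right _ ((hmem _).2 (Or.inl rfl))) with h | h | h
  · exact go _ _ _ _ d0 h
  · exact go _ _ _ _ d1 h
  · exact go _ _ _ _ d2 h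

theorem main (h3 : ∀ v, γ (γ (γ v)) = v) (hf : ∀ v, γ v ≠ v) (n : ℕ) :
    ∀ (S : Finset V) (E : Finset (Sym2 V)), S.card = n → Good γ S E → ∃ A F, Sol γ S E A F := by
  induction n using Nat.strong_induction_on with
  | _ n IH =>
  intro S E hn hg
  obtain ⟨v, hv, hd⟩ := low_deg hg
  have f1 := hf v
  have f2 : γ (γ v) ≠ v := fun h => by
    have := h3 v
    rw [h] at this
    exact hf v this
  have hO3 : ({v, γ v, γ (γ v)} : Finset V).card = 3 :=
    Finset.card_eq_three.2 ⟨_, _, _, f1.symm, f2.symm, (hf _).symm, rfl⟩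
  have hOS : ({v, γ v, γ (γ v)} : Finset V) ⊆ S := by
    intro y hy
    simp only [Finset.mem_insert, Finset.mem_singleton] at hy
    have h1 := hg.invS _ hv
    have h2 := hg.invS _ h1
    rcases hy with rfl | rfl | rfl <;> assumption
  obtain ⟨S', hS'def⟩ : ∃ S', S' = S \ {v, γ v, γ (γ v)} := ⟨_, rfl⟩
  have hS' : Compl γ S S' v := by
    intro y
    rw [hS'def, Finset.mem_sdiff]
    simp only [Finset.mem_insert, Finset.mem_singleton]
    tauto
  have hcard : S.card = S'.card + 3 := by
    have := Finset.card_sdiff_add_card_eq_card hOS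
    rw [← hS'def] at this
    omega
  by_cases hne : S' = ∅
  · apply base h3 hf hg v hv
    intro y hy
    have := hS' y
    rw [hne] at this
    simp only [Finset.notMem_empty, false_iff] at this
    tauto
  obtain ⟨w, hw⟩ := Finset.nonempty_iff_ne_empty.2 hne
  have inv := hS'.inv h3 hg.invS
  have hsubS : S' ⊆ S := fun y hy => ((hS' y).1 hy).1
  have h2 : 2 ≤ S'.card := Finset.one_lt_card.2 ⟨_, inv _ hw, _, hw, hf w⟩
  have ih : ∀ E', Good γ S' E' → ∃ A F, Sol γ S' E' A F :=
    fun E' hE' => IH S'.card (by omega) S' E' rfl hE'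
  have hd2 := high_deg hg v hv (by omega)
  obtain ⟨N, hNdef⟩ : ∃ N, N = S.filter (fun w => s(v, w) ∈ E) := ⟨_, rfl⟩
  rw [← hNdef] at hd hd2
  have hN : ∀ w, w ∈ N ↔ s(v, w) ∈ E := by
    intro w
    rw [hNdef, Finset.mem_filter]
    refine ⟨fun h => h.2, fun h => ⟨?_, h⟩⟩
    exact (Finset.mk_mem_sym2_iff.1 (hg.sub _ h)).2
  have hcov := out_cov h3 hg hS' hN
  have hrestr : E.card ≤ (ins E S').card + 6 →
      Good γ S' (ins E S') ∧ (ins E S').card + 6 ≤ E.card := by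
    intro h6
    refine good_of hg inv ?_ ?_ ?_ ?_ h2 hcard h6
    · intro e he
      rw [mem_ins] at he ⊢
      refine ⟨hg.invE _ he.1, ?_⟩
      intro y hy
      obtain ⟨z, hz, rfl⟩ := Sym2.mem_map.1 hy
      exact inv _ (he.2 z hz)
    · intro e he
      rw [Finset.mem_sym2_iff]
      exact (mem_ins.1 he).2
    · intro e he
      exact hg.nd _ (mem_ins.1 he).1
    · intro X hX hX2
      have h1 := hg.sparse X (hX.trans hsubS) hX2
      have h4 : ins (ins E S') X = ins E X := by
        ext e
        simp only [mem_ins]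
        exact ⟨fun h => ⟨h.1.1, h.2⟩, fun h => ⟨⟨h.1, fun a ha => hX (h.2 a ha)⟩, h.2⟩⟩
      unfold fr at h1 ⊢
      rwa [h4]
  have hvN : v ∉ N := by
    rw [hN]
    intro h
    exact hg.nd _ h (by simp)
  by_cases hl : s(v, γ v) ∈ E
  · have hcov2 : ∀ R : Finset V, (∀ y ∈ N, y ∈ S' → y ∈ R) → ∀ e ∈ E, e ∉ ins E S' →
        Cov γ (R.image (fun w => s(v, w)) ∪ {s(v, γ v)}) e := by
      intro R hR e he he'
      refine (hcov e he he').trans h3 ?_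
      intro q hq
      obtain ⟨y, hy, rfl⟩ := Finset.mem_image.1 hq
      by_cases hyS : y ∈ S'
      · left
        exact Finset.mem_union_left _ (Finset.mem_image_of_mem _ (hR y hy hyS))
      · have hyS2 : y ∈ S := (Finset.mk_mem_sym2_iff.1 (hg.sub _ ((hN y).1 hy))).2
        have : y ≠ v := fun h => hvN (h ▸ hy)
        have k : y = γ v ∨ y = γ (γ v) := by
          have := hS' y
          tauto
        rcases k with rfl | rfl
        · left; simp
        · right; left; simp [h3]
    have hNS : (N.filter (· ∈ S')).card ≤ 1 := by
      have h1 : N.filter (· ∈ S') ⊆ (N.erase (γ v)).erase (γ (γ v)) := by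
        intro y hy
        rw [Finset.mem_filter] at hy
        have := (hS' y).1 hy.2
        simp only [Finset.mem_erase]
        tauto
      have h4 := Finset.card_le_card h1
      have m1 : γ v ∈ N := (hN _).2 hl
      have m2 : γ (γ v) ∈ N := by
        rw [hN]
        have := hg.invE _ (hg.invE _ hl)
        simp only [Sym2.map_mk, h3] at this
        rwa [Sym2.eq_swap]
      rw [Finset.card_erase_of_mem (Finset.mem_erase.2 ⟨hf _, m2⟩),
        Finset.card_erase_of_mem m1] at h4
      omega
    have hR := hcov2 (N.filter (· ∈ S')) (fun y h h' => Finset.mem_filter.2 ⟨h, h'⟩)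
    rcases (N.filter (· ∈ S')).eq_empty_or_nonempty with h0 | ⟨a, haN⟩
    · rw [h0] at hR
      have h1 := cover_card' h3 hR
      have h4 := hrestr (by simp at h1; omega)
      simp at h1
      omega
    · have h1 : N.filter (· ∈ S') = {a} := by
        rw [Finset.card_le_one] at hNS
        ext y
        rw [Finset.mem_singleton]
        exact ⟨fun h => hNS _ h _ haN, fun h => h ▸ haN⟩
      rw [h1] at hR
      rw [Finset.mem_filter, hN] at haN
      have hR' : ∀ e ∈ E, e ∉ ins E S' → Cov γ {s(v, a), s(v, γ v)} e := by
        intro e he he'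
        refine (hR e he he').trans h3 ?_
        intro d hd
        left
        simpa using hd
      have h4 := cover_card' h3 hR'
      have h5 : ({s(v, a), s(v, γ v)} : Finset (Sym2 V)).card ≤ 2 := Finset.card_le_two
      obtain ⟨g', h6⟩ := hrestr (by omega)
      obtain ⟨A, F, hs⟩ := ih _ g'
      exact loop_full h3 hf hg hv hS' hs h6 haN.2 haN.1 hl hR'
  · have hNS : ∀ y ∈ N, y ∈ S' := by
      intro y hy
      have hyE := (hN y).1 hy
      have hyS2 : y ∈ S := (Finset.mk_mem_sym2_iff.1 (hg.sub _ hyE)).2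
      rw [hS']
      refine ⟨hyS2, fun h => hvN (h ▸ hy), ?_, ?_⟩
      · rintro rfl
        exact hl hyE
      · rintro rfl
        have := hg.invE _ hyE
        simp only [Sym2.map_mk, h3] at this
        rw [Sym2.eq_swap] at this
        exact hl this
    have hN23 : N.card = 2 ∨ N.card = 3 := by omega
    rcases hN23 with hN2 | hN3
    · obtain ⟨a, b, _, hNab⟩ := Finset.card_eq_two.1 hN2
      have ha : a ∈ N := by simp [hNab]
      have hb : b ∈ N := by simp [hNab]
      rw [hNab] at hcov
      have hc : ∀ e ∈ E, e ∉ ins E S' → Cov γ {s(v, a), s(v, b)} e := by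
        intro e he he'
        refine (hcov e he he').trans h3 ?_
        intro d hd
        left
        simpa [eq_comm] using hd
      have h4 := cover_card' h3 hc
      have h5 : ({s(v, a), s(v, b)} : Finset (Sym2 V)).card ≤ 2 := Finset.card_le_two
      obtain ⟨g', h6⟩ := hrestr (by omega)
      obtain ⟨A, F, hs⟩ := ih _ g'
      exact step0_full h3 hf hg hv hS' hs h6 (hNS _ ha) (hNS _ hb) ((hN _).1 ha) ((hN _).1 hb) hc
    · obtain ⟨a, b, c, hab, hac, hbc, hNabc⟩ := Finset.card_eq_three.1 hN3
      have ha : a ∈ N := by simp [hNabc]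
      have hb : b ∈ N := by simp [hNabc]
      have hc : c ∈ N := by simp [hNabc]
      have hcc : ∀ p q r, N ⊆ {p, q, r} →
          ∀ e ∈ E, e ∉ ins E S' → Cov γ {s(v, p), s(v, q), s(v, r)} e := by
        intro p q r hpqr e he he'
        refine (hcov e he he').trans h3 ?_
        intro d hd
        left
        obtain ⟨y, hy, rfl⟩ := Finset.mem_image.1 hd
        have := hpqr hy
        simp only [Finset.mem_insert, Finset.mem_singleton] at this ⊢
        rcases this with rfl | rfl | rfl <;> simp
      have hthree : ∀ X ⊆ S', a ∈ X → b ∈ X → c ∈ X → 1 ≤ fr E X := by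
        intro X hX aX bX cX
        have hvX : v ∉ X := fun h => ((hS' v).1 (hX h)).2.1 rfl
        have h1 := hg.sparse (insert v X)
          (Finset.insert_subset hv (hX.trans hsubS)) (by
            rw [Finset.card_insert_of_notMem hvX]
            have : 0 < X.card := Finset.card_pos.2 ⟨a, aX⟩
            omega)
        have hsub : ins E X ∪ N.image (fun w => s(v, w)) ⊆ ins E (insert v X) := by
          apply Finset.union_subset
          · exact ins_mono E (Finset.subset_insert _ _)
          · intro d hd
            obtain ⟨y, hy, rfl⟩ := Finset.mem_image.1 hd
            rw [mem_ins]
            refine ⟨(hN y).1 hy, ?_⟩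
            have : y ∈ X := by
              rw [hNabc] at hy
              simp only [Finset.mem_insert, Finset.mem_singleton] at hy
              rcases hy with rfl | rfl | rfl <;> assumption
            simp [this]
        have hdj : Disjoint (ins E X) (N.image (fun w => s(v, w))) := by
          rw [Finset.disjoint_left]
          intro d hd hd'
          obtain ⟨y, hy, rfl⟩ := Finset.mem_image.1 hd'
          exact hvX ((mem_ins.1 hd).2 v (by simp))
        have h4 := Finset.card_le_card hsub
        rw [Finset.card_union_of_disjoint hdj, Finset.card_image_of_injective _
          (fun w w' h => Sym2.congr_right.1 h), hN3] at h4
        unfold fr at h1 ⊢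
        rw [Finset.card_insert_of_notMem hvX] at h1
        omega
      rcases three_tight hg.nd hac (fun X hX => hg.sparse X (hX.trans hsubS)) hthree
        with h | h | h
      · exact step1_full h3 hf hg hv hS' h2 hcard ih (hNS _ ha) (hNS _ hb) (hNS _ hc) hab
          ((hN _).1 ha) ((hN _).1 hb) ((hN _).1 hc)
          (hcc _ _ _ (by rw [hNabc])) h
      · exact step1_full h3 hf hg hv hS' h2 hcard ih (hNS _ hb) (hNS _ hc) (hNS _ ha) hbc
          ((hN _).1 hb) ((hN _).1 hc) ((hN _).1 ha)
          (hcc _ _ _ (by rw [hNabc]; intro y; simp; tauto)) h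
      · exact step1_full h3 hf hg hv hS' h2 hcard ih (hNS _ ha) (hNS _ hc) (hNS _ hb) hac
          ((hN _).1 ha) ((hN _).1 hc) ((hN _).1 hb)
          (hcc _ _ _ (by rw [hNabc]; intro y; simp; tauto)) h

end core

section graphs

lemma forest_card {W : Type*} [Finite W] [Nonempty W] (K : SimpleGraph W) (hK : K.IsAcyclic) :
    K.edgeSet.ncard + 1 ≤ Nat.card W ∧ (K.edgeSet.ncard + 1 = Nat.card W → K.IsTree) := by
  obtain ⟨T, hKT, -, hT⟩ :=
    (SimpleGraph.connected_top (V := W)).exists_isTree_le_of_le_of_isAcyclic le_top hK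
  have h1 := (SimpleGraph.isTree_iff_connected_and_card.1 hT).2
  rw [Nat.card_coe_set_eq] at h1
  have h2 : K.edgeSet ⊆ T.edgeSet := SimpleGraph.edgeSet_mono hKT
  have h3 := Set.ncard_le_ncard h2 (Set.toFinite _)
  refine ⟨by omega, fun h => ?_⟩
  have h4 : K.edgeSet = T.edgeSet := Set.eq_of_subset_of_ncard_le h2 (by omega) (Set.toFinite _)
  rw [SimpleGraph.edgeSet_inj] at h4
  rwa [h4]

lemma sub_edge_card {G : SimpleGraph V} (P : G.Subgraph) :
    P.coe.edgeSet.ncard = P.edgeSet.ncard := by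
  rw [← SimpleGraph.Subgraph.image_coe_edgeSet_coe,
    Set.ncard_image_of_injective _ (Sym2.map.injective Subtype.val_injective)]

lemma sub_tree_card {G : SimpleGraph V} (P : G.Subgraph) (h : P.coe.IsTree) :
    P.edgeSet.ncard + 1 = P.verts.ncard := by
  have h1 := (SimpleGraph.isTree_iff_connected_and_card.1 h).2
  rwa [Nat.card_coe_set_eq, sub_edge_card, Nat.card_coe_set_eq] at h1

lemma sub_forest_card {G : SimpleGraph V} (P T : G.Subgraph) (hP : P ≤ T) (h : T.coe.IsTree)
    (hne : P.verts.Nonempty) :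
    P.edgeSet.ncard + 1 ≤ P.verts.ncard ∧
      (P.edgeSet.ncard + 1 = P.verts.ncard → P.coe.IsTree) := by
  have hac : P.coe.IsAcyclic :=
    h.isAcyclic.comap (SimpleGraph.Subgraph.inclusion hP) (SimpleGraph.Subgraph.inclusion.injective hP)
  have : Nonempty P.verts := hne.to_subtype
  have h1 := forest_card P.coe hac
  rwa [Nat.card_coe_set_eq, sub_edge_card] at h1

lemma sum_verts (X : Fin 3 → Set V) (hX : ∀ v : V, ({i : Fin 3 | v ∈ X i}).ncard = 2)
    (W : Set V) : (W ∩ X 0).ncard + (W ∩ X 1).ncard + (W ∩ X 2).ncard = 2 * W.ncard := by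
  classical
  have h := Finset.sum_card_bipartiteAbove_eq_sum_card_bipartiteBelow
    (s := (Finset.univ : Finset (Fin 3))) (t := W.toFinset) (fun i v => v ∈ X i)
  have h1 : ∀ v ∈ W.toFinset,
      (Finset.bipartiteBelow (fun i v => v ∈ X i) (Finset.univ : Finset (Fin 3)) v).card = 2 := by
    intro v _
    rw [← hX v, Set.ncard_eq_toFinset_card']
    congr 1
    ext i
    simp [Finset.bipartiteBelow]
  rw [Finset.sum_congr rfl h1] at h
  have h2 : ∀ i, (W ∩ X i).ncard =
      (Finset.bipartiteAbove (fun i v => v ∈ X i) W.toFinset i).card := by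
    intro i
    rw [Set.ncard_eq_toFinset_card']
    congr 1
    ext v
    simp [Finset.bipartiteAbove]
  rw [h2, h2, h2]
  rw [Fin.sum_univ_three] at h
  rw [h, Finset.sum_const, Set.ncard_eq_toFinset_card' W]
  simp [mul_comm]

lemma sum_edges {G : SimpleGraph V} (T : Fin 3 → G.Subgraph)
    (hT : ∀ e ∈ G.edgeSet, ∃! i : Fin 3, e ∈ (T i).edgeSet) :
    G.edgeSet.ncard = (T 0).edgeSet.ncard + (T 1).edgeSet.ncard + (T 2).edgeSet.ncard := by
  have hd : ∀ i j, i ≠ j → Disjoint (T i).edgeSet (T j).edgeSet := by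
    intro i j hij
    rw [Set.disjoint_left]
    intro e h1 h2
    exact hij ((hT e ((T i).edgeSet_subset h1)).unique h1 h2)
  have : G.edgeSet = (T 0).edgeSet ∪ (T 1).edgeSet ∪ (T 2).edgeSet := by
    apply Set.Subset.antisymm
    · intro e he
      obtain ⟨i, hi, -⟩ := hT e he
      fin_cases i
      · exact Or.inl (Or.inl hi)
      · exact Or.inl (Or.inr hi)
      · exact Or.inr hi
    · exact Set.union_subset (Set.union_subset (T 0).edgeSet_subset (T 1).edgeSet_subset)
        (T 2).edgeSet_subset
  rw [this, Set.ncard_union_eq (Set.disjoint_union_left.2 ⟨hd _ _ (by decide), hd _ _ (by decide)⟩)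
    (Set.toFinite _) (Set.toFinite _), Set.ncard_union_eq (hd _ _ (by decide))
    (Set.toFinite _) (Set.toFinite _)]

lemma laman_of_partition {G : SimpleGraph V} (T : Fin 3 → G.Subgraph)
    (h : IsProper3Tree2Partition G T) : Laman G := by
  obtain ⟨⟨ht, he, hv⟩, hp⟩ := h
  constructor
  · have h1 := sum_edges T he
    have h2 := sum_verts (fun i => (T i).verts) hv Set.univ
    simp only [Set.univ_inter, Set.ncard_univ, Nat.card_eq_fintype_card] at h2
    have t0 := sub_tree_card _ (ht 0)
    have t1 := sub_tree_card _ (ht 1)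
    have t2 := sub_tree_card _ (ht 2)
    omega
  · intro H hH
    let P : Fin 3 → G.Subgraph := fun i => (T i).induce (H.verts ∩ (T i).verts)
    have hPT : ∀ i, P i ≤ T i := by
      intro i
      refine ⟨Set.inter_subset_right, ?_⟩
      intro x y hxy
      exact hxy.2.2
    have hPv : ∀ i, (P i).verts = H.verts ∩ (T i).verts := fun i => rfl
    have hsub : H.edgeSet ⊆ (P 0).edgeSet ∪ (P 1).edgeSet ∪ (P 2).edgeSet := by
      intro e heH
      obtain ⟨i, hi, -⟩ := he e (H.edgeSet_subset heH)
      have : e ∈ (P i).edgeSet := by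
        induction e with
        | _ x y =>
          rw [SimpleGraph.Subgraph.mem_edgeSet] at hi heH ⊢
          exact ⟨⟨H.edge_vert heH, (T i).edge_vert hi⟩,
            ⟨H.edge_vert heH.symm, (T i).edge_vert hi.symm⟩, hi⟩
      fin_cases i
      · exact Or.inl (Or.inl this)
      · exact Or.inl (Or.inr this)
      · exact Or.inr this
    have c1 := Set.ncard_le_ncard hsub (Set.toFinite _)
    have c2 := Set.ncard_union_le ((P 0).edgeSet ∪ (P 1).edgeSet) (P 2).edgeSet
    have c3 := Set.ncard_union_le (P 0).edgeSet (P 1).edgeSet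
    have c4 := sum_verts (fun i => (T i).verts) hv H.verts
    simp only [← hPv] at c4
    have hf : ∀ i, (P i).verts.Nonempty → _ := fun i => sub_forest_card (P i) (T i) (hPT i) (ht i)
    have hempty : ∀ i, ¬ (P i).verts.Nonempty → (P i).verts.ncard = 0 ∧ (P i).edgeSet.ncard = 0 := by
      intro i hi
      rw [Set.not_nonempty_iff_eq_empty] at hi
      refine ⟨by simp [hi], ?_⟩
      rw [Set.ncard_eq_zero (Set.toFinite _), Set.eq_empty_iff_forall_notMem]
      intro e
      induction e with
      | _ x y =>
        intro hxy
        rw [SimpleGraph.Subgraph.mem_edgeSet] at hxy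
        have := (P i).edge_vert hxy
        rw [hi] at this
        exact this
    have hle : ∀ i, (P i).verts.ncard ≤ H.verts.ncard := fun i =>
      Set.ncard_le_ncard Set.inter_subset_left (Set.toFinite _)
    have heq : ∀ i, H.verts.ncard ≤ (P i).verts.ncard → (P i).verts = H.verts := fun i hi =>
      Set.eq_of_subset_of_ncard_le Set.inter_subset_left hi (Set.toFinite _)
    have hpair : ∀ i j, i ≠ j → H.verts.ncard ≤ (P i).verts.ncard →
        H.verts.ncard ≤ (P j).verts.ncard →
        (P i).edgeSet.ncard + (P j).edgeSet.ncard + 3 ≤ 2 * H.verts.ncard := by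
      intro i j hij hi hj
      have ei := heq i hi
      have ej := heq j hj
      have hne : H.verts.Nonempty := by
        rw [← Set.ncard_pos (Set.toFinite _)]; omega
      have fi := hf i (ei ▸ hne)
      have fj := hf j (ej ▸ hne)
      by_contra! hlt
      have ni := congrArg Set.ncard ei
      have nj := congrArg Set.ncard ej
      exact hp i j hij (P i) (P j) (hPT i) (hPT j) (fi.2 (by omega)) (fj.2 (by omega))
        (by rw [ei]; exact hH) (by rw [ej]; exact hH) (ei.trans ej.symm)
    have l0 := hle 0
    have l1 := hle 1
    have l2 := hle 2
    by_cases h0 : (P 0).verts.Nonempty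
    · by_cases h1 : (P 1).verts.Nonempty
      · by_cases h2 : (P 2).verts.Nonempty
        · have := (hf 0 h0).1
          have := (hf 1 h1).1
          have := (hf 2 h2).1
          omega
        · have := hempty 2 h2
          have := hpair 0 1 (by decide) (by omega) (by omega)
          omega
      · have := hempty 1 h1
        have := hpair 0 2 (by decide) (by omega) (by omega)
        omega
    · have := hempty 0 h0
      have := hpair 1 2 (by decide) (by omega) (by omega)
      omega

lemma free_of_partition {G : SimpleGraph V} (γ : G ≃g G) (T : Fin 3 → G.Subgraph)
    (h : IsC3_3Tree2Partition G γ T) (v : V) : γ v ≠ v := by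
  intro hv
  obtain ⟨⟨-, -, h2⟩, hm⟩ := h
  have step : ∀ i, v ∈ (T i).verts → v ∈ (T (i + 1)).verts := by
    intro i hi
    rw [← hm i]
    exact ⟨v, hi, hv⟩
  have hv2 := h2 v
  have s0 := step 0
  have s1 := step 1
  have s2 := step 2
  simp only [Fin.isValue, Fin.reduceAdd, zero_add] at s0 s1 s2
  by_cases h0 : v ∈ (T 0).verts
  · have : {i : Fin 3 | v ∈ (T i).verts} = Set.univ := by
      ext i; fin_cases i <;> simp <;> tauto
    rw [this] at hv2
    simp at hv2
  · have : {i : Fin 3 | v ∈ (T i).verts} = ∅ := by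
      ext i; fin_cases i <;> simp <;> tauto
    rw [this] at hv2
    simp at hv2

lemma map_tree {G : SimpleGraph V} (γ : G ≃g G) (P : G.Subgraph) (h : P.coe.IsTree) :
    (P.map γ.toHom).coe.IsTree := by
  have hinj : Function.Injective γ := γ.injective
  let f : P.coe ≃g (P.map γ.toHom).coe :=
    { toEquiv := Equiv.Set.image γ P.verts hinj
      map_rel_iff' := by
        rintro ⟨a, ha⟩ ⟨b, hb⟩
        constructor
        · rintro ⟨x, y, hxy, hx, hy⟩
          have hx' : x = a := hinj hx
          have hy' : y = b := hinj hy
          subst hx' hy'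
          exact hxy
        · intro hab
          exact ⟨a, b, hab, rfl, rfl⟩ }
  exact f.isTree_iff.1 h

lemma mem_map_verts {G : SimpleGraph V} (γ : G ≃g G) (h3 : ∀ v, γ (γ (γ v)) = v)
    (P : G.Subgraph) (v : V) : v ∈ (P.map γ.toHom).verts ↔ γ (γ v) ∈ P.verts := by
  constructor
  · rintro ⟨x, hx, rfl⟩
    have : γ (γ (γ x)) ∈ P.verts := by rw [h3]; exact hx
    exact this
  · intro h
    exact ⟨_, h, h3 v⟩

lemma map_map_map {G : SimpleGraph V} (γ : G ≃g G) (h3 : ∀ v, γ (γ (γ v)) = v)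
    (P : G.Subgraph) : ((P.map γ.toHom).map γ.toHom).map γ.toHom = P := by
  have hc : (γ.toHom.comp γ.toHom).comp γ.toHom = SimpleGraph.Hom.id := by
    ext v
    exact h3 v
  rw [← SimpleGraph.Subgraph.map_comp, ← SimpleGraph.Subgraph.map_comp, hc,
    SimpleGraph.Subgraph.map_id]

lemma mem_map_edges {G : SimpleGraph V} (γ : G ≃g G) (h3 : ∀ v, γ (γ (γ v)) = v)
    (P : G.Subgraph) (e : Sym2 V) :
    e ∈ (P.map γ.toHom).edgeSet ↔ (e.map γ).map γ ∈ P.edgeSet := by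
  rw [SimpleGraph.Subgraph.edgeSet_map]
  have key : ∀ e : Sym2 V, ((e.map γ).map γ).map γ = e := by
    intro e
    induction e with
    | _ x y => simp [h3]
  constructor
  · rintro ⟨x, hx, rfl⟩
    have : ((x.map γ).map γ).map γ ∈ P.edgeSet := by rw [key]; exact hx
    exact this
  · intro h
    exact ⟨_, h, key e⟩

lemma proper_of_laman {G : SimpleGraph V} (hL : Laman G) (T : Fin 3 → G.Subgraph)
    (h : Is3Tree2Partition G T) : IsProper3Tree2Partition G T := by
  refine ⟨h, ?_⟩
  intro i j hij Si Sj hi hj ti tj ci cj hv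
  have h1 := sub_tree_card _ ti
  have h2 := sub_tree_card _ tj
  have h3 := hL.2 (Si ⊔ Sj) (by rw [SimpleGraph.Subgraph.verts_sup, hv, Set.union_self]; exact cj)
  rw [SimpleGraph.Subgraph.verts_sup, hv, Set.union_self, SimpleGraph.Subgraph.edgeSet_sup,
    Set.ncard_union_eq _ (Set.toFinite _) (Set.toFinite _)] at h3
  · rw [hv] at h1
    push_cast at h3
    omega
  · rw [Set.disjoint_left]
    intro e he1 he2
    have a := SimpleGraph.Subgraph.edgeSet_mono hi he1
    have b := SimpleGraph.Subgraph.edgeSet_mono hj he2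
    exact hij ((h.2.1 e (Si.edgeSet_subset he1)).unique a b)

lemma good_of_laman {G : SimpleGraph V} (hL : Laman G) (γ : G ≃g G) (E : Finset (Sym2 V))
    (hE : ∀ e, e ∈ E ↔ e ∈ G.edgeSet) : Good γ.toEquiv Finset.univ E where
  invS := fun v _ => Finset.mem_univ _
  invE := by
    intro e he
    rw [hE] at he ⊢
    induction e with
    | _ x y => exact γ.map_adj_iff.2 he
  sub := by
    intro e _
    simp
  nd := fun e he => G.not_isDiag_of_mem_edgeSet ((hE e).1 he)
  sparse := by
    intro X _ hX
    have h := hL.2 ((⊤ : G.Subgraph).induce (X : Set V)) (by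
      simpa [Set.ncard_coe_finset] using hX)
    have he : ((⊤ : G.Subgraph).induce (X : Set V)).edgeSet = (ins E X : Set (Sym2 V)) := by
      ext e
      rw [Finset.mem_coe, mem_ins, hE]
      induction e with
      | _ x y =>
        simp [SimpleGraph.Subgraph.mem_edgeSet]
        tauto
    rw [he, Set.ncard_coe_finset] at h
    simp only [SimpleGraph.Subgraph.induce_verts, Set.ncard_coe_finset] at h
    unfold fr
    linarith
  tight := by
    have : G.edgeSet = (E : Set (Sym2 V)) := by
      ext e; simp [hE]
    have h := hL.1
    rw [this, Set.ncard_coe_finset] at h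
    rw [h]
    simp

lemma exists_partition {G : SimpleGraph V} (hL : Laman G) (γ : G ≃g G)
    (h3 : ∀ v, γ (γ (γ v)) = v) (hf : ∀ v, γ v ≠ v) :
    ∃ T : Fin 3 → G.Subgraph,
        IsC3_3Tree2Partition G γ T ∧ IsProper3Tree2Partition G T := by
  classical
  let E : Finset (Sym2 V) := G.edgeSet.toFinset
  have hE : ∀ e, e ∈ E ↔ e ∈ G.edgeSet := fun e => Set.mem_toFinset
  have hg := good_of_laman hL γ E hE
  have h3' : ∀ v, γ.toEquiv (γ.toEquiv (γ.toEquiv v)) = v := h3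
  have hf' : ∀ v, γ.toEquiv v ≠ v := hf
  obtain ⟨A, F, hS⟩ := main h3' hf' _ _ E rfl hg
  have hFA : ∀ {x y}, s(x, y) ∈ F → x ∈ A ∧ y ∈ A := by
    intro x y h
    have := hS.supp _ h
    simpa using this
  let T0 : G.Subgraph :=
    { verts := A
      Adj := fun x y => s(x, y) ∈ F
      adj_sub := fun {x y} h => (hE s(x, y)).1 (hS.subF h)
      edge_vert := fun h => (hFA h).1
      symm := ⟨fun x y h => by rw [Sym2.eq_swap]; exact h⟩ }
  have hTv : ∀ v, v ∈ T0.verts ↔ v ∈ A := fun v => Iff.rfl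
  have hTe : ∀ e, e ∈ T0.edgeSet ↔ e ∈ F := by
    intro e
    induction e with
    | _ x y => exact Iff.rfl
  let T : Fin 3 → G.Subgraph := ![T0, T0.map γ.toHom, (T0.map γ.toHom).map γ.toHom]
  have hv0 : ∀ v, v ∈ (T 0).verts ↔ v ∈ A := hTv
  have hv1 : ∀ v, v ∈ (T 1).verts ↔ γ (γ v) ∈ A := fun v => mem_map_verts γ h3 T0 v
  have hv2 : ∀ v, v ∈ (T 2).verts ↔ γ v ∈ A := fun v => by
    have := (mem_map_verts γ h3 (T0.map γ.toHom) v).trans (mem_map_verts γ h3 T0 _)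
    rw [h3] at this
    exact this
  have he0 : ∀ e, e ∈ (T 0).edgeSet ↔ e ∈ F := hTe
  have he1 : ∀ e, e ∈ (T 1).edgeSet ↔ (e.map γ).map γ ∈ F := fun e =>
    (mem_map_edges γ h3 T0 e).trans (hTe _)
  have he2 : ∀ e, e ∈ (T 2).edgeSet ↔ e.map γ ∈ F := fun e => by
    have := ((mem_map_edges γ h3 (T0.map γ.toHom) e).trans (mem_map_edges γ h3 T0 _)).trans (hTe _)
    have k : (((e.map γ).map γ).map γ).map γ = e.map γ := by
      induction e with
      | _ x y => simp [h3]
    rw [k] at this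
    exact this
  have hrot : ∀ i : Fin 3, (T i).map γ.toHom = T (i + 1) := by
    intro i
    fin_cases i
    · rfl
    · rfl
    · exact map_map_map γ h3 T0
  have htwo : ∀ v : V, ({i : Fin 3 | v ∈ (T i).verts}).ncard = 2 := by
    intro v
    have n := hS.nthree v
    have a := hS.two v (Finset.mem_univ _)
    have b := hS.two (γ v) (Finset.mem_univ _)
    have c := hS.two (γ (γ v)) (Finset.mem_univ _)
    change ¬ (v ∈ A ∧ γ v ∈ A ∧ γ (γ v) ∈ A) at n
    change v ∈ A ∨ γ v ∈ A at a
    change γ v ∈ A ∨ γ (γ v) ∈ A at b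
    change γ (γ v) ∈ A ∨ γ (γ (γ v)) ∈ A at c
    rw [h3] at c
    have key : ∀ i j : Fin 3, i ≠ j → {i : Fin 3 | v ∈ (T i).verts} = {i, j} →
        ({i : Fin 3 | v ∈ (T i).verts}).ncard = 2 := by
      intro i j hij h
      rw [h, Set.ncard_pair hij]
    have m0 := hv0 v
    have m1 := hv1 v
    have m2 := hv2 v
    by_cases p : v ∈ A
    · by_cases q : γ v ∈ A
      · apply key 0 2 (by decide)
        ext i
        fin_cases i <;> simp [m0, m1, m2] <;> tauto
      · apply key 0 1 (by decide)
        ext i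
        fin_cases i <;> simp [m0, m1, m2] <;> tauto
    · apply key 1 2 (by decide)
      ext i
      fin_cases i <;> simp [m0, m1, m2] <;> tauto
  have huniq : ∀ e ∈ G.edgeSet, ∃! i : Fin 3, e ∈ (T i).edgeSet := by
    intro e he
    have c := hS.cov e ((hE e).2 he)
    have u : ∀ e ∈ F, e.map γ ∉ F := fun e he => hS.uniq h3' hf' e he
    have k : ((e.map γ).map γ).map γ = e := by
      induction e with
      | _ x y => simp [h3]
    have u0 := u e
    have u1 := u (e.map γ)
    have u2 := u ((e.map γ).map γ)
    rw [k] at u2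
    change e ∈ F ∨ e.map γ ∈ F ∨ (e.map γ).map γ ∈ F at c
    have m0 := he0 e
    have m1 := he1 e
    have m2 := he2 e
    rcases c with c | c | c
    · refine ⟨0, m0.2 c, fun i hi => ?_⟩
      fin_cases i
      · rfl
      · exact absurd c (u2 (m1.1 hi))
      · exact absurd (m2.1 hi) (u0 c)
    · refine ⟨2, m2.2 c, fun i hi => ?_⟩
      fin_cases i
      · exact absurd c (u0 (m0.1 hi))
      · exact absurd (m1.1 hi) (u1 c)
      · rfl
    · refine ⟨1, m1.2 c, fun i hi => ?_⟩
      fin_cases i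
      · exact absurd (m0.1 hi) (u2 c)
      · rfl
      · exact absurd c (u1 (m2.1 hi))
  have htree0 : T0.coe.IsTree := by
    rw [SimpleGraph.isTree_iff_connected_and_card]
    constructor
    · obtain ⟨r, hr, hc⟩ := hS.conn
      have reach : ∀ x, Relation.ReflTransGen (fun x y => s(x, y) ∈ F) r x →
          ∃ hx : x ∈ T0.verts, T0.coe.Reachable ⟨r, hr⟩ ⟨x, hx⟩ := by
        intro x h
        induction h with
        | refl => exact ⟨hr, SimpleGraph.Reachable.refl _⟩
        | @tail b c _ hbc ih =>
          obtain ⟨hb, ih⟩ := ih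
          refine ⟨(hFA hbc).2, ih.trans ?_⟩
          apply SimpleGraph.Adj.reachable
          exact hbc
      have : Nonempty T0.verts := ⟨⟨r, hr⟩⟩
      refine ⟨fun x y => ?_⟩
      obtain ⟨_, hx⟩ := reach x.1 (hc x.1 x.2)
      obtain ⟨_, hy⟩ := reach y.1 (hc y.1 y.2)
      exact hx.symm.trans hy
    · rw [Nat.card_coe_set_eq, sub_edge_card, Nat.card_coe_set_eq]
      have e1 : T0.edgeSet = (F : Set (Sym2 V)) := by
        ext e; exact hTe e
      have e2 : T0.verts = (A : Set V) := rfl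
      have s := sum_verts (fun i => (T i).verts) htwo Set.univ
      simp only [Set.univ_inter, Set.ncard_univ, Nat.card_eq_fintype_card] at s
      have n1 : ∀ P : G.Subgraph, (P.map γ.toHom).verts.ncard = P.verts.ncard := fun P =>
        Set.ncard_image_of_injective P.verts γ.injective
      have q0 : (T 0).verts.ncard = A.card := by
        change (A : Set V).ncard = _
        rw [Set.ncard_coe_finset]
      have q1 : (T 1).verts.ncard = A.card := (n1 T0).trans q0
      have q2 : (T 2).verts.ncard = A.card := (n1 _).trans q1
      rw [e1, e2, Set.ncard_coe_finset, Set.ncard_coe_finset]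
      have c1 := cover_card h3' hS.cov
      have c2 := hS.card
      have c3 := hg.tight
      rw [Finset.card_univ] at c3
      omega
  have hP : Is3Tree2Partition G T := by
    refine ⟨?_, huniq, htwo⟩
    intro i
    fin_cases i
    · exact htree0
    · exact map_tree γ _ htree0
    · exact map_tree γ _ (map_tree γ _ htree0)
  exact ⟨T, ⟨hP, hrot⟩, proper_of_laman hL T hP⟩

end graphs

/-- `G` (with `|V(G)| ≥ 3` and automorphism `γ` with `γ³ = id`) satisfies the Laman
conditions with `γ` fixing no vertex if and only if `G` has a proper `(C₃, γ)`
3Tree2 partition. -/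
theorem c3_laman_iff_3Tree2 {V : Type*} [Fintype V] [DecidableEq V]
    (G : SimpleGraph V) (hV : 3 ≤ Fintype.card V)
    (γ : G ≃g G) (hγ3 : ∀ v, γ (γ (γ v)) = v) :
    (Laman G ∧ ∀ v, γ v ≠ v) ↔
      ∃ T : Fin 3 → G.Subgraph,
        IsC3_3Tree2Partition G γ T ∧ IsProper3Tree2Partition G T := by
  constructor
  · rintro ⟨hL, hf⟩
    exact exists_partition hL γ hγ3 hf
  · rintro ⟨T, h1, h2⟩
    exact ⟨laman_of_partition T h2, free_of_partition γ T h1⟩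

end C3Laman
end
end
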